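/- arXiv:2011.07890 — 2 statements merged into one kernel-verified Lean document; each statement's English description precedes it below -/
import Mathlib

section
/- Fix a real α≥0 and take η=θ=1. Then for all 0<x<1 and 0<y<1, K_he(x,y) = ∫_0^1 J_α(2√(ux))·J_α(2√(uy)) du, where J_α is the Bessel function of the first kind, J_α(t)=∑_{k≥0}(−1)^k (t/2)^{2k+α}/(k!·Γ(k+α+1)) for t>0. -/
open MeasureTheory Filter Topology Set

noncomputable section



/-- An `(M,N)`-based plane partition, with 0-based indices: the entry `part i j`
corresponds to `Λ_{i+1,j+1}`. -/
structure PlanePartition (M N : ℕ∞) where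
  part : ℕ → ℕ → ℕ
  antitone_fst : ∀ i j, part (i + 1) j ≤ part i j
  antitone_snd : ∀ i j, part i (j + 1) ≤ part i j
  supp_fst : ∀ i j : ℕ, M ≤ (i : ℕ∞) → part i j = 0
  supp_snd : ∀ i j : ℕ, N ≤ (j : ℕ∞) → part i j = 0
  finite_supp : {p : ℕ × ℕ | part p.1 p.2 ≠ 0}.Finite

/-- Left volume: sum of the entries strictly to the left of the diagonal. -/
def PlanePartition.leftVol {M N : ℕ∞} (Λ : PlanePartition M N) : ℕ :=
  ∑ᶠ p : ℕ × ℕ, if p.2 < p.1 then Λ.part p.1 p.2 else 0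

/-- Central volume (trace): sum of the diagonal entries. -/
def PlanePartition.centralVol {M N : ℕ∞} (Λ : PlanePartition M N) : ℕ :=
  ∑ᶠ i : ℕ, Λ.part i i

/-- Right volume: sum of the entries strictly to the right of the diagonal. -/
def PlanePartition.rightVol {M N : ℕ∞} (Λ : PlanePartition M N) : ℕ :=
  ∑ᶠ p : ℕ × ℕ, if p.1 < p.2 then Λ.part p.1 p.2 else 0

/-- The Muttalib–Borodin weight `Q^{left vol} (a √(Q Q̃))^{central vol} Q̃^{right vol}`,
where `Q = q^η` and `Q̃ = q^θ`. -/
def mbWeight (q a η θ : ℝ) {M N : ℕ∞} (Λ : PlanePartition M N) : ℝ :=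
  (q ^ η) ^ Λ.leftVol * (a * Real.sqrt ((q ^ η) * (q ^ θ))) ^ Λ.centralVol *
    (q ^ θ) ^ Λ.rightVol

/-- The probability of the event `E` under the Muttalib–Borodin measure on
`(M,N)`-based plane partitions. -/
def mbProb (q a η θ : ℝ) (M N : ℕ∞) (E : Set (PlanePartition M N)) : ℝ :=
  (∑' Λ : E, mbWeight q a η θ Λ.1) / (∑' Λ : PlanePartition M N, mbWeight q a η θ Λ)

/-- The Fredholm series `det(1-K)_{L²(X)}
  = 1 + ∑_{m ≥ 1} ((-1)^m/m!) ∫_{X^m} det[K(x_i,x_j)] dx₁⋯dx_m`. -/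
def fredholmDet (K : ℝ → ℝ → ℂ) (X : Set ℝ) : ℂ :=
  1 + ∑' m : ℕ,
    ((-1 : ℂ) ^ (m + 1) / (m + 1).factorial) *
      ∫ x : Fin (m + 1) → ℝ in {x | ∀ i, x i ∈ X},
        Matrix.det (Matrix.of fun i j => K (x i) (x j))

/-- `F_he(ζ) = Γ(α/(2η) - ζ/η + 1/2) / Γ(α/(2θ) + ζ/θ + 1/2)`. -/
def Fhe (α η θ : ℝ) (ζ : ℂ) : ℂ :=
  Complex.Gamma (α / (2 * η) - ζ / η + 1 / 2) / Complex.Gamma (α / (2 * θ) + ζ / θ + 1 / 2)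

/-- The hard-edge kernel `K_he(x,y)`, a double contour integral over the vertical lines
`δ + iℝ` (in `ζ`) and `-δ + iℝ` (in `ω`), with the (valid) choice `δ = min(η,θ)/4`. -/
def Khe (α η θ : ℝ) (x y : ℝ) : ℂ :=
  (((x * y) ^ (-(1 / 2) : ℝ) : ℝ) : ℂ) * ((2 * Real.pi * Complex.I) ^ 2)⁻¹ *
    ∫ t : ℝ, (∫ s : ℝ,
      (Fhe α η θ (min η θ / 4 + t * Complex.I) / Fhe α η θ (-(min η θ / 4) + s * Complex.I)) *
        (x : ℂ) ^ (min η θ / 4 + t * Complex.I) * (y : ℂ) ^ (-(-(min η θ / 4) + s * Complex.I)) /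
        ((min η θ / 4 + t * Complex.I) - (-(min η θ / 4) + s * Complex.I)) * Complex.I) *
      Complex.I

/-- `K̃_he(x,y) = e^{-x/2-y/2} K_he(e^{-x}, e^{-y})`. -/
def Kthe (α η θ : ℝ) (x y : ℝ) : ℂ :=
  Real.exp (-x / 2 - y / 2) * Khe α η θ (Real.exp (-x)) (Real.exp (-y))




/-- The infinite q-Pochhammer symbol `(x;u)_∞ = ∏_{i ≥ 0} (1 - x u^i)` in `ℂ`. -/
def qPochInf (x u : ℂ) : ℂ := ∏' i : ℕ, (1 - x * u ^ i)

/-- The point `r e^{iφ}` on the circle of radius `r`. -/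
def zCirc (r φ : ℝ) : ℂ := (r : ℂ) * Complex.exp (φ * Complex.I)

/-- `F_d(z) = (√a Q̃^{1/2}/z; Q̃)_∞ / (√a Q^{1/2} z; Q)_∞` with `Q = q^η`, `Q̃ = q^θ`
(the case `M = N = ∞`). -/
def Fd (q a η θ : ℝ) (z : ℂ) : ℂ :=
  qPochInf (((Real.sqrt a * (q ^ θ) ^ ((1 : ℝ) / 2) : ℝ) : ℂ) / z) ((q ^ θ : ℝ) : ℂ) /
    qPochInf (((Real.sqrt a * (q ^ η) ^ ((1 : ℝ) / 2) : ℝ) : ℂ) * z) ((q ^ η : ℝ) : ℂ)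

/-- A (valid) choice of the contour parameter `δ` for the discrete kernel:
`√a Q̃^{1/2} < 1 - δ` and `(1 + δ) √a Q^{1/2} < 1`. -/
def ddelta (q a η θ : ℝ) : ℝ :=
  min ((1 - Real.sqrt a * (q ^ θ) ^ ((1 : ℝ) / 2)) / 2)
    (((Real.sqrt a * (q ^ η) ^ ((1 : ℝ) / 2))⁻¹ - 1) / 2)

/-- The discrete kernel `K_d(k,ℓ)` with `M = N = ∞`, evaluated at the half-integers
`k = κ + 1/2` and `ℓ = l + 1/2`; note that then `z^{-k+1/2} = z^{-κ}` and
`w^{ℓ+1/2} = w^{l+1}` are integer powers. -/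
def Kd (q a η θ : ℝ) (κ l : ℤ) : ℂ :=
  ((2 * Real.pi : ℂ) ^ 2)⁻¹ *
    ∫ φ in Set.Ioc (-Real.pi) Real.pi, ∫ ψ in Set.Ioc (-Real.pi) Real.pi,
      Fd q a η θ (zCirc (1 + ddelta q a η θ) φ) / Fd q a η θ (zCirc (1 - ddelta q a η θ) ψ) *
        zCirc (1 + ddelta q a η θ) φ ^ (-κ) * zCirc (1 - ddelta q a η θ) ψ ^ (l + 1) /
        (zCirc (1 + ddelta q a η θ) φ - zCirc (1 - ddelta q a η θ) ψ)

/-- The Airy kernel, as a double contour integral over the vertical lines `1 + iℝ`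
(in `ζ`) and `-1 + iℝ` (in `ω`). -/
def airyKernel (x y : ℝ) : ℂ :=
  ((2 * Real.pi * Complex.I) ^ 2)⁻¹ *
    ∫ t : ℝ, (∫ s : ℝ,
      Complex.exp ((1 + t * Complex.I) ^ 3 / 3 - x * (1 + t * Complex.I)) *
        Complex.exp (-(-1 + s * Complex.I) ^ 3 / 3 + y * (-1 + s * Complex.I)) /
        ((1 + t * Complex.I) - (-1 + s * Complex.I)) * Complex.I) * Complex.I

/-- The dilogarithm `Li₂(t) = ∑_{k ≥ 1} t^k / k²`. -/
def Li2 (t : ℝ) : ℝ := ∑' k : ℕ, t ^ (k + 1) / ((k : ℝ) + 1) ^ 2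

/-- The saddle point `z_c` associated to `(a, η, θ)` (with `b = √a`). -/
def zc (a η θ : ℝ) : ℝ :=
  (Real.sqrt a * (θ - η) + Real.sqrt (4 * η * θ + a * (θ - η) ^ 2)) / (2 * θ)

/-- `v_c = -η⁻¹ log(1 - b z_c) - θ⁻¹ log(1 - b / z_c)`; this is the constant `c₁`. -/
def vc (a η θ : ℝ) : ℝ :=
  -η⁻¹ * Real.log (1 - Real.sqrt a * zc a η θ) - θ⁻¹ * Real.log (1 - Real.sqrt a / zc a η θ)

/-- The action `S(z) = η⁻¹ Li₂(b z) - θ⁻¹ Li₂(b / z) - v_c log z`. -/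
def Sfun (a η θ : ℝ) (z : ℝ) : ℝ :=
  η⁻¹ * Li2 (Real.sqrt a * z) - θ⁻¹ * Li2 (Real.sqrt a / z) - vc a η θ * Real.log z

/-- The constant `c₂ = ((1/2) ((z d/dz)³ S)(z_c))^{1/3}`. -/
def c2const (a η θ : ℝ) : ℝ :=
  ((1 / 2) * ((fun f : ℝ → ℝ => fun z => z * deriv f z)^[3] (Sfun a η θ)) (zc a η θ)) ^
    ((1 : ℝ) / 3)

/-- The finite q-Pochhammer symbol `(x;u)_n = ∏_{0 ≤ i < n} (1 - x u^i)` in `ℝ`. -/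
def qPoch (x u : ℝ) (n : ℕ) : ℝ := ∏ i ∈ Finset.range n, (1 - x * u ^ i)

/-- The density (unnormalized) of the continuous Muttalib–Borodin ensemble. -/
def mbDensity (α η θ : ℝ) (M N : ℕ) (x : Fin M → ℝ) : ℝ :=
  (∏ i : Fin M, ∏ j : Fin M,
      if i < j then (x j ^ η - x i ^ η) * (x j ^ θ - x i ^ θ) else 1) *
    ∏ i : Fin M, x i ^ (α + (η + θ) / 2 - 1) * (1 - x i ^ θ) ^ (N - M)

/-- The probability of the event `E` under the continuous Muttalib–Borodin ensemble with
parameters `(α, η, θ, M, N)`, defined as a ratio of integrals over ordered tuples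
`0 < x₁ < ⋯ < x_M < 1`. -/
def contMBProb (α η θ : ℝ) (M N : ℕ) (E : Set (Fin M → ℝ)) : ℝ :=
  (∫ x in {x : Fin M → ℝ | (∀ i, 0 < x i ∧ x i < 1) ∧ StrictMono x ∧ x ∈ E},
      mbDensity α η θ M N x) /
    ∫ x in {x : Fin M → ℝ | (∀ i, 0 < x i ∧ x i < 1) ∧ StrictMono x},
      mbDensity α η θ M N x

/-- A step of a ↘-path: one coordinate increases by exactly 1. -/
def DRStep (p q : ℕ × ℕ) : Prop :=
  (q.1 = p.1 + 1 ∧ q.2 = p.2) ∨ (q.1 = p.1 ∧ q.2 = p.2 + 1)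

/-- A step of a ↗-path: the first coordinate decreases by 1, or the second increases by 1. -/
def URStep (p q : ℕ × ℕ) : Prop :=
  (q.1 + 1 = p.1 ∧ q.2 = p.2) ∨ (q.1 = p.1 ∧ q.2 = p.2 + 1)

/-- Bessel function of the first kind (series form), for `t > 0`. -/
def besselJ (α t : ℝ) : ℝ :=
  ∑' k : ℕ, (-1 : ℝ) ^ k * (t / 2) ^ (2 * (k : ℝ) + α) /
    ((k.factorial : ℝ) * Real.Gamma ((k : ℝ) + α + 1))


lemma aux_norm_sq (p s : ℝ) : ‖(p : ℂ) + s * Complex.I‖ ^ 2 = p ^ 2 + s ^ 2 := by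
  rw [Complex.sq_norm, Complex.normSq_add_mul_I]

lemma aux_gs_norm (x t : ℝ) (n : ℕ) (hn : n ≠ 0) :
    ‖Complex.GammaSeq (x + t * Complex.I) n‖ =
      (n : ℝ) ^ x * n.factorial / ∏ j ∈ Finset.range (n + 1), ‖((x + j : ℝ) : ℂ) + t * Complex.I‖ := by
  unfold Complex.GammaSeq
  rw [norm_div, norm_mul, norm_prod]
  congr 1
  · congr 1
    · have : (n : ℂ) = ((n : ℝ) : ℂ) := by push_cast; rfl
      rw [this, Complex.norm_cpow_eq_rpow_re_of_pos (by positivity)]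
      simp
    · simp
  · refine Finset.prod_congr rfl fun j _ => ?_
    congr 1
    push_cast; ring

lemma aux_gs_norm' (x : ℝ) (hx : 0 < x) (n : ℕ) (hn : n ≠ 0) :
    ‖Complex.GammaSeq x n‖ =
      (n : ℝ) ^ x * n.factorial / ∏ j ∈ Finset.range (n + 1), (x + j) := by
  have h := aux_gs_norm x 0 n hn
  simp only [Complex.ofReal_zero, zero_mul, add_zero] at h
  rw [h]
  congr 1
  refine Finset.prod_congr rfl fun j _ => ?_
  rw [Complex.norm_real, Real.norm_of_nonneg (by positivity)]

lemma aux_gs_lim (z : ℂ) : Tendsto (fun n => ‖Complex.GammaSeq z n‖) atTop (𝓝 ‖Complex.Gamma z‖) :=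
  (Complex.GammaSeq_tendsto_Gamma z).norm

lemma aux_gs_lim' (x : ℝ) (hx : 0 < x) :
    Tendsto (fun n => ‖Complex.GammaSeq x n‖) atTop (𝓝 (Real.Gamma x)) := by
  have := aux_gs_lim x
  rwa [Complex.Gamma_ofReal, Complex.norm_real, Real.norm_of_nonneg (Real.Gamma_pos_of_pos hx).le] at this

/-- monotonicity of `|Γ(x+it)|/Γ(x)` -/
lemma aux_gamma_mono (x c t : ℝ) (hx : 0 < x) (hc : 0 ≤ c) :
    ‖Complex.Gamma (x + t * Complex.I)‖ * Real.Gamma (x + c) ≤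
      ‖Complex.Gamma ((x + c : ℝ) + t * Complex.I)‖ * Real.Gamma x := by
  refine le_of_tendsto_of_tendsto ((aux_gs_lim _).mul (aux_gs_lim' (x + c) (by linarith)))
    ((aux_gs_lim _).mul (aux_gs_lim' x hx)) ?_
  filter_upwards [eventually_ne_atTop 0] with n hn
  have hP : ∀ w : ℝ, 0 < w → 0 < ∏ j ∈ Finset.range (n + 1), (w + j) := fun w hw =>
    Finset.prod_pos fun j _ => by positivity
  have hQ : ∀ w : ℝ, 0 < w →
      0 < ∏ j ∈ Finset.range (n + 1), ‖((w + j : ℝ) : ℂ) + t * Complex.I‖ := fun w hw =>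
    Finset.prod_pos fun j _ => by
      apply norm_pos_iff.mpr
      intro h
      have := congrArg Complex.re h
      simp at this
      have : (0:ℝ) ≤ j := by positivity
      linarith
  have hxc : 0 < x + c := by linarith
  rw [aux_gs_norm x t n hn, aux_gs_norm (x + c) t n hn, aux_gs_norm' x hx n hn,
    aux_gs_norm' (x + c) hxc n hn]
  rw [div_mul_div_comm, div_mul_div_comm,
    mul_comm ((n : ℝ) ^ x * n.factorial) ((n : ℝ) ^ (x + c) * n.factorial)]
  have key : (∏ j ∈ Finset.range (n + 1), ‖((x + c + j : ℝ) : ℂ) + t * Complex.I‖) *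
      (∏ j ∈ Finset.range (n + 1), (x + j)) ≤
      (∏ j ∈ Finset.range (n + 1), ‖((x + j : ℝ) : ℂ) + t * Complex.I‖) *
      (∏ j ∈ Finset.range (n + 1), (x + c + j)) := by
    rw [← Finset.prod_mul_distrib, ← Finset.prod_mul_distrib]
    refine Finset.prod_le_prod (fun j _ => by positivity) fun j _ => ?_
    have hj : (0:ℝ) ≤ j := by positivity
    refine le_of_sq_le_sq ?_ (by positivity)
    rw [mul_pow, mul_pow, aux_norm_sq, aux_norm_sq]
    have h1 : (x + j) ^ 2 ≤ (x + c + j) ^ 2 := by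
      apply pow_le_pow_left₀ (by positivity); linarith
    nlinarith [mul_le_mul_of_nonneg_left h1 (sq_nonneg t)]
  have := mul_pos (hQ (x+c) hxc) (hP x hx)
  gcongr

lemma aux_gamma_half (x t : ℝ) (hx : 0 < x) :
    (‖Complex.Gamma (x + t * Complex.I)‖ * ‖Complex.Gamma ((x + 1 : ℝ) + t * Complex.I)‖) *
      (Real.Gamma (x + 1 / 2) * Real.Gamma (x + 1 / 2)) ≤
    (‖Complex.Gamma ((x + 1 / 2 : ℝ) + t * Complex.I)‖ *
      ‖Complex.Gamma ((x + 1 / 2 : ℝ) + t * Complex.I)‖) * (Real.Gamma x * Real.Gamma (x + 1)) := by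
  refine le_of_tendsto_of_tendsto
    (((aux_gs_lim _).mul (aux_gs_lim _)).mul
      ((aux_gs_lim' (x + 1/2) (by linarith)).mul (aux_gs_lim' (x + 1/2) (by linarith))))
    (((aux_gs_lim _).mul (aux_gs_lim _)).mul
      ((aux_gs_lim' x hx).mul (aux_gs_lim' (x + 1) (by linarith)))) ?_
  filter_upwards [eventually_ne_atTop 0] with n hn
  have hP : ∀ w : ℝ, 0 < w → 0 < ∏ j ∈ Finset.range (n + 1), (w + j) := fun w hw =>
    Finset.prod_pos fun j _ => by positivity
  have hQ : ∀ w : ℝ, 0 < w →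
      0 < ∏ j ∈ Finset.range (n + 1), ‖((w + j : ℝ) : ℂ) + t * Complex.I‖ := fun w hw =>
    Finset.prod_pos fun j _ => by
      apply norm_pos_iff.mpr
      intro h
      have := congrArg Complex.re h
      simp at this
      have : (0:ℝ) ≤ j := by positivity
      linarith
  have hx1 : 0 < x + 1 := by linarith
  have hx2 : 0 < x + 1 / 2 := by linarith
  rw [aux_gs_norm x t n hn, aux_gs_norm (x + 1) t n hn, aux_gs_norm (x + 1/2) t n hn,
    aux_gs_norm' x hx n hn, aux_gs_norm' (x + 1) hx1 n hn, aux_gs_norm' (x + 1/2) hx2 n hn]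
  simp only [div_mul_div_comm]
  rw [mul_comm ((n : ℝ) ^ x * n.factorial * ((n : ℝ) ^ (x + 1) * n.factorial))]
  have key : ((∏ j ∈ Finset.range (n + 1), ‖((x + 1/2 + j : ℝ) : ℂ) + t * Complex.I‖) *
      (∏ j ∈ Finset.range (n + 1), ‖((x + 1/2 + j : ℝ) : ℂ) + t * Complex.I‖)) *
      ((∏ j ∈ Finset.range (n + 1), (x + j)) * (∏ j ∈ Finset.range (n + 1), (x + 1 + j))) ≤
      ((∏ j ∈ Finset.range (n + 1), ‖((x + j : ℝ) : ℂ) + t * Complex.I‖) *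
      (∏ j ∈ Finset.range (n + 1), ‖((x + 1 + j : ℝ) : ℂ) + t * Complex.I‖)) *
      ((∏ j ∈ Finset.range (n + 1), (x + 1/2 + j)) *
        (∏ j ∈ Finset.range (n + 1), (x + 1/2 + j))) := by
    simp only [← Finset.prod_mul_distrib]
    refine Finset.prod_le_prod (fun j _ => by positivity) fun j _ => ?_
    obtain ⟨p, hp⟩ : ∃ p : ℝ, p = x + j := ⟨_, rfl⟩
    have hp0 : 0 < p := by rw [hp]; positivity
    rw [show x + 1/2 + j = p + 1/2 by rw [hp]; ring, show x + 1 + j = p + 1 by rw [hp]; ring, ← hp]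
    refine le_of_sq_le_sq ?_ (by positivity)
    simp only [mul_pow, aux_norm_sq]
    have h1 : ((p + 1/2)^2 + t^2) * (p * (p+1)) ≤ (p * (p+1) + t^2) * (p+1/2)^2 := by
      nlinarith [sq_nonneg t]
    have h2 : (p * (p+1) + t^2)^2 ≤ (p^2 + t^2) * ((p+1)^2+t^2) := by
      nlinarith [sq_nonneg t]
    calc _ = (((p + 1/2)^2 + t^2) * (p * (p+1)))^2 := by ring
      _ ≤ ((p * (p+1) + t^2) * (p+1/2)^2)^2 := by gcongr
      _ = (p * (p+1) + t^2)^2 * ((p+1/2)^2 * (p+1/2)^2) := by ring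
      _ ≤ _ := by gcongr
  have := mul_pos (mul_pos (hQ _ hx2) (hQ _ hx2)) (mul_pos (hP x hx) (hP _ hx1))
  gcongr

lemma aux_quarter (x t : ℝ) (hx : 0 < x) :
    (‖Complex.Gamma (x + t * Complex.I)‖ / ‖Complex.Gamma ((x + 1 / 2 : ℝ) + t * Complex.I)‖) ^ 2
     ≤ (Real.Gamma x * Real.Gamma (x + 1) / (Real.Gamma (x + 1 / 2)) ^ 2) /
        ‖(x : ℂ) + t * Complex.I‖ := by
  have h := aux_gamma_half x t hx
  have hz : (x : ℂ) + t * Complex.I ≠ 0 := by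
    intro h
    have := congrArg Complex.re h
    simp at this
    linarith
  have e : ((x + 1 : ℝ) : ℂ) + t * Complex.I = (x + t * Complex.I) + 1 := by push_cast; ring
  rw [e, Complex.Gamma_add_one _ hz, norm_mul] at h
  have h1 : 0 < ‖Complex.Gamma ((x + 1 / 2 : ℝ) + t * Complex.I)‖ := by
    apply norm_pos_iff.mpr
    apply Complex.Gamma_ne_zero_of_re_pos
    simp; linarith
  have h2 : 0 < Real.Gamma (x + 1/2) := Real.Gamma_pos_of_pos (by linarith)
  have h3 : 0 < ‖(x : ℂ) + t * Complex.I‖ := norm_pos_iff.mpr hz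
  rw [div_pow, div_div, div_le_div_iff₀ (by positivity) (by positivity)]
  nlinarith

lemma aux_ne (c y : ℝ) (hc : c ≠ 0) : (c : ℂ) + y * Complex.I ≠ 0 := by
  intro h
  have := congrArg Complex.re h
  simp at this
  exact hc this

lemma aux_cont (c : ℝ) (hc : c ≠ 0) : Continuous fun y : ℝ => ((c : ℂ) + y * Complex.I)⁻¹ := by
  apply Continuous.inv₀ (by fun_prop)
  intro y; exact aux_ne c y hc

lemma aux_arctan (c T : ℝ) (hc : c ≠ 0) :
    ∫ y in (-T)..T, ((c : ℂ) + y * Complex.I)⁻¹ = ((2 * Real.arctan (T / c) : ℝ) : ℂ) := by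
  have h1 : ∫ y in (-T)..T, ((c : ℂ) + y * Complex.I)⁻¹ =
      ∫ y in (-T)..T, ((c : ℂ) + (-y : ℝ) * Complex.I)⁻¹ := by
    rw [intervalIntegral.integral_comp_neg (fun y : ℝ => ((c : ℂ) + y * Complex.I)⁻¹)]
    simp
  have h2 : (∫ y in (-T)..T, ((c : ℂ) + y * Complex.I)⁻¹) +
      (∫ y in (-T)..T, ((c : ℂ) + (-y : ℝ) * Complex.I)⁻¹) =
      ∫ y in (-T)..T, ((2 * (c / (c ^ 2 + y ^ 2)) : ℝ) : ℂ) := by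
    have hc2 : Continuous fun y : ℝ => ((c : ℂ) + (-y : ℝ) * Complex.I)⁻¹ :=
      (aux_cont c hc).comp continuous_neg
    rw [← intervalIntegral.integral_add ((aux_cont c hc).intervalIntegrable _ _)
      (hc2.intervalIntegrable _ _)]
    refine intervalIntegral.integral_congr fun y _ => ?_
    have e1 := aux_ne c y hc
    have e2 := aux_ne c (-y) hc
    have e3 : ((c : ℂ) ^ 2 + y ^ 2) ≠ 0 := by
      have : 0 < c ^ 2 + y ^ 2 := by positivity
      exact_mod_cast this.ne'
    push_cast at e2 ⊢
    have e4 : ((c : ℂ) ^ 2 + y ^ 2) = (c + y * Complex.I) * (c + -y * Complex.I) := by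
      ring_nf; rw [Complex.I_sq]; ring
    rw [e4, ← mul_div_assoc,
      show (2 * c : ℂ) = (c + y * Complex.I) + (c + -y * Complex.I) by ring]
    generalize (c + y * Complex.I : ℂ) = A at *
    generalize (c + -y * Complex.I : ℂ) = B at *
    field_simp
    ring
  rw [← h1, intervalIntegral.integral_ofReal] at h2
  have h3 : ∫ y in (-T)..T, (2 * (c / (c ^ 2 + y ^ 2))) =
      2 * Real.arctan (T / c) - 2 * Real.arctan (-T / c) := by
    apply intervalIntegral.integral_eq_sub_of_hasDerivAt (f := fun y => 2 * Real.arctan (y / c))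
    · intro y _
      have := ((hasDerivAt_id y).div_const c).arctan.const_mul 2
      refine this.congr_deriv ?_
      simp only [id]
      have : 0 < c ^ 2 + y ^ 2 := by positivity
      field_simp
    · apply Continuous.intervalIntegrable
      have : ∀ y : ℝ, c ^ 2 + y ^ 2 ≠ 0 := fun y => by positivity
      fun_prop (disch := assumption)
  rw [h3, neg_div, Real.arctan_neg] at h2
  have : (∫ y in (-T)..T, ((c : ℂ) + y * Complex.I)⁻¹) * 2 =
      ((2 * Real.arctan (T / c) : ℝ) : ℂ) * 2 := by
    rw [mul_two, h2]; push_cast; ring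
  exact mul_right_cancel₀ two_ne_zero this

lemma aux_arctan_lim_pos (c : ℝ) (hc : 0 < c) :
    Tendsto (fun T : ℝ => ∫ y in (-T)..T, ((c : ℂ) + y * Complex.I)⁻¹) atTop (𝓝 (Real.pi : ℂ)) := by
  simp only [aux_arctan c _ hc.ne']
  apply (Complex.continuous_ofReal.tendsto _).comp
  have : Tendsto (fun T : ℝ => Real.arctan (T / c)) atTop (𝓝 (Real.pi / 2)) :=
    (Real.tendsto_arctan_atTop.mono_right nhdsWithin_le_nhds).comp
      (tendsto_id.atTop_div_const hc)
  have := this.const_mul 2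
  rwa [mul_div_cancel₀ _ (two_ne_zero)] at this

lemma aux_arctan_lim_neg (c : ℝ) (hc : c < 0) :
    Tendsto (fun T : ℝ => ∫ y in (-T)..T, ((c : ℂ) + y * Complex.I)⁻¹) atTop
      (𝓝 (-Real.pi : ℂ)) := by
  have h := (aux_arctan_lim_pos (-c) (by linarith)).neg
  refine h.congr fun T => ?_
  rw [aux_arctan _ _ hc.ne, aux_arctan _ _ (by linarith : -c ≠ 0), div_neg, Real.arctan_neg]
  push_cast; ring

lemma aux_shift (σ1 σ2 p : ℝ) (h1 : σ1 < p) (h2 : p < σ2) (h : ℂ → ℂ) (U : Set ℂ) (hU : IsOpen U)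
    (hs : ∀ z : ℂ, σ1 ≤ z.re → z.re ≤ σ2 → z ∈ U) (hh : DifferentiableOn ℂ h U)
    (e : ℝ → ℝ) (he : Tendsto e atTop (𝓝 0))
    (hd : ∀ᶠ T in atTop, ∀ σ ∈ Icc σ1 σ2, ∀ t : ℝ, |t| = T →
      ‖h (σ + t * Complex.I) / (σ + t * Complex.I - p)‖ ≤ e T)
    (i1 : Integrable fun t : ℝ => h (σ1 + t * Complex.I) / (σ1 + t * Complex.I - p))
    (i2 : Integrable fun t : ℝ => h (σ2 + t * Complex.I) / (σ2 + t * Complex.I - p)) :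
    (∫ t : ℝ, h (σ1 + t * Complex.I) / (σ1 + t * Complex.I - p)) =
      (∫ t : ℝ, h (σ2 + t * Complex.I) / (σ2 + t * Complex.I - p)) - 2 * Real.pi * h p := by
  have hpU : (p : ℂ) ∈ U := hs p (by simpa using h1.le) (by simpa using h2.le)
  have hg : DifferentiableOn ℂ (dslope h p) U :=
    (Complex.differentiableOn_dslope (hU.mem_nhds hpU)).2 hh
  have hds : ∀ z : ℂ, z ≠ p → dslope h p z = h z / (z - p) - h p * (z - p)⁻¹ := by
    intro z hz
    rw [dslope_of_ne _ hz, slope_def_field]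
    rw [sub_div]; rfl
  -- vertical pieces
  have hv : ∀ σ : ℝ, σ ≠ p → (Integrable fun t : ℝ => h (σ + t * Complex.I) / (σ + t * Complex.I - p))
      → ∀ T : ℝ, ∫ t in (-T)..T, dslope h p (σ + t * Complex.I) =
        (∫ t in (-T)..T, h (σ + t * Complex.I) / (σ + t * Complex.I - p)) -
          h p * ∫ t in (-T)..T, (((σ - p : ℝ) : ℂ) + t * Complex.I)⁻¹ := by
    intro σ hσ hi T
    rw [← intervalIntegral.integral_const_mul, ← intervalIntegral.integral_sub
      hi.intervalIntegrable
      (((aux_cont (σ - p) (sub_ne_zero.2 hσ)).const_mul _).intervalIntegrable _ _)]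
    refine intervalIntegral.integral_congr fun t _ => ?_
    have : (σ : ℂ) + t * Complex.I ≠ p := by
      intro h
      have := congrArg Complex.re h
      simp at this
      exact hσ this
    rw [hds _ this]
    congr 3
    push_cast; ring
  have hhor : ∀ ε : ℝ, |ε| = 1 → Tendsto
      (fun T : ℝ => ∫ x in σ1..σ2, dslope h p (x + (ε * T : ℝ) * Complex.I)) atTop (𝓝 0) := by
    intro ε hε
    have hlim : Tendsto (fun T : ℝ => (e T + ‖h p‖ * T⁻¹) * |σ2 - σ1|) atTop (𝓝 0) := by
      have := (he.add (tendsto_inv_atTop_zero.const_mul ‖h p‖)).mul_const |σ2 - σ1|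
      simpa using this
    refine squeeze_zero_norm' ?_ hlim
    filter_upwards [hd, eventually_gt_atTop 0] with T hT hT0
    apply intervalIntegral.norm_integral_le_of_norm_le_const
    intro x hx
    rw [uIoc_of_le (by linarith)] at hx
    have habs : |ε * T| = T := by rw [abs_mul, hε, one_mul, abs_of_pos hT0]
    have him : T ≤ ‖(x : ℂ) + (ε * T : ℝ) * Complex.I - p‖ := by
      calc T = |((x : ℂ) + (ε * T : ℝ) * Complex.I - p).im| := by
            have : ((x : ℂ) + (ε * T : ℝ) * Complex.I - p).im = ε * T := by simp
            rw [this, habs]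
        _ ≤ _ := Complex.abs_im_le_norm _
    have hne : (x : ℂ) + (ε * T : ℝ) * Complex.I ≠ p := by
      intro h
      rw [h, sub_self, norm_zero] at him
      linarith
    rw [hds _ hne]
    refine (norm_sub_le _ _).trans (add_le_add (hT x ⟨hx.1.le, hx.2⟩ _ habs) ?_)
    rw [norm_mul, norm_inv]
    gcongr
  have hrect : ∀ T : ℝ, (∫ x : ℝ in σ1..σ2, dslope h p (x + (-1 * T : ℝ) * Complex.I)) -
      (∫ x : ℝ in σ1..σ2, dslope h p (x + (1 * T : ℝ) * Complex.I)) +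
      Complex.I * (∫ y : ℝ in (-T)..T, dslope h p (σ2 + y * Complex.I)) -
      Complex.I * (∫ y : ℝ in (-T)..T, dslope h p (σ1 + y * Complex.I)) = 0 := by
    intro T
    have := Complex.integral_boundary_rect_eq_zero_of_differentiableOn (dslope h p)
      ⟨σ1, -T⟩ ⟨σ2, T⟩ (hg.mono ?_)
    · simpa only [smul_eq_mul, neg_one_mul, one_mul] using this
    · intro z hz
      rw [Complex.mem_reProdIm] at hz
      simp only [uIcc_of_le (h1.trans h2).le] at hz
      exact hs z hz.1.1 hz.1.2
  have l1 := intervalIntegral_tendsto_integral i1 tendsto_neg_atTop_atBot tendsto_id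
  have l2 := intervalIntegral_tendsto_integral i2 tendsto_neg_atTop_atBot tendsto_id
  have a1 := aux_arctan_lim_neg (σ1 - p) (by linarith)
  have a2 := aux_arctan_lim_pos (σ2 - p) (by linarith)
  have L := (((hhor (-1) (by simp)).sub (hhor 1 (by simp))).add
    ((l2.sub (a2.const_mul (h p))).const_mul Complex.I)).sub
    ((l1.sub (a1.const_mul (h p))).const_mul Complex.I)
  have Z := tendsto_nhds_unique (L.congr fun T => by
    have := hrect T
    rw [hv σ1 (h1.ne) i1, hv σ2 (h2.ne') i2] at this
    exact this) tendsto_const_nhds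
  have Z2 := mul_eq_zero.1 (show Complex.I * ((∫ t : ℝ, h (σ2 + t * Complex.I) / (σ2 + t * Complex.I - p)) -
     2 * Real.pi * h p - (∫ t : ℝ, h (σ1 + t * Complex.I) / (σ1 + t * Complex.I - p))) = 0 by
       rw [← Z]; ring)
  rcases Z2 with Z2 | Z2
  · exact absurd Z2 Complex.I_ne_zero
  · exact (sub_eq_zero.1 Z2).symm

lemma aux_gamma_prod (z : ℂ) (hz : ∀ k : ℕ, z ≠ -k) (n : ℕ) :
    Complex.Gamma (z + n) = (∏ k ∈ Finset.range n, (z + k)) * Complex.Gamma z := by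
  induction n with
  | zero => simp
  | succ n ih =>
    have h : z + n ≠ 0 := fun h => hz n (eq_neg_of_add_eq_zero_left h)
    rw [Finset.prod_range_succ]
    push_cast
    rw [← add_assoc, Complex.Gamma_add_one _ h, ih]
    ring

/-- the ratio of Gamma functions -/
def gq (a : ℝ) (ζ : ℂ) : ℂ := Complex.Gamma (a - ζ) / Complex.Gamma (a + ζ)

/-- the integrand -/
def fq (a x : ℝ) (b ζ : ℂ) : ℂ := gq a ζ * (x : ℂ) ^ ζ / (ζ + b)

lemma aux_gamma_conj (u t : ℝ) :
    ‖Complex.Gamma ((u : ℂ) + (-t : ℝ) * Complex.I)‖ = ‖Complex.Gamma ((u : ℂ) + t * Complex.I)‖ := by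
  have : ((u : ℂ) + (-t : ℝ) * Complex.I) = starRingEnd ℂ ((u : ℂ) + t * Complex.I) := by
    simp
  rw [this, Complex.Gamma_conj, Complex.norm_conj]

/-- weight -/
def mw (t : ℝ) : ℝ := 1 + ‖t‖ ^ 2

lemma mw_one_le (t : ℝ) : 1 ≤ mw t := by unfold mw; nlinarith [sq_nonneg ‖t‖]
lemma mw_pos (t : ℝ) : 0 < mw t := lt_of_lt_of_le one_pos (mw_one_le t)

lemma mw_int : Integrable fun t : ℝ => mw t ^ (-(3/4) : ℝ) := by
  have := integrable_rpow_neg_one_add_norm_sq (E := ℝ) (μ := volume) (r := 3/2) (by simp; norm_num)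
  refine this.congr (Eventually.of_forall fun t => ?_)
  simp only [mw]
  norm_num

lemma mw_norm (c t : ℝ) (hc : 1 / 4 ≤ c) : mw t ^ (1/2 : ℝ) / 4 ≤ ‖(c : ℂ) + t * Complex.I‖ := by
  refine le_of_sq_le_sq ?_ (norm_nonneg _)
  rw [aux_norm_sq, div_pow, ← Real.rpow_natCast, ← Real.rpow_mul (mw_pos t).le]
  norm_num [mw]
  nlinarith [sq_nonneg t]

lemma mw_amgm (p q : ℝ) (hp : 0 < p) (hq : 0 < q) :
    p ^ (-(1/4) : ℝ) * q ^ (-(1/2) : ℝ) ≤ p ^ (-(3/4) : ℝ) + q ^ (-(3/4) : ℝ) := by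
  rcases le_total p q with h | h
  · calc _ ≤ p ^ (-(1/4) : ℝ) * p ^ (-(1/2) : ℝ) := by
          gcongr ?_ * ?_
          exact Real.rpow_le_rpow_of_nonpos hp h (by norm_num)
      _ = p ^ (-(3/4) : ℝ) := by rw [← Real.rpow_add hp]; norm_num
      _ ≤ _ := by have := Real.rpow_nonneg hq.le (-(3/4)); linarith
  · calc _ ≤ q ^ (-(1/4) : ℝ) * q ^ (-(1/2) : ℝ) := by
          gcongr ?_ * ?_
          exact Real.rpow_le_rpow_of_nonpos hq h (by norm_num)
      _ = q ^ (-(3/4) : ℝ) := by rw [← Real.rpow_add hq]; norm_num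
      _ ≤ _ := by have := Real.rpow_nonneg hp.le (-(3/4)); linarith

lemma fq_bound (a x : ℝ) (hx : 0 < x) (hx1 : x < 1) (b : ℂ) (hb : 0 ≤ b.re) (σ t C : ℝ)
    (hσ : 1 / 4 ≤ σ) (hC : ‖gq a (σ + t * Complex.I)‖ ≤ C * mw t ^ (-(1/4) : ℝ)) :
    ‖fq a x b (σ + t * Complex.I)‖ ≤
      4 * C * (mw t ^ (-(3/4) : ℝ) + mw (t + b.im) ^ (-(3/4) : ℝ)) := by
  unfold fq
  rw [norm_div, norm_mul, Complex.norm_cpow_eq_rpow_re_of_pos hx]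
  have h1 : x ^ ((σ : ℂ) + t * Complex.I).re ≤ 1 := by
    apply Real.rpow_le_one hx.le hx1.le
    simp; linarith
  have h2 : mw (t + b.im) ^ (1/2 : ℝ) / 4 ≤ ‖(σ : ℂ) + t * Complex.I + b‖ := by
    have := mw_norm (σ + b.re) (t + b.im) (by linarith)
    convert this using 2
    apply Complex.ext <;> simp
  have h3 := Real.rpow_pos_of_pos (mw_pos (t + b.im)) (1/2)
  have h0 : 0 ≤ C * mw t ^ (-(1/4) : ℝ) := (norm_nonneg _).trans hC
  have hC0 : 0 ≤ C := by
    have := Real.rpow_pos_of_pos (mw_pos t) (-(1/4))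
    exact nonneg_of_mul_nonneg_left h0 this
  calc _ ≤ (C * mw t ^ (-(1/4) : ℝ)) * 1 / (mw (t + b.im) ^ (1/2 : ℝ) / 4) := by gcongr
    _ = 4 * C * (mw t ^ (-(1/4) : ℝ) * mw (t + b.im) ^ (-(1/2) : ℝ)) := by
      rw [Real.rpow_neg (mw_pos (t + b.im)).le (1/2)]
      field_simp
    _ ≤ _ := by
      gcongr
      exact mw_amgm _ _ (mw_pos _) (mw_pos _)

lemma gq_cont (a σ : ℝ) (hs : ∀ m : ℕ, a - σ ≠ -m) :
    Continuous fun t : ℝ => gq a (σ + t * Complex.I) := by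
  unfold gq
  simp only [div_eq_mul_inv]
  refine Continuous.mul ?_ ?_
  · rw [continuous_iff_continuousAt]
    intro t
    have : ContinuousAt Complex.Gamma (a - (σ + t * Complex.I)) := by
      apply (Complex.differentiableAt_Gamma _ _).continuousAt
      intro m h
      have := congrArg Complex.re h
      simp at this
      exact hs m this
    exact ContinuousAt.comp (f := fun t : ℝ => (a : ℂ) - (σ + t * Complex.I)) this (by fun_prop)
  · exact Complex.differentiable_one_div_Gamma.continuous.comp (by fun_prop)

lemma fq_cont (a x : ℝ) (hx : 0 < x) (b : ℂ) (hb : 0 ≤ b.re) (σ : ℝ) (hσ : 1 / 4 ≤ σ)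
    (hs : ∀ m : ℕ, a - σ ≠ -m) :
    Continuous fun t : ℝ => fq a x b (σ + t * Complex.I) := by
  unfold fq
  have hx0 : (x : ℂ) ≠ 0 := by exact_mod_cast hx.ne'
  refine ((gq_cont a σ hs).mul ?_).div (by fun_prop) ?_
  · refine Continuous.const_cpow (by fun_prop) (Or.inl hx0)
  · intro t h
    have := congrArg Complex.re h
    simp at this
    linarith

lemma fq_int (a x : ℝ) (hx : 0 < x) (hx1 : x < 1) (b : ℂ) (hb : 0 ≤ b.re) (σ C : ℝ)
    (hσ : 1 / 4 ≤ σ) (hs : ∀ m : ℕ, a - σ ≠ -m)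
    (hC : ∀ t : ℝ, ‖gq a (σ + t * Complex.I)‖ ≤ C * mw t ^ (-(1/4) : ℝ)) :
    (Integrable fun t : ℝ => fq a x b (σ + t * Complex.I)) ∧
    ‖∫ t : ℝ, fq a x b (σ + t * Complex.I)‖ ≤ 8 * C * ∫ t : ℝ, mw t ^ (-(3/4) : ℝ) := by
  have hi : Integrable fun t : ℝ =>
      4 * C * (mw t ^ (-(3/4) : ℝ) + mw (t + b.im) ^ (-(3/4) : ℝ)) :=
    (mw_int.add (mw_int.comp_add_right b.im)).const_mul _
  have hle := fun t => fq_bound a x hx hx1 b hb σ t C hσ (hC t)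
  refine ⟨hi.mono' (fq_cont a x hx b hb σ hσ hs).aestronglyMeasurable (Eventually.of_forall hle), ?_⟩
  refine (norm_integral_le_of_norm_le hi (Eventually.of_forall hle)).trans (le_of_eq ?_)
  rw [integral_const_mul, integral_add mw_int (mw_int.comp_add_right b.im),
    integral_add_right_eq_self (fun t => mw t ^ (-(3/4) : ℝ))]
  ring

lemma gq_quarter (a : ℝ) (ha : 1 / 2 ≤ a) : ∃ C : ℝ, ∀ t : ℝ,
    ‖gq a ((1/4 : ℝ) + t * Complex.I)‖ ≤ C * mw t ^ (-(1/4) : ℝ) := by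
  have hx : 0 < a - 1/4 := by linarith
  set D := Real.Gamma (a - 1/4) * Real.Gamma (a - 1/4 + 1) / (Real.Gamma (a - 1/4 + 1 / 2)) ^ 2 with hD
  have hD0 : 0 ≤ D := by
    have := Real.Gamma_pos_of_pos hx
    have := Real.Gamma_pos_of_pos (by linarith : 0 < a - 1/4 + 1)
    positivity
  refine ⟨Real.sqrt (4 * D), fun t => ?_⟩
  have h := aux_quarter (a - 1/4) (-t) hx
  rw [← hD, aux_gamma_conj (a - 1/4 + 1/2) t] at h
  have e : ‖gq a ((1/4 : ℝ) + t * Complex.I)‖ =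
     ‖Complex.Gamma ((a - 1/4 : ℝ) + (-t : ℝ) * Complex.I)‖ /
       ‖Complex.Gamma ((a - 1/4 + 1 / 2 : ℝ) + t * Complex.I)‖ := by
    unfold gq
    rw [norm_div]
    congr 3 <;> (push_cast; ring)
  rw [← e] at h
  refine le_of_sq_le_sq (h.trans ?_) (by have := Real.rpow_pos_of_pos (mw_pos t) (-(1/4)); positivity)
  rw [mul_pow, Real.sq_sqrt (by positivity), ← Real.rpow_natCast, ← Real.rpow_mul (mw_pos t).le]
  have h2 := mw_norm (a - 1/4) (-t) (by linarith)
  have h3 : mw (-t) = mw t := by simp [mw]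
  rw [h3] at h2
  have h4 := Real.rpow_pos_of_pos (mw_pos t) (1/2)
  calc _ ≤ D / (mw t ^ (1/2 : ℝ) / 4) := by gcongr
    _ = _ := by
      rw [show (-(1/4 : ℝ) * ((2 : ℕ) : ℝ)) = -(1/2) by norm_num, Real.rpow_neg (mw_pos t).le]
      field_simp

lemma aux_not_int (n k : ℕ) : (1 / 2 - n : ℝ) ≠ -k := by
  intro h
  have h2 : (2 * n : ℝ) = 2 * k + 1 := by linarith
  have h3 : 2 * n = 2 * k + 1 := by exact_mod_cast h2
  omega

lemma gq_right (a : ℝ) (ha : 1 / 2 ≤ a) (m : ℕ) (t : ℝ) :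
    ‖gq a (((a + m + 1 / 2 : ℝ) : ℂ) + t * Complex.I)‖ ≤
      (4 * Real.Gamma (1/2) / Real.Gamma (2 * a + m + 1/2)) * mw t ^ (-(1/4) : ℝ) := by
  set z : ℂ := ((1/2 - (m + 1 : ℕ) : ℝ) : ℂ) + (-t : ℝ) * Complex.I with hz
  have hzk : ∀ k : ℕ, z ≠ -k := by
    intro k h
    have := congrArg Complex.re h
    rw [hz] at this
    simp at this
    apply aux_not_int (m + 1) k
    push_cast
    linarith
  have hp := aux_gamma_prod z hzk (m + 1)
  have e1 : z + (m + 1 : ℕ) = ((1/2 : ℝ) : ℂ) + (-t : ℝ) * Complex.I := by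
    rw [hz]; push_cast; ring
  rw [e1] at hp
  have hmono := aux_gamma_mono (1/2) (2 * a + m) (-t) (by norm_num) (by positivity)
  rw [hp, aux_gamma_conj, norm_mul] at hmono
  have hP : mw t ^ (1/2 : ℝ) / 4 ≤ ‖∏ k ∈ Finset.range (m + 1), (z + k)‖ := by
    rw [Finset.prod_range_succ, norm_mul, norm_prod]
    have h1 : mw t ^ (1/2 : ℝ) / 4 ≤ ‖z + m‖ := by
      have := mw_norm (1/2) t (by norm_num)
      have e0 : z + m = -(((1/2 : ℝ) : ℂ) + t * Complex.I) := by
        rw [hz]; push_cast; ring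
      rw [e0, norm_neg]
      exact this
    have h2 : 1 ≤ ∏ k ∈ Finset.range m, ‖z + k‖ := by
      calc (1 : ℝ) = ∏ k ∈ Finset.range m, 1 := by simp
        _ ≤ _ := by
          refine Finset.prod_le_prod (fun _ _ => zero_le_one) fun k hk => ?_
          have hk' : (k : ℝ) + 1 ≤ m := by exact_mod_cast Finset.mem_range.1 hk
          refine le_trans ?_ (Complex.abs_re_le_norm _)
          have : (z + k).re = 1/2 - (m + 1) + k := by rw [hz]; simp
          rw [this]
          apply le_abs.2; right; linarith
    calc _ ≤ ‖z + m‖ := h1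
      _ = 1 * ‖z + m‖ := (one_mul _).symm
      _ ≤ _ := by gcongr
  have h4 := Real.rpow_pos_of_pos (mw_pos t) (1/2)
  have hP0 := lt_of_lt_of_le (by positivity) hP
  have hG : 0 < Real.Gamma (2 * a + m + 1/2) := Real.Gamma_pos_of_pos (by positivity)
  have hG' : 0 < Real.Gamma (1/2) := Real.Gamma_pos_of_pos (by positivity)
  have hN : 0 < ‖Complex.Gamma (((1/2 + (2 * a + m) : ℝ) : ℂ) + t * Complex.I)‖ := by
    apply norm_pos_iff.mpr
    apply Complex.Gamma_ne_zero_of_re_pos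
    simp; positivity
  have e : ‖gq a (((a + m + 1 / 2 : ℝ) : ℂ) + t * Complex.I)‖ = ‖Complex.Gamma z‖ /
      ‖Complex.Gamma (((1/2 + (2 * a + m) : ℝ) : ℂ) + t * Complex.I)‖ := by
    unfold gq
    rw [norm_div, hz]
    congr 3 <;> (push_cast; ring)
  rw [e]
  have hG2 : Real.Gamma (1/2 + (2 * a + m)) = Real.Gamma (2 * a + m + 1/2) := by congr 1; ring
  rw [hG2] at hmono
  calc _ ≤ (Real.Gamma (1/2) / Real.Gamma (2 * a + m + 1/2)) /
        ‖∏ k ∈ Finset.range (m + 1), (z + k)‖ := by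
        rw [div_div, div_le_div_iff₀ hN (by positivity)]
        nlinarith
    _ ≤ (Real.Gamma (1/2) / Real.Gamma (2 * a + m + 1/2)) / (mw t ^ (1/2 : ℝ) / 4) := by gcongr
    _ = (4 * Real.Gamma (1/2) / Real.Gamma (2 * a + m + 1/2)) * mw t ^ (-(1/2) : ℝ) := by
        rw [Real.rpow_neg (mw_pos t).le]
        field_simp
    _ ≤ _ := by
        gcongr
        · exact mw_one_le t
        · norm_num

lemma gq_hor (a : ℝ) (ha : 1 / 2 ≤ a) (n : ℕ) (S : ℝ) (hS : S < a + n) : ∃ C : ℝ, 0 ≤ C ∧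
    ∀ σ ∈ Icc (1/4) S, ∀ t : ℝ, 1 ≤ |t| → ‖gq a (σ + t * Complex.I)‖ ≤ C := by
  obtain ⟨D, hD⟩ := (isCompact_Icc (a := (1/4 : ℝ)) (b := S)).exists_bound_of_continuousOn
    (f := fun σ => Real.Gamma (a - σ + n) / Real.Gamma (a + σ + n)) (by
      refine ContinuousOn.div ?_ ?_ ?_
      · intro σ hσ
        apply ContinuousAt.continuousWithinAt
        refine ContinuousAt.comp (f := fun σ : ℝ => a - σ + n) (g := Real.Gamma) ?_ (by fun_prop)
        apply (Real.differentiableAt_Gamma _).continuousAt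
        intro m h
        have : (0:ℝ) ≤ m := by positivity
        linarith [hσ.2]
      · intro σ hσ
        apply ContinuousAt.continuousWithinAt
        refine ContinuousAt.comp (f := fun σ : ℝ => a + σ + n) (g := Real.Gamma) ?_ (by fun_prop)
        apply (Real.differentiableAt_Gamma _).continuousAt
        intro m h
        have : (0:ℝ) ≤ m := by positivity
        have : (0:ℝ) ≤ n := by positivity
        linarith [hσ.1]
      · intro σ hσ
        have : (0:ℝ) ≤ n := by positivity
        exact (Real.Gamma_pos_of_pos (by linarith [hσ.1])).ne')
  refine ⟨|D| * (a + |S| + n + 1) ^ n, by positivity, fun σ hσ t ht => ?_⟩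
  have hn : (0:ℝ) ≤ n := by positivity
  have hσ1 := hσ.1
  have hσ2 := hσ.2
  have hSpos : 0 < S := by linarith
  set z : ℂ := ((a - σ : ℝ) : ℂ) + (-t : ℝ) * Complex.I with hz
  set w : ℂ := ((a + σ : ℝ) : ℂ) + t * Complex.I with hw
  have ht0 : t ≠ 0 := by intro h; rw [h] at ht; norm_num at ht
  have hzk : ∀ k : ℕ, z ≠ -k := by
    intro k h
    have := congrArg Complex.im h
    rw [hz] at this
    simp at this
    exact ht0 this
  have hwk : ∀ k : ℕ, w ≠ -k := by
    intro k h
    have := congrArg Complex.im h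
    rw [hw] at this
    simp at this
    exact ht0 this
  have hp := aux_gamma_prod z hzk n
  have hq := aux_gamma_prod w hwk n
  have e1 : z + n = ((a - σ + n : ℝ) : ℂ) + (-t : ℝ) * Complex.I := by
    rw [hz]; push_cast; ring
  have e2 : w + n = ((a - σ + n + 2 * σ : ℝ) : ℂ) + (t : ℝ) * Complex.I := by
    rw [hw]; push_cast; ring
  rw [e1] at hp
  rw [e2] at hq
  have hmono := aux_gamma_mono (a - σ + n) (2 * σ) (-t) (by linarith) (by linarith)
  rw [hp, aux_gamma_conj, hq, norm_mul, norm_mul,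
    show a - σ + n + 2 * σ = a + σ + n by ring] at hmono
  have hG : 0 < Real.Gamma (a + σ + n) := Real.Gamma_pos_of_pos (by linarith)
  have hG' : 0 < Real.Gamma (a - σ + n) := Real.Gamma_pos_of_pos (by linarith)
  have hN : 0 < ‖Complex.Gamma w‖ := by
    apply norm_pos_iff.mpr
    exact Complex.Gamma_ne_zero hwk
  have hz1 : ∀ k : ℕ, |t| ≤ ‖z + k‖ := fun k => by
    have : (z + k).im = -t := by rw [hz]; simp
    have h := Complex.abs_im_le_norm (z + k)
    rwa [this, abs_neg] at h
  have hP0 : 0 < ‖∏ k ∈ Finset.range n, (z + k)‖ := by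
    rw [norm_prod]
    refine Finset.prod_pos fun k _ => ?_
    linarith [hz1 k]
  have hPQ : ‖∏ k ∈ Finset.range n, (w + k)‖ ≤
      (a + |S| + n + 1) ^ n * ‖∏ k ∈ Finset.range n, (z + k)‖ := by
    rw [norm_prod, norm_prod]
    calc _ ≤ ∏ k ∈ Finset.range n, ((a + |S| + n + 1) * ‖z + k‖) := by
          refine Finset.prod_le_prod (fun _ _ => norm_nonneg _) fun k hk => ?_
          have hk' : (k : ℝ) ≤ n := by exact_mod_cast (Finset.mem_range.1 hk).le
          have hk0 : (0 : ℝ) ≤ k := by positivity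
          have e3 : w + k = ((a + σ + k : ℝ) : ℂ) + t * Complex.I := by
            rw [hw]; push_cast; ring
          have : ‖w + k‖ ≤ (a + σ + k) + |t| := by
            rw [e3]
            refine (norm_add_le _ _).trans ?_
            rw [norm_mul, Complex.norm_I, Complex.norm_real, Complex.norm_real,
              Real.norm_of_nonneg (by linarith), Real.norm_eq_abs, mul_one]
          have hSa := le_abs_self S
          calc _ ≤ (a + |S| + n + 1) * |t| := by nlinarith
            _ ≤ _ := by gcongr; exact hz1 k
      _ = _ := by rw [Finset.prod_mul_distrib]; simp
  have hDb : Real.Gamma (a - σ + n) / Real.Gamma (a + σ + n) ≤ |D| := 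
    (le_abs_self _).trans ((hD σ hσ).trans (le_abs_self _))
  have e : ‖gq a (σ + t * Complex.I)‖ = ‖Complex.Gamma z‖ / ‖Complex.Gamma w‖ := by
    unfold gq
    rw [norm_div, hz, hw]
    congr 3 <;> (push_cast; ring)
  rw [e]
  calc _ ≤ (Real.Gamma (a - σ + n) / Real.Gamma (a + σ + n)) *
        (‖∏ k ∈ Finset.range n, (w + k)‖ / ‖∏ k ∈ Finset.range n, (z + k)‖) := by
        rw [div_mul_div_comm, div_le_div_iff₀ hN (by positivity)]
        nlinarith
    _ ≤ |D| * (a + |S| + n + 1) ^ n := by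
        gcongr
        rw [div_le_iff₀ hP0]
        exact hPQ

/-- the numerator at the pole `a + n` -/
def hq (a x : ℝ) (b : ℂ) (n : ℕ) (ζ : ℂ) : ℂ :=
  -(Complex.Gamma (a + n + 1 - ζ) / ∏ k ∈ Finset.range n, (a - ζ + k)) * (Complex.Gamma (a + ζ))⁻¹ *
    (x : ℂ) ^ ζ / (ζ + b)

/-- the residue terms -/
def rq (a x : ℝ) (b : ℂ) (n : ℕ) : ℂ :=
  (((-1) ^ n / (n.factorial * Real.Gamma (n + 2 * a)) : ℝ) : ℂ) * ((x ^ (n + a) : ℝ) : ℂ) /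
    (a + n + b)

lemma aux_prod_fact (n : ℕ) :
    ∏ k ∈ Finset.range n, (-(n : ℂ) + k) = (-1) ^ n * (n.factorial : ℂ) := by
  rw [← Finset.prod_range_reflect, ← Finset.prod_range_add_one_eq_factorial]
  push_cast
  rw [show ((-1 : ℂ) ^ n) = ∏ k ∈ Finset.range n, (-1 : ℂ) by simp, ← Finset.prod_mul_distrib]
  refine Finset.prod_congr rfl fun k hk => ?_
  have := Finset.mem_range.1 hk
  rw [Nat.sub_sub, Nat.cast_sub (by omega)]
  push_cast; ring

lemma hq_at (a x : ℝ) (hx : 0 < x) (b : ℂ) (n : ℕ) : hq a x b n ((a + n : ℝ) : ℂ) = - rq a x b n := by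
  unfold hq rq
  rw [show (a : ℂ) + n + 1 - ((a + n : ℝ) : ℂ) = 1 by push_cast; ring, Complex.Gamma_one]
  rw [show (a : ℂ) - ((a + n : ℝ) : ℂ) = -n by push_cast; ring, aux_prod_fact]
  rw [show (a : ℂ) + ((a + n : ℝ) : ℂ) = ((n + 2 * a : ℝ) : ℂ) by push_cast; ring,
    Complex.Gamma_ofReal, ← Complex.ofReal_cpow hx.le, add_comm a (n : ℝ)]
  push_cast
  rw [add_comm (n : ℂ) a]
  have : ((-1 : ℂ) ^ n) * (-1) ^ n = 1 := by rw [← mul_pow]; simp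
  have h1 : (1 : ℂ) / ((-1) ^ n * n.factorial) = (-1) ^ n / n.factorial := by
    have h0 : ((-1 : ℂ) ^ n) ≠ 0 := by simp
    have h2 : (n.factorial : ℂ) ≠ 0 := by exact_mod_cast n.factorial_ne_zero
    field_simp
    rw [sq, this]
  rw [h1]
  simp only [div_eq_mul_inv, mul_inv]
  ring

lemma hq_eq (a x : ℝ) (b : ℂ) (n : ℕ) (ζ : ℂ) (h : ∀ k : ℕ, (a : ℂ) - ζ ≠ -k) :
    hq a x b n ζ / (ζ - ((a + n : ℝ) : ℂ)) = fq a x b ζ := by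
  unfold hq fq gq
  have hp := aux_gamma_prod _ h (n + 1)
  rw [Finset.prod_range_succ] at hp
  rw [show (a : ℂ) + n + 1 - ζ = a - ζ + (n + 1 : ℕ) by push_cast; ring, hp]
  have hP : ∏ k ∈ Finset.range n, ((a : ℂ) - ζ + k) ≠ 0 := by
    rw [Finset.prod_ne_zero_iff]
    intro k _ h0
    exact h k (eq_neg_of_add_eq_zero_left h0)
  have hn : (a : ℂ) - ζ + n ≠ 0 := fun h0 => h n (eq_neg_of_add_eq_zero_left h0)
  have e : ζ - ((a + n : ℝ) : ℂ) = -((a : ℂ) - ζ + n) := by push_cast; ring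
  rw [e]
  generalize (a : ℂ) - ζ + n = A at *
  generalize ∏ k ∈ Finset.range n, ((a : ℂ) - ζ + k) = P at *
  simp only [div_eq_mul_inv, inv_neg]
  rw [show ∀ g c d f : ℂ, -(P * A * g * P⁻¹) * c * d * f * -A⁻¹ = g * c * d * f * (P * P⁻¹) * (A * A⁻¹) by
    intros; ring, mul_inv_cancel₀ hP, mul_inv_cancel₀ hn]
  ring

lemma hq_diff (a x : ℝ) (hx : 0 < x) (b : ℂ) (hb : 0 ≤ b.re) (n : ℕ) (L : ℝ) (hL0 : 0 ≤ L)
    (hL : ∀ k : ℕ, k < n → a + k ≤ L) :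
    DifferentiableOn ℂ (hq a x b n) {z : ℂ | L < z.re ∧ z.re < a + n + 1} := by
  intro z hz
  apply DifferentiableAt.differentiableWithinAt
  have hx0 : (x : ℂ) ≠ 0 := by exact_mod_cast hx.ne'
  unfold hq
  refine DifferentiableAt.div (DifferentiableAt.mul (DifferentiableAt.mul (DifferentiableAt.neg
    (DifferentiableAt.div ?_ ?_ ?_)) ?_) ?_) (by fun_prop) ?_
  · refine DifferentiableAt.comp (f := fun z : ℂ => (a : ℂ) + n + 1 - z) (g := Complex.Gamma) z ?_
      (by fun_prop)
    apply Complex.differentiableAt_Gamma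
    intro m h
    have := congrArg Complex.re h
    simp at this
    have h0 : (0 : ℝ) ≤ m := by positivity
    linarith [hz.2]
  · fun_prop
  · rw [Finset.prod_ne_zero_iff]
    intro k hk h
    have := congrArg Complex.re h
    simp at this
    linarith [hL k (Finset.mem_range.1 hk), hz.1]
  · exact (Complex.differentiable_one_div_Gamma _).comp (f := fun z : ℂ => (a : ℂ) + z) z
      (by fun_prop)
  · exact (differentiableAt_id).const_cpow (Or.inl hx0)
  · intro h
    have := congrArg Complex.re h
    simp at this
    linarith [hz.1]

lemma fq_step (a x : ℝ) (ha : 1 / 2 ≤ a) (hx : 0 < x) (hx1 : x < 1) (b : ℂ) (hb : 0 ≤ b.re)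
    (n : ℕ) (L σ1 σ2 : ℝ) (hL0 : 0 ≤ L) (hL : ∀ k : ℕ, k < n → a + k ≤ L)
    (h1 : L < σ1) (h1' : 1 / 4 ≤ σ1) (h2 : σ1 < a + n) (h3 : a + n < σ2) (h4 : σ2 < a + n + 1)
    (hs1 : ∀ m : ℕ, a - σ1 ≠ -m) (hs2 : ∀ m : ℕ, a - σ2 ≠ -m)
    (i1 : Integrable fun t : ℝ => fq a x b (σ1 + t * Complex.I))
    (i2 : Integrable fun t : ℝ => fq a x b (σ2 + t * Complex.I)) :
    (∫ t : ℝ, fq a x b (σ1 + t * Complex.I)) =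
      (∫ t : ℝ, fq a x b (σ2 + t * Complex.I)) + 2 * Real.pi * rq a x b n := by
  obtain ⟨C, hC0, hC⟩ := gq_hor a ha (n + 1) σ2 (by push_cast; linarith)
  have hline : ∀ σ : ℝ, (∀ m : ℕ, a - σ ≠ -m) → ∀ t : ℝ,
      hq a x b n (σ + t * Complex.I) / (σ + t * Complex.I - ((a + n : ℝ) : ℂ)) =
        fq a x b (σ + t * Complex.I) := by
    intro σ hσ t
    apply hq_eq
    intro k h
    have := congrArg Complex.re h
    simp at this
    exact hσ k this
  have hdecay : ∀ᶠ T in atTop, ∀ σ ∈ Icc σ1 σ2, ∀ t : ℝ, |t| = T →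
      ‖hq a x b n (σ + t * Complex.I) / (σ + t * Complex.I - ((a + n : ℝ) : ℂ))‖ ≤
        C * (T - |b.im|)⁻¹ := by
    filter_upwards [eventually_ge_atTop 1, eventually_gt_atTop |b.im|] with T hT1 hT2 σ hσ t ht
    rw [hq_eq]
    · unfold fq
      rw [norm_div, norm_mul, Complex.norm_cpow_eq_rpow_re_of_pos hx]
      have k1 : x ^ ((σ : ℂ) + t * Complex.I).re ≤ 1 := by
        apply Real.rpow_le_one hx.le hx1.le
        simp; linarith [hσ.1]
      have k2 : T - |b.im| ≤ ‖(σ : ℂ) + t * Complex.I + b‖ := by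
        have : ((σ : ℂ) + t * Complex.I + b).im = t + b.im := by simp
        have h := Complex.abs_im_le_norm ((σ : ℂ) + t * Complex.I + b)
        rw [this] at h
        refine le_trans ?_ h
        have := abs_sub_abs_le_abs_sub t (-b.im)
        rwa [abs_neg, sub_neg_eq_add, ht] at this
      have k3 := hC σ ⟨by linarith [hσ.1], hσ.2⟩ t (by rw [ht]; exact hT1)
      have : 0 < T - |b.im| := by linarith
      calc _ ≤ C * 1 / (T - |b.im|) := by gcongr
        _ = _ := by rw [mul_one, div_eq_mul_inv]
    · intro k h
      have := congrArg Complex.im h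
      simp at this
      rw [this, abs_zero] at ht
      linarith
  have he : Tendsto (fun T : ℝ => C * (T - |b.im|)⁻¹) atTop (𝓝 0) := by
    have : Tendsto (fun T : ℝ => (T - |b.im|)) atTop atTop :=
      tendsto_atTop_add_const_right atTop (-|b.im|) tendsto_id
    simpa using (tendsto_inv_atTop_zero.comp this).const_mul C
  have key := aux_shift σ1 σ2 (a + n) h2 h3 (hq a x b n) {z : ℂ | L < z.re ∧ z.re < a + n + 1}
    ((isOpen_lt continuous_const Complex.continuous_re).inter
      (isOpen_lt Complex.continuous_re continuous_const))
    (fun z hz1 hz2 => ⟨by linarith, by linarith⟩) (hq_diff a x hx b hb n L hL0 hL) _ he hdecay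
    (by simpa only [hline σ1 hs1] using i1) (by simpa only [hline σ2 hs2] using i2)
  simp only [hline σ1 hs1, hline σ2 hs2, hq_at a x hx b n] at key
  rw [key]; ring

lemma fq_tendsto (a x : ℝ) (ha : 1 / 2 ≤ a) (hx : 0 < x) (hx1 : x < 1) (b : ℂ) (hb : 0 ≤ b.re) :
    Tendsto (fun N => 2 * Real.pi * ∑ n ∈ Finset.range N, rq a x b n) atTop
      (𝓝 (∫ t : ℝ, fq a x b ((1/4 : ℝ) + t * Complex.I))) := by
  obtain ⟨C0, hC0⟩ := gq_quarter a ha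
  have hq4 : ∀ m : ℕ, a - 1/4 ≠ -m := by
    intro m h
    have : (0:ℝ) ≤ m := by positivity
    linarith
  have hr : ∀ n : ℕ, ∀ m : ℕ, a - (a + n + 1/2) ≠ -m := by
    intro n m h
    apply aux_not_int (n + 1) m
    push_cast
    linarith
  have i0 := fq_int a x hx hx1 b hb (1/4) C0 le_rfl hq4 hC0
  have iN := fun n : ℕ => fq_int a x hx hx1 b hb (a + n + 1/2) _
    (by have : (0:ℝ) ≤ n := by positivity
        linarith) (hr n) (gq_right a ha n)
  have hsum : ∀ N : ℕ, (∫ t : ℝ, fq a x b ((1/4 : ℝ) + t * Complex.I)) =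
      (∫ t : ℝ, fq a x b ((a + N + 1/2 : ℝ) + t * Complex.I)) +
        2 * Real.pi * ∑ n ∈ Finset.range (N + 1), rq a x b n := by
    intro N
    induction N with
    | zero =>
      have := fq_step a x ha hx hx1 b hb 0 0 (1/4) (a + (0:ℕ) + 1/2) le_rfl (by simp) (by norm_num)
        le_rfl (by push_cast; linarith) (by linarith) (by linarith) hq4 (hr 0) i0.1 (iN 0).1
      rw [this]
      simp
    | succ N ih =>
      have hN : (0:ℝ) ≤ N := by positivity
      have := fq_step a x ha hx hx1 b hb (N + 1) (a + N) (a + N + 1/2) (a + (N + 1 : ℕ) + 1/2)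
        (by linarith)
        (fun k hk => by
          have : (k : ℝ) ≤ N := by exact_mod_cast Nat.lt_succ_iff.1 hk
          linarith) (by linarith) (by linarith) (by push_cast; linarith) (by linarith)
          (by linarith) (hr N) (hr (N + 1)) (iN N).1 (iN (N + 1)).1
      rw [ih, this, Finset.sum_range_succ _ (N + 1)]
      ring
  rw [← tendsto_add_atTop_iff_nat 1]
  have hlim : Tendsto (fun N : ℕ => ∫ t : ℝ, fq a x b ((a + N + 1/2 : ℝ) + t * Complex.I)) atTop
      (𝓝 0) := by
    refine squeeze_zero_norm (fun N => (iN N).2) ?_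
    have hg : Tendsto (fun N : ℕ => 4 * Real.Gamma (1/2) / Real.Gamma (2 * a + N + 1/2)) atTop
        (𝓝 0) := by
      apply Tendsto.const_div_atTop
      refine tendsto_atTop_mono' _ ?_ tendsto_natCast_atTop_atTop
      filter_upwards [eventually_ge_atTop 2] with N hN
      have hN' : (2:ℝ) ≤ N := by exact_mod_cast hN
      have h1 := Real.Gamma_strictMonoOn_Ici.monotoneOn (a := (N : ℝ) + 1) (b := 2 * a + N + 1/2)
        (by simp only [mem_Ici]; linarith) (by simp only [mem_Ici]; linarith) (by linarith)
      rw [Real.Gamma_nat_eq_factorial] at h1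
      refine le_trans ?_ h1
      exact_mod_cast Nat.self_le_factorial N
    have := (hg.const_mul 8).mul_const (∫ t : ℝ, mw t ^ (-(3/4) : ℝ))
    simpa using this
  have := (tendsto_const_nhds (x := ∫ t : ℝ, fq a x b ((1/4 : ℝ) + t * Complex.I))).sub hlim
  rw [sub_zero] at this
  refine this.congr fun N => ?_
  rw [hsum N]; ring

/-- Bessel coefficients -/
def cq (α : ℝ) (k : ℕ) : ℝ := (-1) ^ k / (k.factorial * Real.Gamma (k + α + 1))

lemma cq_summable (α : ℝ) (hα : 0 ≤ α) : Summable fun k => |cq α k| := by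
  have hG0 : 0 < Real.Gamma (α + 1) := Real.Gamma_pos_of_pos (by linarith)
  have hs : Summable fun k : ℕ => (1 + (Real.Gamma (α + 1))⁻¹) * ((1 : ℝ) ^ k / k.factorial) :=
    (Real.summable_pow_div_factorial 1).mul_left _
  refine Summable.of_nonneg_of_le (fun _ => abs_nonneg _) (fun k => ?_) hs
  have hk : (0:ℝ) ≤ k := by positivity
  have hGk : 0 < Real.Gamma (k + α + 1) := Real.Gamma_pos_of_pos (by linarith)
  have hb : (Real.Gamma (k + α + 1))⁻¹ ≤ 1 + (Real.Gamma (α + 1))⁻¹ := by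
    rcases Nat.eq_zero_or_pos k with h | h
    · subst h; simp
    · have hk1 : (1:ℝ) ≤ k := by exact_mod_cast h
      have h1 := Real.Gamma_strictMonoOn_Ici.monotoneOn (a := (2 : ℝ)) (b := k + α + 1)
        (by simp) (by simp only [mem_Ici]; linarith) (by linarith)
      rw [Real.Gamma_two] at h1
      have := inv_le_one_of_one_le₀ h1
      have : 0 < (Real.Gamma (α + 1))⁻¹ := by positivity
      linarith
  unfold cq
  rw [abs_div, abs_pow, abs_neg, abs_one, one_pow, abs_of_pos (by positivity)]
  have hf : (0:ℝ) < k.factorial := by positivity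
  calc (1:ℝ) / (k.factorial * Real.Gamma (k + α + 1)) = (Real.Gamma (k + α + 1))⁻¹ * (1 / k.factorial) := by
        field_simp
    _ ≤ _ := by gcongr

/-- Bessel series -/
def bq (α x u : ℝ) : ℝ := ∑' k : ℕ, cq α k * (u * x) ^ (k + α / 2)

lemma bq_term_bound (α : ℝ) (hα : 0 ≤ α) (x u : ℝ) (hx : 0 < x) (hx1 : x < 1) (hu : u ∈ Icc (0:ℝ) 1)
    (k : ℕ) : ‖cq α k * (u * x) ^ (k + α / 2)‖ ≤ |cq α k| := by
  have h0 : 0 ≤ u * x := mul_nonneg hu.1 hx.le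
  rw [norm_mul, Real.norm_eq_abs, Real.norm_of_nonneg (Real.rpow_nonneg h0 _)]
  apply mul_le_of_le_one_right (abs_nonneg _)
  apply Real.rpow_le_one h0 _ (by positivity)
  nlinarith [hu.1, hu.2]

lemma bq_cont (α : ℝ) (hα : 0 ≤ α) (x : ℝ) (hx : 0 < x) (hx1 : x < 1) :
    ContinuousOn (bq α x) (Icc 0 1) := by
  unfold bq
  refine continuousOn_tsum (fun k => ?_) (cq_summable α hα)
    (fun k u hu => bq_term_bound α hα x u hx hx1 hu k)
  apply Continuous.continuousOn
  refine continuous_const.mul ?_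
  exact (by fun_prop : Continuous fun u : ℝ => u * x).rpow_const
    (fun u => Or.inr (by positivity))

lemma bessel_eq (α : ℝ) (x u : ℝ) (hx : 0 < x) (hu : 0 < u) :
    besselJ α (2 * Real.sqrt (u * x)) = bq α x u := by
  unfold besselJ bq
  congr 1
  ext k
  have h : (2 * Real.sqrt (u * x) / 2) ^ (2 * (k : ℝ) + α) = (u * x) ^ (k + α / 2) := by
    rw [mul_div_cancel_left₀ _ two_ne_zero, Real.sqrt_eq_rpow, ← Real.rpow_mul (by positivity)]
    congr 1; ring
  rw [h, cq]; ring

lemma bq_int (α : ℝ) (hα : 0 ≤ α) (x : ℝ) (hx : 0 < x) (hx1 : x < 1) (g : ℝ → ℝ)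
    (hg : ContinuousOn g (Icc 0 1)) :
    ∫ u in (0:ℝ)..1, g u * bq α x u =
      ∑' k : ℕ, cq α k * x ^ (k + α / 2) * ∫ u in (0:ℝ)..1, g u * u ^ (k + α / 2) := by
  obtain ⟨B, hB⟩ := isCompact_Icc.exists_bound_of_continuousOn hg
  have hsub : ∀ t : ℝ, t ∈ uIoc (0:ℝ) 1 → t ∈ Icc (0:ℝ) 1 := fun t ht => by
    rw [uIoc_of_le zero_le_one] at ht
    exact Ioc_subset_Icc_self ht
  have hc : ∀ k : ℕ, Continuous fun u : ℝ => cq α k * (u * x) ^ (k + α / 2) := fun k => by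
    refine continuous_const.mul ?_
    exact (by fun_prop : Continuous fun u : ℝ => u * x).rpow_const
      (fun u => Or.inr (by positivity))
  have hB0 : 0 ≤ B := (norm_nonneg _).trans (hB 0 (by simp))
  have key := intervalIntegral.hasSum_integral_of_dominated_convergence (μ := volume) (a := 0)
    (b := 1) (F := fun (k : ℕ) (u : ℝ) => g u * (cq α k * (u * x) ^ (k + α / 2)))
    (f := fun u => g u * bq α x u) (fun k _ => B * |cq α k|) ?_ ?_ ?_ ?_ ?_
  · rw [← key.tsum_eq]
    congr 1
    ext k
    rw [← intervalIntegral.integral_const_mul]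
    refine intervalIntegral.integral_congr fun u hu => ?_
    rw [uIcc_of_le zero_le_one] at hu
    rw [Real.mul_rpow hu.1 hx.le]
    ring
  · intro k
    refine ContinuousOn.aestronglyMeasurable ?_ measurableSet_uIoc
    exact (hg.mono hsub).mul (hc k).continuousOn
  · intro k
    refine Eventually.of_forall fun u hu => ?_
    rw [norm_mul]
    exact mul_le_mul (hB u (hsub u hu)) (bq_term_bound α hα x u hx hx1 (hsub u hu) k)
      (norm_nonneg _) hB0
  · exact Eventually.of_forall fun u _ => (cq_summable α hα).mul_left B
  · exact intervalIntegrable_const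
  · refine Eventually.of_forall fun u hu => ?_
    refine HasSum.mul_left _ ?_
    exact (Summable.of_norm_bounded (cq_summable α hα)
      (bq_term_bound α hα x u hx hx1 (hsub u hu))).hasSum

lemma rhs_eq (α : ℝ) (hα : 0 ≤ α) (x y : ℝ) (hx0 : 0 < x) (hx1 : x < 1) (hy0 : 0 < y) (hy1 : y < 1) :
    (∫ u in (0 : ℝ)..1,
        besselJ α (2 * Real.sqrt (u * x)) * besselJ α (2 * Real.sqrt (u * y))) =
    ∑' k : ℕ, cq α k * y ^ (k + α / 2) *
      ∑' j : ℕ, cq α j * x ^ (j + α / 2) * (1 / (k + j + α + 1)) := by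
  have e1 : (∫ u in (0 : ℝ)..1,
        besselJ α (2 * Real.sqrt (u * x)) * besselJ α (2 * Real.sqrt (u * y))) =
      ∫ u in (0:ℝ)..1, bq α x u * bq α y u := by
    refine intervalIntegral.integral_congr_ae (Eventually.of_forall fun u hu => ?_)
    rw [uIoc_of_le zero_le_one] at hu
    rw [bessel_eq α x u hx0 hu.1, bessel_eq α y u hy0 hu.1]
  rw [e1, bq_int α hα y hy0 hy1 _ (bq_cont α hα x hx0 hx1)]
  congr 1
  ext k
  congr 1
  have hk : Continuous fun u : ℝ => u ^ (k + α / 2) :=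
    continuous_id.rpow_const (fun u => Or.inr (by positivity))
  rw [show (fun u : ℝ => bq α x u * u ^ (k + α / 2)) = fun u => u ^ (k + α / 2) * bq α x u from
    funext fun u => mul_comm _ _, bq_int α hα x hx0 hx1 _ hk.continuousOn]
  congr 1
  ext j
  congr 1
  have : ∫ u in (0:ℝ)..1, u ^ (k + α / 2) * u ^ (j + α / 2) =
      ∫ u in (0:ℝ)..1, u ^ (k + j + α) := by
    refine intervalIntegral.integral_congr_ae (Eventually.of_forall fun u hu => ?_)
    rw [uIoc_of_le zero_le_one] at hu
    rw [← Real.rpow_add hu.1]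
    congr 1; ring
  have hp : (0:ℝ) ≤ k + j + α := by positivity
  rw [this, integral_rpow (Or.inl (by linarith)), Real.one_rpow, Real.zero_rpow (by linarith), sub_zero]

lemma rq_hasSum (α x : ℝ) (hα : 0 ≤ α) (hx : 0 < x) (hx1 : x < 1) (b : ℂ) (hb : 0 ≤ b.re) :
    (∫ t : ℝ, fq ((α + 1) / 2) x b ((1/4 : ℝ) + t * Complex.I)) =
      2 * Real.pi * ∑' n : ℕ, rq ((α + 1) / 2) x b n := by
  have ha : 1 / 2 ≤ (α + 1) / 2 := by linarith
  have hs : Summable (rq ((α + 1) / 2) x b) := by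
    refine Summable.of_norm_bounded ((cq_summable α hα).mul_left 2) fun n => ?_
    unfold rq
    have e : ((-1) ^ n / (n.factorial * Real.Gamma (n + 2 * ((α + 1) / 2)))) = cq α n := by
      unfold cq; congr 3; ring
    rw [e, norm_div, norm_mul, Complex.norm_real, Complex.norm_real,
      Real.norm_of_nonneg (Real.rpow_nonneg hx.le _), Real.norm_eq_abs]
    have h1 : x ^ (n + (α + 1) / 2) ≤ 1 := Real.rpow_le_one hx.le hx1.le (by positivity)
    have h2 : 1 / 2 ≤ ‖(((α + 1) / 2 : ℝ) : ℂ) + n + b‖ := by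
      refine le_trans ?_ (Complex.re_le_norm _)
      have : ((((α + 1) / 2 : ℝ) : ℂ) + n + b).re = (α + 1) / 2 + n + b.re := by
        simp
      rw [this]
      have : (0:ℝ) ≤ n := by positivity
      linarith
    calc _ ≤ |cq α n| * 1 / (1 / 2) := by gcongr
      _ = _ := by ring
  have h1 := fq_tendsto ((α + 1) / 2) x ha hx hx1 b hb
  have h2 := hs.hasSum.tendsto_sum_nat.const_mul (2 * Real.pi : ℂ)
  exact tendsto_nhds_unique h1 h2

lemma Fhe_eq (α : ℝ) (ζ : ℂ) : Fhe α 1 1 ζ = gq ((α + 1) / 2) ζ := by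
  unfold Fhe gq
  push_cast
  congr 2 <;> ring

lemma gq_inv (a : ℝ) (ζ : ℂ) : (gq a ζ)⁻¹ = gq a (-ζ) := by
  unfold gq
  rw [inv_div, sub_neg_eq_add, ← sub_eq_add_neg]

lemma inner_eq (α x y : ℝ) (hα : 0 ≤ α) (hy0 : 0 < y) (hy1 : y < 1) (t : ℝ) :
    (∫ s : ℝ,
      (Fhe α 1 1 ((1/4 : ℝ) + t * Complex.I) / Fhe α 1 1 (-((1/4 : ℝ) : ℂ) + s * Complex.I)) *
        (x : ℂ) ^ (((1/4 : ℝ) : ℂ) + t * Complex.I) *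
        (y : ℂ) ^ (-(-((1/4 : ℝ) : ℂ) + s * Complex.I)) /
        ((((1/4 : ℝ) : ℂ) + t * Complex.I) - (-((1/4 : ℝ) : ℂ) + s * Complex.I)) * Complex.I) =
    ∑' k : ℕ, 2 * Real.pi * Complex.I * (((cq α k * y ^ (k + (α + 1) / 2) : ℝ) : ℂ) *
      fq ((α + 1) / 2) x (((α + 1) / 2 + k : ℝ) : ℂ) ((1/4 : ℝ) + t * Complex.I)) := by
  set ζ : ℂ := ((1/4 : ℝ) : ℂ) + t * Complex.I with hζ
  set a : ℝ := (α + 1) / 2 with ha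
  have hre : 0 ≤ ζ.re := by rw [hζ]; simp
  have e : ∀ s : ℝ, (Fhe α 1 1 ζ / Fhe α 1 1 (-((1/4 : ℝ) : ℂ) + s * Complex.I)) *
        (x : ℂ) ^ ζ * (y : ℂ) ^ (-(-((1/4 : ℝ) : ℂ) + s * Complex.I)) /
        (ζ - (-((1/4 : ℝ) : ℂ) + s * Complex.I)) * Complex.I =
      gq a ζ * (x : ℂ) ^ ζ * Complex.I *
        (fun s : ℝ => fq a y ζ ((1/4 : ℝ) + s * Complex.I)) (-s) := by
    intro s
    simp only [Fhe_eq, ← ha, fq]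
    rw [div_eq_mul_inv (gq a ζ), gq_inv,
      show -(-((1/4 : ℝ) : ℂ) + s * Complex.I) = ((1/4 : ℝ) : ℂ) + (-s : ℝ) * Complex.I by
        push_cast; ring,
      show ζ - (-((1/4 : ℝ) : ℂ) + s * Complex.I) = ((1/4 : ℝ) : ℂ) + (-s : ℝ) * Complex.I + ζ by
        push_cast; ring]
    ring
  simp only [e]
  rw [integral_const_mul, integral_neg_eq_self (fun s : ℝ => fq a y ζ ((1/4 : ℝ) + s * Complex.I)),
    rq_hasSum α y hα hy0 hy1 ζ hre, ← ha, ← tsum_mul_left, ← tsum_mul_left]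
  congr 1
  ext k
  have e2 : ((-1) ^ k / (k.factorial * Real.Gamma (k + 2 * a))) = cq α k := by
    unfold cq; congr 3; rw [ha]; ring
  rw [rq, e2, fq, show ζ + ((a + k : ℝ) : ℂ) = a + k + ζ by push_cast; ring]
  push_cast
  ring

theorem statement9 (α : ℝ) (hα : 0 ≤ α)
    (x y : ℝ) (hx0 : 0 < x) (hx1 : x < 1) (hy0 : 0 < y) (hy1 : y < 1) :
    Khe α 1 1 x y =
      ((∫ u in (0 : ℝ)..1,
        besselJ α (2 * Real.sqrt (u * x)) * besselJ α (2 * Real.sqrt (u * y)) : ℝ) : ℂ) := by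
  have hA : 1 / 2 ≤ (α + 1) / 2 := by linarith
  have hI : ((min (((1:ℝ) : ℝ) : ℝ) ((1:ℝ) : ℝ) : ℝ) : ℂ) / 4 = ((1/4 : ℝ) : ℂ) := by simp
  unfold Khe
  simp only [hI]
  simp only [inner_eq α x y hα hy0 hy1]
  obtain ⟨C, hC⟩ := gq_quarter ((α + 1) / 2) hA
  have hq4 : ∀ m : ℕ, (α + 1) / 2 - 1/4 ≠ -m := by
    intro m h
    have : (0:ℝ) ≤ m := by positivity
    linarith
  have hbk : ∀ k : ℕ, 0 ≤ ((((α + 1) / 2 + k : ℝ) : ℂ)).re := fun k => by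
    rw [Complex.ofReal_re]; positivity
  have hint : ∀ k : ℕ, Integrable fun t : ℝ => ((cq α k * y ^ (k + (α + 1) / 2) : ℝ) : ℂ) *
      fq ((α + 1) / 2) x (((α + 1) / 2 + k : ℝ) : ℂ) ((1/4 : ℝ) + t * Complex.I) := fun k =>
    (fq_int _ x hx0 hx1 _ (hbk k) (1/4) C le_rfl hq4 hC).1.const_mul _
  have hW : Integrable fun t : ℝ => 4 * C * (mw t ^ (-(3/4) : ℝ) + mw t ^ (-(3/4) : ℝ)) :=
    (mw_int.add mw_int).const_mul _
  have hsum : Summable fun k : ℕ => ∫ t : ℝ, ‖((cq α k * y ^ (k + (α + 1) / 2) : ℝ) : ℂ) *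
      fq ((α + 1) / 2) x (((α + 1) / 2 + k : ℝ) : ℂ) ((1/4 : ℝ) + t * Complex.I)‖ := by
    refine Summable.of_nonneg_of_le (fun k => integral_nonneg fun t => norm_nonneg _) (fun k => ?_)
      ((cq_summable α hα).mul_right
        (∫ t : ℝ, 4 * C * (mw t ^ (-(3/4) : ℝ) + mw t ^ (-(3/4) : ℝ))))
    rw [← integral_const_mul]
    refine integral_mono (hint k).norm (hW.const_mul _) fun t => ?_
    simp only [norm_mul]
    have h1 := fq_bound ((α + 1) / 2) x hx0 hx1 _ (hbk k) (1/4) t C le_rfl (hC t)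
    rw [Complex.ofReal_im, add_zero] at h1
    have h2 : ‖((cq α k * y ^ (k + (α + 1) / 2) : ℝ) : ℂ)‖ ≤ |cq α k| := by
      rw [Complex.norm_real, norm_mul, Real.norm_eq_abs,
        Real.norm_of_nonneg (Real.rpow_nonneg hy0.le _)]
      exact mul_le_of_le_one_right (abs_nonneg _) (Real.rpow_le_one hy0.le hy1.le (by positivity))
    exact mul_le_mul h2 h1 (norm_nonneg _) (abs_nonneg _)
  have hswap := integral_tsum_of_summable_integral_norm hint hsum
  simp only [tsum_mul_left]
  rw [integral_mul_const, integral_const_mul, ← hswap, rhs_eq α hα x y hx0 hx1 hy0 hy1]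
  have hterm : ∀ k : ℕ, (∫ t : ℝ, ((cq α k * y ^ (k + (α + 1) / 2) : ℝ) : ℂ) *
      fq ((α + 1) / 2) x (((α + 1) / 2 + k : ℝ) : ℂ) ((1/4 : ℝ) + t * Complex.I)) =
      2 * Real.pi * ((x * y) ^ (1/2 : ℝ) : ℝ) * ((cq α k * y ^ (k + α / 2) *
      ∑' j : ℕ, cq α j * x ^ (j + α / 2) * (1 / (k + j + α + 1)) : ℝ) : ℂ) := by
    intro k
    rw [integral_const_mul, rq_hasSum α x hα hx0 hx1 _ (hbk k)]
    have hr : ∀ j : ℕ, rq ((α + 1) / 2) x (((α + 1) / 2 + k : ℝ) : ℂ) j =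
        ((x ^ (1/2 : ℝ) * (cq α j * x ^ (j + α / 2) * (1 / (k + j + α + 1))) : ℝ) : ℂ) := by
      intro j
      have e2 : ((-1) ^ j / (j.factorial * Real.Gamma (j + 2 * ((α + 1) / 2)))) = cq α j := by
        unfold cq; congr 3; ring
      have e3 : x ^ (j + (α + 1) / 2) = x ^ (1/2 : ℝ) * x ^ (j + α / 2) := by
        rw [← Real.rpow_add hx0]; congr 1; ring
      rw [rq, e2, e3]
      push_cast
      rw [show ((α : ℂ) + 1) / 2 + j + ((α + 1) / 2 + k) = k + j + α + 1 by ring]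
      ring
    simp only [hr]
    rw [← Complex.ofReal_tsum, tsum_mul_left]
    have e3 : y ^ (k + (α + 1) / 2) = y ^ (1/2 : ℝ) * y ^ (k + α / 2) := by
      rw [← Real.rpow_add hy0]; congr 1; ring
    rw [e3, Real.mul_rpow hx0.le hy0.le]
    push_cast
    ring
  simp only [hterm]
  rw [tsum_mul_left, ← Complex.ofReal_tsum]
  generalize (∑' k : ℕ, cq α k * y ^ (k + α / 2) *
      ∑' j : ℕ, cq α j * x ^ (j + α / 2) * (1 / (k + j + α + 1)) : ℝ) = Z
  have hxy : ((x * y) ^ (-(1/2) : ℝ)) * ((x * y) ^ (1/2 : ℝ)) = 1 := by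
    rw [← Real.rpow_add (by positivity)]; norm_num
  have hxy' : (((x * y) ^ (-(1/2) : ℝ) : ℝ) : ℂ) * (((x * y) ^ (1/2 : ℝ) : ℝ) : ℂ) = 1 := by
    rw [← Complex.ofReal_mul, hxy, Complex.ofReal_one]
  have hpi : (2 * Real.pi * Complex.I : ℂ) ≠ 0 := by
    simp [Real.pi_ne_zero]
  calc _ = ((((x * y) ^ (-(1/2) : ℝ) : ℝ) : ℂ) * (((x * y) ^ (1/2 : ℝ) : ℝ) : ℂ)) *
        (((2 * Real.pi * Complex.I : ℂ) ^ 2)⁻¹ * (2 * Real.pi * Complex.I) ^ 2) * Z := by ring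
    _ = Z := by rw [hxy', inv_mul_cancel₀ (pow_ne_zero 2 hpi)]; ring

end
end

section
/- Fix reals 0<q<1, 0<a≤1, η,θ>0, Q=q^η, Q̃=q^θ, and let Λ be distributed according to the Muttalib–Borodin measure on (∞,∞)-based plane partitions. Let S(Λ)={Λ_{i,i}−i+1/2 : i≥1}⊂ℤ+1/2. Then for every m≥1 and all distinct half-integers k_1,…,k_m∈ℤ+1/2, P( {k_1,…,k_m} ⊆ S(Λ) ) = det_{1≤i,j≤m}[ K_d(k_i,k_j) ], where K_d is the discrete kernel with these parameters and M=N=∞. -/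
open MeasureTheory Filter Topology Set

noncomputable section



/-- Cauchy matrix with entries `1/(1 - x_i y_j)`. -/
def cauM {F : Type*} [Field F] {n : ℕ} (x y : Fin n → F) : Matrix (Fin n) (Fin n) F :=
  Matrix.of fun i j => (1 - x i * y j)⁻¹

lemma cauchy_aux {F : Type*} [Field F] {x y a b : F} (h1 : 1 - x * y ≠ 0) (h2 : 1 - x * b ≠ 0)
    (h3 : 1 - a * y ≠ 0) : (1 - x * y)⁻¹ - (1 - x * b)⁻¹ * (1 - a * b) * (1 - a * y)⁻¹ =
      (x - a) / (1 - x * b) * ((y - b) / (1 - a * y) * (1 - x * y)⁻¹) := by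
  have h3' : 1 - y * a ≠ 0 := by rwa [mul_comm]
  field_simp
  ring

lemma cauchy_border {F : Type*} [Field F] {n : ℕ} (x y : Fin n → F) (x0 y0 : F)
    (h00 : 1 - x0 * y0 ≠ 0) (h : ∀ i j, 1 - x i * y j ≠ 0) (hx : ∀ i, 1 - x i * y0 ≠ 0)
    (hy : ∀ j, 1 - x0 * y j ≠ 0) :
    (Matrix.fromBlocks (cauM x y) (Matrix.of fun i (_ : Fin 1) => (1 - x i * y0)⁻¹)
      (Matrix.of fun (_ : Fin 1) j => (1 - x0 * y j)⁻¹)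
      (Matrix.of fun (_ : Fin 1) (_ : Fin 1) => (1 - x0 * y0)⁻¹)).det =
    (1 - x0 * y0)⁻¹ * (∏ i, (x i - x0) / (1 - x i * y0)) * (∏ j, (y j - y0) / (1 - x0 * y j)) *
      (cauM x y).det := by
  let _inv : Invertible (Matrix.of fun (_ : Fin 1) (_ : Fin 1) => (1 - x0 * y0)⁻¹) :=
    ⟨Matrix.of fun _ _ => (1 - x0 * y0), by
      ext i j; obtain rfl := Subsingleton.elim i j; simp [Matrix.mul_apply, h00], by
      ext i j; obtain rfl := Subsingleton.elim i j; simp [Matrix.mul_apply, h00]⟩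
  rw [Matrix.det_fromBlocks₂₂]
  have e : cauM x y - (Matrix.of fun i (_ : Fin 1) => (1 - x i * y0)⁻¹) *
      ⅟(Matrix.of fun (_ : Fin 1) (_ : Fin 1) => (1 - x0 * y0)⁻¹) *
      (Matrix.of fun (_ : Fin 1) j => (1 - x0 * y j)⁻¹) =
      Matrix.of fun i j => ((x i - x0) / (1 - x i * y0)) *
        (Matrix.of fun i j => ((y j - y0) / (1 - x0 * y j)) * cauM x y i j) i j := by
    ext i j
    change cauM x y i j - ((Matrix.of fun i (_ : Fin 1) => (1 - x i * y0)⁻¹) *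
      (Matrix.of fun (_ : Fin 1) (_ : Fin 1) => (1 - x0 * y0)) *
      (Matrix.of fun (_ : Fin 1) j => (1 - x0 * y j)⁻¹)) i j = _
    simp only [cauM, Matrix.mul_apply, Matrix.of_apply, Finset.univ_unique, Finset.sum_singleton]
    exact cauchy_aux (h i j) (hx i) (hy j)
  rw [e, Matrix.det_mul_column, Matrix.det_mul_row]
  simp
  ring

lemma cauchy_resolvent {n : ℕ} (x y : Fin n → ℂ) (z w : ℂ)
    (hw : w ≠ 0) (hzw : z ≠ w) (h : ∀ i j, 1 - x i * y j ≠ 0) (hx : ∀ i, 1 - x i * z ≠ 0)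
    (hy : ∀ j, w - y j ≠ 0) (hdet : (cauM x y).det ≠ 0) :
    (z - w)⁻¹ + ∑ i, ∑ j, (cauM x y)⁻¹ j i * (1 - x i * z)⁻¹ * (w - y j)⁻¹ =
    (z - w)⁻¹ * (∏ i, (1 - x i * w) / (1 - x i * z)) * (∏ j, (z - y j) / (w - y j)) := by
  have hzw' : z - w ≠ 0 := sub_ne_zero.2 hzw
  have hwz' : w - z ≠ 0 := sub_ne_zero.2 hzw.symm
  have h00 : 1 - w⁻¹ * z ≠ 0 := by
    intro h0; apply hzw'; field_simp at h0; linear_combination -h0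
  have hy' : ∀ j, 1 - w⁻¹ * y j ≠ 0 := by
    intro j h0; apply hy j; field_simp at h0; simpa using h0
  have key := cauchy_border x y w⁻¹ z h00 h hx hy'
  let _inv : Invertible (cauM x y) := Matrix.invertibleOfIsUnitDet _ (Ne.isUnit hdet)
  rw [Matrix.det_fromBlocks₁₁, mul_comm _ (cauM x y).det] at key
  have key := mul_left_cancel₀ hdet key
  rw [Matrix.det_unique] at key
  simp only [Matrix.invOf_eq_nonsing_inv, Matrix.sub_apply, Matrix.mul_apply, Matrix.of_apply,
    Finset.sum_mul] at key
  have e0 : (1 - w⁻¹ * z)⁻¹ = -w * (z - w)⁻¹ := by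
    field_simp; ring
  have e1 : ∀ j, (1 - w⁻¹ * y j)⁻¹ = w * (w - y j)⁻¹ := by
    intro j; have := hy j; have := hy' j; field_simp
  have e2 : ∏ i, (x i - w⁻¹) / (1 - x i * z) = (∏ i, (1 - x i * w) / (1 - x i * z)) * (-w⁻¹) ^ n := by
    rw [← Fin.prod_const, ← Finset.prod_mul_distrib]
    refine Finset.prod_congr rfl fun i _ => ?_
    have := hx i; field_simp; ring
  have e3 : ∏ j, (y j - z) / (1 - w⁻¹ * y j) = (∏ j, (z - y j) / (w - y j)) * (-w) ^ n := by
    rw [← Fin.prod_const, ← Finset.prod_mul_distrib]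
    refine Finset.prod_congr rfl fun i _ => ?_
    rw [div_eq_mul_inv, e1]; have := hy i; field_simp; ring
  rw [e0, e2, e3] at key
  have e4 : (-w⁻¹) ^ n * (-w) ^ n = 1 := by rw [← mul_pow]; simp [hw]
  have e5 : ∑ i, ∑ j, (1 - w⁻¹ * y j)⁻¹ * (cauM x y)⁻¹ j i * (1 - x i * z)⁻¹ =
     w * ∑ i, ∑ j, (cauM x y)⁻¹ j i * (1 - x i * z)⁻¹ * (w - y j)⁻¹ := by
    rw [Finset.mul_sum]
    refine Finset.sum_congr rfl fun i _ => ?_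
    rw [Finset.mul_sum]
    refine Finset.sum_congr rfl fun j _ => ?_
    rw [e1]; ring
  rw [e5] at key
  have : -w * ((z - w)⁻¹ + ∑ i, ∑ j, (cauM x y)⁻¹ j i * (1 - x i * z)⁻¹ * (w - y j)⁻¹) =
    -w * ((z - w)⁻¹ * (∏ i, (1 - x i * w) / (1 - x i * z)) * (∏ j, (z - y j) / (w - y j))) := by
    linear_combination key + (-w * (z - w)⁻¹ * (∏ i, (1 - x i * w) / (1 - x i * z)) *
      (∏ j, (z - y j) / (w - y j))) * e4
  exact mul_left_cancel₀ (neg_ne_zero.2 hw) this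

/-- Vandermonde product. -/
def vdm (n : ℕ) (x : ℕ → ℝ) : ℝ := ∏ j ∈ Finset.range n, ∏ i ∈ Finset.range j, (x i - x j)

/-- The alternant `det[x_i^{l_j}]`. -/
def altD (n : ℕ) (x : ℕ → ℝ) (l : Fin n → ℕ) : ℝ :=
  (Matrix.of fun i j : Fin n => x i ^ l j).det

lemma altD_zero (n : ℕ) (x : ℕ → ℝ) : altD n x (fun j => n - 1 - j) = vdm n x := by
  have := Matrix.det_projVandermonde (fun _ : Fin n => (1 : ℝ)) (fun i => x i)
  have e : (Matrix.projVandermonde (fun _ : Fin n => (1 : ℝ)) (fun i => x i)) =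
      Matrix.of fun i j : Fin n => x i ^ (n - 1 - (j : ℕ)) := by
    ext i j
    simp [Matrix.projVandermonde_apply, Fin.val_rev, Nat.sub_sub, add_comm]
  rw [e] at this
  rw [altD, this, vdm, ← Fin.prod_univ_eq_prod_range (fun j => ∏ i ∈ Finset.range j, (x i - x j)) n]
  rw [Finset.prod_comm' (t' := Finset.univ) (s' := fun j => Finset.Iio j) (by simp)]
  refine Finset.prod_congr rfl fun j _ => ?_
  simp only [one_mul]
  refine Finset.prod_bij (fun i _ => (i : ℕ)) ?_ ?_ ?_ ?_
  · intro i hi; simpa using hi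
  · intro i _ i' _ h; exact Fin.ext h
  · intro i hi
    have hi := Finset.mem_range.1 hi
    exact ⟨⟨i, hi.trans j.2⟩, by simp [Fin.lt_def, hi], rfl⟩
  · intro i _; rfl

lemma cauchy_det (n : ℕ) (x y : ℕ → ℝ) (h : ∀ i j, 1 - x i * y j ≠ 0) :
    (cauM (fun i : Fin n => x i) (fun i : Fin n => y i)).det =
      vdm n x * vdm n y * ∏ i ∈ Finset.range n, ∏ j ∈ Finset.range n, (1 - x i * y j)⁻¹ := by
  induction n with
  | zero => simp [vdm]
  | succ n ih =>
    have key := cauchy_border (fun i : Fin n => x i) (fun i : Fin n => y i) (x n) (y n) (h _ _)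
      (fun _ _ => h _ _) (fun _ => h _ _) (fun _ => h _ _)
    rw [ih] at key
    rw [← Matrix.det_submatrix_equiv_self finSumFinEquiv]
    have e : (cauM (fun i : Fin (n+1) => x i) (fun i : Fin (n+1) => y i)).submatrix
      (finSumFinEquiv : Fin n ⊕ Fin 1 ≃ _) (finSumFinEquiv : Fin n ⊕ Fin 1 ≃ _) =
      (Matrix.fromBlocks (cauM (fun i : Fin n => x i) (fun i : Fin n => y i))
        (Matrix.of fun i (_ : Fin 1) => (1 - x i * y n)⁻¹)
      (Matrix.of fun (_ : Fin 1) j => (1 - x n * y j)⁻¹)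
      (Matrix.of fun (_ : Fin 1) (_ : Fin 1) => (1 - x n * y n)⁻¹)) := by
      ext i j
      rcases i with i | i <;> rcases j with j | j <;> simp [cauM]
    rw [e, key]
    simp only [vdm, Finset.prod_range_succ, Finset.prod_div_distrib, Finset.prod_mul_distrib]
    rw [← Fin.prod_univ_eq_prod_range (fun i => x i - x n), 
      ← Fin.prod_univ_eq_prod_range (fun i => y i - y n),
      ← Fin.prod_univ_eq_prod_range (fun i => (1 - x i * y n)⁻¹),
      ← Fin.prod_univ_eq_prod_range (fun i => (1 - x n * y i)⁻¹)]
    simp only [Finset.prod_inv_distrib]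
    ring

lemma HasSum.congr_fun' {ι : Type*} {f g : ι → ℝ} {a : ℝ} (h : HasSum f a) (e : ∀ i, g i = f i) :
    HasSum g a := by
  rwa [show g = f from funext e]

lemma hasSum_pi_prod (n : ℕ) (a : Fin n → ℕ → ℝ) (h : ∀ j, Summable (fun l => ‖a j l‖)) :
    Summable (fun g : Fin n → ℕ => ‖∏ j, a j (g j)‖) ∧
    HasSum (fun g : Fin n → ℕ => ∏ j, a j (g j)) (∏ j, ∑' l, a j l) := by
  induction n with
  | zero =>
    refine ⟨(hasSum_fintype _).summable, ?_⟩
    simp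
  | succ n ih =>
    obtain ⟨ih1, ih2⟩ := ih (fun j => a j.succ) (fun j => h j.succ)
    have s := summable_mul_of_summable_norm (h 0) ih1
    have s' := Summable.mul_norm (h 0) ih1
    have e : ∀ p : ℕ × (Fin n → ℕ), ∏ j, a j ((Fin.consEquiv (fun _ : Fin (n+1) => ℕ)) p j) = 
        a 0 p.1 * ∏ j : Fin n, a j.succ (p.2 j) := by
      intro p; rw [Fin.prod_univ_succ]; simp [Fin.consEquiv]
    constructor
    · rw [← (Fin.consEquiv (fun _ : Fin (n+1) => ℕ)).summable_iff]
      refine s'.congr fun p => ?_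
      simp only [Function.comp, e]
    · rw [← (Fin.consEquiv (fun _ : Fin (n+1) => ℕ)).hasSum_iff, Fin.prod_univ_succ]
      have := (h 0).of_norm.hasSum.mul ih2 s
      refine this.congr_fun' fun p => ?_
      simp only [Function.comp, e]

lemma cauchy_binet (n : ℕ) (f g : Fin n → ℕ → ℝ) (h : ∀ i j, Summable (fun l => ‖f i l * g j l‖)) :
    HasSum (fun l : {l : Fin n → ℕ // StrictAnti l} =>
      (Matrix.of fun i j => f i (l.1 j)).det * (Matrix.of fun i j => g i (l.1 j)).det)
      (Matrix.of fun i j => ∑' l, f i l * g j l).det := by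
  have key : HasSum (fun u : Fin n → ℕ => (Matrix.of fun i j => f i (u j)).det * ∏ j, g j (u j))
      (Matrix.of fun i j => ∑' l, f i l * g j l).det := by
    simp only [Matrix.det_apply', Finset.sum_mul]
    refine hasSum_sum fun σ _ => ?_
    have := (hasSum_pi_prod n (fun j l => f (σ j) l * g j l) (fun j => h _ _)).2.mul_left
      (((Equiv.Perm.sign σ : ℤ) : ℝ))
    have e : (fun u : Fin n → ℕ => ((Equiv.Perm.sign σ : ℤ) : ℝ) * (∏ i, (Matrix.of fun i j => f i (u j)) (σ i) i) *
        ∏ j, g j (u j)) = fun i => ((Equiv.Perm.sign σ : ℤ) : ℝ) * ∏ j, f (σ j) (i j) * g j (i j) := by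
      funext u
      rw [mul_assoc, Finset.prod_mul_distrib]
      rfl
    rw [e]
    exact this
  have inj : Function.Injective (fun p : {l : Fin n → ℕ // StrictAnti l} × Equiv.Perm (Fin n) =>
      p.1.1 ∘ p.2) := by
    rintro ⟨⟨l, hl⟩, σ⟩ ⟨⟨l', hl'⟩, σ'⟩ he
    have he : l ∘ σ = l' ∘ σ' := he
    have hr : range l = range l' := by
      rw [← σ.surjective.range_comp l, he, σ'.surjective.range_comp l']
    have : l = l' := (StrictAnti.range_inj hl hl').1 hr
    subst this
    have : σ = σ' := by
      ext i; exact congrArg Fin.val (hl.injective (congrFun he i))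
    subst this; rfl
  have key2 := (inj.hasSum_iff (f := fun u : Fin n → ℕ =>
      (Matrix.of fun i j => f i (u j)).det * ∏ j, g j (u j)) (a := 
      (Matrix.of fun i j => ∑' l, f i l * g j l).det) (by
    intro u hu
    have : ¬ Function.Injective u := by
      intro hui
      apply hu
      let u' : Fin n → ℕᵒᵈ := fun i => OrderDual.toDual (u i)
      let τ := Tuple.sort u'
      have hm : Monotone (u' ∘ τ) := Tuple.monotone_sort u'
      have hs : StrictAnti (u ∘ τ) := by
        have : Antitone (u ∘ τ) := fun i j hij => hm hij
        exact this.strictAnti_of_injective (hui.comp τ.injective)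
      exact ⟨⟨⟨u ∘ τ, hs⟩, τ⁻¹⟩, by funext i; simp⟩
    simp only [Function.Injective, not_forall] at this
    obtain ⟨i, j, hij, hne⟩ := this
    rw [Matrix.det_zero_of_column_eq hne (by intro k; simp [hij]), zero_mul])).2 key
  refine HasSum.prod_fiberwise key2 fun l => ?_
  have this := hasSum_fintype (fun σ : Equiv.Perm (Fin n) => (Matrix.of fun i j => f i ((l.1 ∘ σ) j)).det *
    ∏ j, g j ((l.1 ∘ σ) j))
  have e : (Matrix.of fun i j => f i (l.1 j)).det * (Matrix.of fun i j => g i (l.1 j)).det =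
      ∑ σ : Equiv.Perm (Fin n), (Matrix.of fun i j => f i ((l.1 ∘ σ) j)).det *
        ∏ j, g j ((l.1 ∘ σ) j) := ?_
  · rw [e]; exact this
  rw [← Matrix.det_transpose (Matrix.of fun i j => g i (l.1 j)),
    Matrix.det_apply' (Matrix.transpose _), Finset.mul_sum]
  refine Finset.sum_congr rfl fun σ _ => ?_
  have := Matrix.det_permute' σ (Matrix.of fun i j => f i (l.1 j))
  rw [show (Matrix.of fun i j => f i ((l.1 ∘ σ) j)) = 
    (Matrix.of fun i j => f i (l.1 j)).submatrix id σ from rfl, this]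
  simp
  ring

lemma altD_pos (n : ℕ) (c Q : ℝ) (hc : 0 < c) (hQ0 : 0 < Q) (hQ1 : Q < 1) (l : Fin n → ℕ)
    (hl : StrictAnti l) : 0 < altD n (fun i => c * Q ^ i) l := by
  have e : (Matrix.of fun i j : Fin n => (c * Q ^ (i : ℕ)) ^ l j) =
      Matrix.of fun i j => c ^ l j * (Matrix.vandermonde (fun j => Q ^ l j)).transpose i j := by
    ext i j
    simp only [Matrix.of_apply, Matrix.transpose_apply, Matrix.vandermonde_apply, mul_pow,
      ← pow_mul, mul_comm]
  rw [altD, e, Matrix.det_mul_row, Matrix.det_transpose, Matrix.det_vandermonde]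
  refine mul_pos (Finset.prod_pos fun i _ => pow_pos hc _) (Finset.prod_pos fun i _ =>
    Finset.prod_pos fun j hj => sub_pos.2 ?_)
  exact pow_lt_pow_right_of_lt_one₀ hQ0 hQ1 (hl (Finset.mem_Ioi.1 hj))

lemma altD_diff (n : ℕ) (x : ℕ → ℝ) (hx0 : x 0 = 1) (l : Fin (n+1) → ℕ) :
    altD (n+1) x l = (Matrix.of fun i j : Fin n => x (i+1) ^ l j.succ - x (i+1) ^ l j.castSucc).det := by
  have := Matrix.det_eq_of_forall_col_eq_smul_add_pred
    (A := Matrix.of fun i j : Fin (n+1) => x i ^ l j)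
    (B := Matrix.of fun i j : Fin (n+1) => Fin.cases (x i ^ l 0)
      (fun j : Fin n => x i ^ l j.succ - x i ^ l j.castSucc) j) (fun _ => 1)
    (by intro i; simp) (by intro i j; simp)
  rw [altD, this, Matrix.det_succ_row_zero, Fin.sum_univ_succ]
  simp only [Matrix.of_apply, Fin.val_zero, hx0, one_pow, Fin.cases_succ, sub_self, mul_zero,
    zero_mul, Finset.sum_const_zero, add_zero, pow_zero, Fin.cases_zero, one_mul]
  congr 1

lemma det_sum_piFinset (n : ℕ) (f : Fin n → ℕ → ℝ) (s : Fin n → Finset ℕ) :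
    ∑ u ∈ Fintype.piFinset s, (Matrix.of fun i j => f i (u j)).det =
      (Matrix.of fun i j => ∑ m ∈ s j, f i m).det := by
  have := (Matrix.detRowAlternating (R := ℝ) (n := Fin n)).toMultilinearMap.map_sum_finset
    (fun j m => fun i => f i m) s
  rw [← Matrix.det_transpose]
  have e : (Matrix.of fun i j => ∑ m ∈ s j, f i m).transpose = 
    (fun i => ∑ j ∈ s i, (fun j m => fun i => f i m : Fin n → ℕ → Fin n → ℝ) i j) := by
    ext i j; simp
  rw [e]
  refine Eq.trans ?_ this.symm
  refine Finset.sum_congr rfl fun u _ => ?_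
  rw [← Matrix.det_transpose]
  rfl

lemma altD_branch (n : ℕ) (Q : ℝ) (hQ0 : 0 < Q) (hQ1 : Q < 1) (l : Fin (n+1) → ℕ)
    (hl : StrictAnti l) :
    ∑ u ∈ Fintype.piFinset (fun j : Fin n => Finset.Ico (l j.succ) (l j.castSucc)),
      Q ^ (∑ j, u j) * altD n (fun i => Q ^ i) u =
    (∏ i : Fin n, (1 - Q ^ ((i : ℕ) + 1))⁻¹) * altD (n+1) (fun i => Q ^ i) l := by
  rw [altD_diff _ _ (by simp), ← Matrix.det_mul_column]
  have e : ∀ u : Fin n → ℕ, Q ^ (∑ j, u j) * altD n (fun i => Q ^ i) u =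
      (Matrix.of fun i j : Fin n => (Q ^ ((i : ℕ)+1)) ^ u j).det := by
    intro u
    rw [altD, ← Finset.prod_pow_eq_pow_sum, ← Matrix.det_mul_row]
    congr 1; ext i j
    simp only [Matrix.of_apply]; ring
  simp only [e]
  rw [det_sum_piFinset n (fun i m => (Q ^ ((i : ℕ)+1)) ^ m)]
  congr 1; ext i j
  simp only [Matrix.of_apply]
  have h1 : Q ^ ((i : ℕ)+1) < 1 := pow_lt_one₀ hQ0.le hQ1 (by omega)
  rw [geom_sum_Ico' h1.ne (hl.antitone (by simp [Fin.le_def]))]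
  rw [div_eq_inv_mul]

def IsPar (n : ℕ) (lam : ℕ → ℕ) : Prop :=
  (∀ j, lam (j + 1) ≤ lam j) ∧ ∀ j, n ≤ j → lam j = 0

def sh (n : ℕ) (lam : ℕ → ℕ) : Fin n → ℕ := fun j => lam j + (n - 1 - j)

lemma sh_anti (n : ℕ) (lam : ℕ → ℕ) (h : ∀ j, lam (j+1) ≤ lam j) : StrictAnti (sh n lam) := by
  intro i j hij
  have := antitone_nat_of_succ_le h (show (i : ℕ) ≤ j from hij.le)
  have : (i : ℕ) < j := hij
  simp only [sh]
  have := j.2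
  omega

abbrev Tri (n : ℕ) (lam : ℕ → ℕ) : Type :=
  {g : ℕ → ℕ → ℕ // g 0 = lam ∧ (∀ k j, g (k+1) j ≤ g k j) ∧ (∀ k j, g k (j+1) ≤ g (k+1) j) ∧
    ∀ k j, n ≤ k + j → g k j = 0}

def triVol (n : ℕ) (g : ℕ → ℕ → ℕ) : ℕ := ∑ k ∈ Finset.range n, ∑ j ∈ Finset.range n, g (k+1) j

def triSum (Q : ℝ) (n : ℕ) (lam : ℕ → ℕ) : ENNReal :=
  ∑' g : Tri n lam, ENNReal.ofReal (Q ^ triVol n g.1)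

def Ilc (n : ℕ) (lam : ℕ → ℕ) : Type :=
  {μ : ℕ → ℕ // (∀ j, lam (j+1) ≤ μ j ∧ μ j ≤ lam j) ∧ ∀ j, n ≤ j → μ j = 0}

lemma Ilc.isPar {n : ℕ} {lam : ℕ → ℕ} (μ : Ilc n lam) : IsPar n μ.1 :=
  ⟨fun j => (μ.2.1 (j+1)).2.trans (μ.2.1 j).1, μ.2.2⟩

def triEquiv (n : ℕ) (lam : ℕ → ℕ) (hl : IsPar (n+1) lam) :
    Tri (n+1) lam ≃ Σ μ : Ilc n lam, Tri n μ.1 where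
  toFun g := ⟨⟨g.1 1, fun j => by
      have h1 := g.2.2.1 0 j
      have h2 := g.2.2.2.1 0 j
      rw [g.2.1] at h1 h2
      exact ⟨h2, h1⟩, fun j hj => g.2.2.2.2 1 j (by omega)⟩,
    ⟨fun k => g.1 (k+1), rfl, fun k j => g.2.2.1 _ _, fun k j => g.2.2.2.1 _ _, 
      fun k j h => g.2.2.2.2 _ _ (by omega)⟩⟩
  invFun p := ⟨fun k => Nat.casesOn k lam (fun k => p.2.1 k), rfl, by
      rintro (_ | k) j
      · change p.2.1 0 j ≤ lam j
        rw [p.2.2.1]; exact (p.1.2.1 j).2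
      · exact p.2.2.2.1 k j, by
      rintro (_ | k) j
      · change lam (j+1) ≤ p.2.1 0 j
        rw [p.2.2.1]; exact (p.1.2.1 j).1
      · exact p.2.2.2.2.1 k j, by
      rintro (_ | k) j h
      · exact hl.2 j (by omega)
      · exact p.2.2.2.2.2 k j (by omega)⟩
  left_inv g := by
    apply Subtype.ext
    funext k
    cases k with
    | zero => exact g.2.1.symm
    | succ k => rfl
  right_inv := by
    rintro ⟨⟨μ, hμ⟩, ⟨g, h0, hg⟩⟩
    dsimp only at h0
    subst h0
    rfl

lemma triSum_succ (Q : ℝ) (hQ : 0 ≤ Q) (n : ℕ) (lam : ℕ → ℕ) (hl : IsPar (n+1) lam) :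
    triSum Q (n+1) lam = ∑' μ : Ilc n lam,
      ENNReal.ofReal (Q ^ (∑ j ∈ Finset.range n, μ.1 j)) * triSum Q n μ.1 := by
  simp only [triSum, ← ENNReal.tsum_mul_left]
  rw [← ENNReal.tsum_sigma (f := fun (μ : Ilc n lam) (g : Tri n μ.1) => 
    ENNReal.ofReal (Q ^ (∑ j ∈ Finset.range n, μ.1 j)) * ENNReal.ofReal (Q ^ triVol n g.1)),
    ← (triEquiv n lam hl).tsum_eq]
  refine tsum_congr fun g => ?_
  rw [← ENNReal.ofReal_mul (by positivity), ← pow_add]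
  congr 2
  simp only [triEquiv, triVol]
  rw [Finset.sum_range_succ', add_comm]
  congr 1
  · rw [Finset.sum_range_succ, g.2.2.2.2 _ n (by omega), add_zero]; rfl
  · refine Finset.sum_congr rfl fun k _ => ?_
    rw [Finset.sum_range_succ, g.2.2.2.2 _ n (by omega), add_zero]; rfl

lemma triSum_zero (Q : ℝ) (n : ℕ) : triSum Q n (fun _ => 0) = 1 := by
  let z : Tri n (fun _ => 0) := ⟨fun _ _ => 0, rfl, by simp, by simp, by simp⟩
  have hz : ∀ g : Tri n (fun _ => 0), g = z := by
    intro g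
    apply Subtype.ext
    funext k j
    change g.1 k j = 0
    induction k with
    | zero => rw [g.2.1]
    | succ k ih => have := g.2.2.1 k j; omega
  rw [triSum, tsum_eq_single z (fun g hg => absurd (hz g) hg)]
  simp [z, triVol]

def ilcEquiv (n : ℕ) (lam : ℕ → ℕ) (hl : IsPar (n+1) lam) :
    Ilc n lam ≃ {u // u ∈ Fintype.piFinset (fun j : Fin n =>
      Finset.Ico (sh (n+1) lam j.succ) (sh (n+1) lam j.castSucc))} where
  toFun μ := ⟨sh n μ.1, by
    rw [Fintype.mem_piFinset]
    intro j
    have := μ.2.1 j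
    have := j.2
    simp only [sh, Finset.mem_Ico, Fin.val_succ, Fin.val_castSucc]
    omega⟩
  invFun u := ⟨fun j => if h : j < n then u.1 ⟨j, h⟩ - (n - 1 - j) else 0, by
    constructor
    · intro j
      by_cases h : j < n
      · have := (Fintype.mem_piFinset.1 u.2) ⟨j, h⟩
        simp only [sh, Finset.mem_Ico, Fin.val_succ, Fin.val_castSucc] at this
        simp only [h, dif_pos]
        omega
      · simp only [h, dif_neg, not_false_eq_true, Nat.zero_le, and_true]
        have := hl.2 (j+1) (by omega)
        omega
    · intro j hj
      exact dif_neg (by omega)⟩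
  left_inv μ := by
    apply Subtype.ext
    funext j
    by_cases h : j < n
    · simp [h, sh]
    · simp only [h, dif_neg, not_false_eq_true]
      exact (μ.2.2 j (by omega)).symm
  right_inv u := by
    apply Subtype.ext
    funext j
    have := (Fintype.mem_piFinset.1 u.2) j
    simp only [sh, Finset.mem_Ico, Fin.val_succ, Fin.val_castSucc] at this
    simp only [sh, j.2, dif_pos, Fin.eta]
    omega

lemma triSum_exists (Q : ℝ) (hQ0 : 0 < Q) (hQ1 : Q < 1) (n : ℕ) :
    ∃ c : ℝ, 0 < c ∧ ∀ lam, IsPar n lam →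
      triSum Q n lam = ENNReal.ofReal (c * altD n (fun i => Q ^ i) (sh n lam)) := by
  have hpos : ∀ n lam, IsPar n lam → 0 < altD n (fun i => Q ^ i) (sh n lam) := by
    intro n lam h
    simpa using altD_pos n 1 Q one_pos hQ0 hQ1 (sh n lam) (sh_anti n lam h.1)
  induction n with
  | zero =>
    refine ⟨1, one_pos, fun lam h => ?_⟩
    have : lam = fun _ => 0 := funext fun j => h.2 j (Nat.zero_le _)
    rw [this, triSum_zero]
    simp [altD]
  | succ n ih =>
    obtain ⟨c, hc, ih⟩ := ih
    have h1 : ∀ i : ℕ, 0 < (1 - Q ^ (i + 1))⁻¹ := fun i =>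
      inv_pos.2 (sub_pos.2 (pow_lt_one₀ hQ0.le hQ1 (by omega)))
    set T : ℕ := ∑ j : Fin n, (n - 1 - (j : ℕ)) with hT
    refine ⟨c * (Q ^ T)⁻¹ * ∏ i : Fin n, (1 - Q ^ ((i : ℕ) + 1))⁻¹,
      mul_pos (mul_pos hc (by positivity)) (Finset.prod_pos fun i _ => h1 i), fun lam hl => ?_⟩
    rw [triSum_succ Q hQ0.le n lam hl, mul_assoc, ← altD_branch n Q hQ0 hQ1 _ (sh_anti _ _ hl.1)]
    have hX : ∀ μ : Ilc n lam, ENNReal.ofReal (Q ^ (∑ j ∈ Finset.range n, μ.1 j)) * triSum Q n μ.1 =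
        ENNReal.ofReal (c * (Q ^ T)⁻¹ * (Q ^ (∑ j, (ilcEquiv n lam hl μ).1 j) *
          altD n (fun i => Q ^ i) (ilcEquiv n lam hl μ).1)) := by
      intro μ
      rw [ih _ μ.isPar, ← ENNReal.ofReal_mul (by positivity)]
      congr 1
      have e : ∑ j, (ilcEquiv n lam hl μ).1 j = ∑ j ∈ Finset.range n, μ.1 j + T := by
        rw [← Fin.sum_univ_eq_sum_range, hT, ← Finset.sum_add_distrib]
        rfl
      rw [e, pow_add]
      change _ = c * (Q ^ T)⁻¹ * (_ * altD n (fun i => Q ^ i) (sh n μ.1))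
      have : Q ^ T ≠ 0 := by positivity
      field_simp
    simp only [hX]
    rw [Finset.mul_sum, ENNReal.ofReal_sum_of_nonneg]
    · rw [← Finset.tsum_subtype, ← (ilcEquiv n lam hl).tsum_eq]
    · intro u hu
      obtain ⟨μ, hμ⟩ := (ilcEquiv n lam hl).surjective ⟨u, hu⟩
      have hμ' : u = sh n μ.1 := (congrArg Subtype.val hμ).symm
      have := hpos n μ.1 μ.isPar
      rw [hμ']
      positivity

lemma sh_zero (n : ℕ) : sh n (fun _ => 0) = fun j : Fin n => n - 1 - (j : ℕ) := by
  funext j; simp [sh]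

lemma triSum_eq (Q : ℝ) (hQ0 : 0 < Q) (hQ1 : Q < 1) (n : ℕ) (lam : ℕ → ℕ) (hl : IsPar n lam) :
    triSum Q n lam = ENNReal.ofReal (altD n (fun i => Q ^ i) (sh n lam) / vdm n (fun i => Q ^ i)) := by
  obtain ⟨c, hc, h⟩ := triSum_exists Q hQ0 hQ1 n
  have h0 := h (fun _ => 0) ⟨by simp, by simp⟩
  rw [triSum_zero, sh_zero, altD_zero, eq_comm, ENNReal.ofReal_eq_one] at h0
  rw [h lam hl]
  congr 1
  have : vdm n (fun i => Q ^ i) ≠ 0 := by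
    intro h; simp [h] at h0
  field_simp
  linear_combination altD n (fun i => Q ^ i) (sh n lam) * h0

def InBox (M : ℕ) (P : PlanePartition ⊤ ⊤) : Prop := ∀ i j, (M ≤ i ∨ M ≤ j) → P.part i j = 0

lemma pp_ext {M N : ℕ∞} {P P' : PlanePartition M N} (h : ∀ i j, P.part i j = P'.part i j) : P = P' := by
  cases P; cases P'
  congr
  funext i j
  exact h i j

def glue (_M : ℕ) (gl gr : ℕ → ℕ → ℕ) (i j : ℕ) : ℕ := if j ≤ i then gl (i - j) j else gr (j - i) i

def boxInv (M : ℕ) (lam : ℕ → ℕ) (gl gr : Tri M lam) : {P : PlanePartition ⊤ ⊤ // InBox M P} := by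
  have hbox : ∀ i j, (M ≤ i ∨ M ≤ j) → glue M gl.1 gr.1 i j = 0 := by
    intro i j h
    simp only [glue]
    split_ifs with h1
    · exact gl.2.2.2.2 _ _ (by omega)
    · exact gr.2.2.2.2 _ _ (by omega)
  refine ⟨⟨glue M gl.1 gr.1, ?_, ?_, by simp, by simp, ?_⟩, hbox⟩
  · intro i j
    simp only [glue]
    rcases lt_trichotomy j (i+1) with h | h | h
    · rw [if_pos (by omega), if_pos (by omega), show i + 1 - j = (i - j) + 1 by omega]
      exact gl.2.2.1 _ _
    · subst h
      rw [if_pos le_rfl, if_neg (by omega), Nat.sub_self, show i + 1 - i = 0 + 1 by omega]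
      have h0 : gl.1 0 = gr.1 0 := gl.2.1.trans gr.2.1.symm
      rw [h0]
      exact gr.2.2.2.1 0 i
    · rw [if_neg (by omega), if_neg (by omega), show j - i = (j - (i+1)) + 1 by omega]
      exact gr.2.2.2.1 _ _
  · intro i j
    simp only [glue]
    rcases lt_trichotomy i j with h | h | h
    · rw [if_neg (by omega), if_neg (by omega), show j + 1 - i = (j - i) + 1 by omega]
      exact gr.2.2.1 _ _
    · subst h
      rw [if_pos le_rfl, if_neg (by omega), Nat.sub_self, show i + 1 - i = 0 + 1 by omega]
      have h0 : gl.1 0 = gr.1 0 := gl.2.1.trans gr.2.1.symm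
      rw [h0]
      exact gr.2.2.1 0 i
    · rw [if_pos (by omega), if_pos (by omega), show i - j = (i - (j+1)) + 1 by omega]
      exact gl.2.2.2.1 _ _
  · refine ((Set.finite_Iio M).prod (Set.finite_Iio M)).subset ?_
    rintro ⟨i, j⟩ h
    simp only [Set.mem_ofPred_eq] at h
    simp only [mem_prod, mem_Iio]
    by_contra h'
    exact h (hbox i j (by omega))

def boxEquiv (M : ℕ) : {P : PlanePartition ⊤ ⊤ // InBox M P} ≃
    Σ lam : {lam // IsPar M lam}, Tri M lam.1 × Tri M lam.1 where
  toFun P := ⟨⟨fun j => P.1.part j j, fun j => (P.1.antitone_fst j (j+1)).trans (P.1.antitone_snd _ _),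
      fun j hj => P.2 j j (Or.inl hj)⟩,
    ⟨fun k j => P.1.part (j + k) j, rfl, fun k j => P.1.antitone_fst _ _, fun k j => by
      change P.1.part (j + 1 + k) (j + 1) ≤ P.1.part (j + (k + 1)) j
      rw [show j + 1 + k = j + (k + 1) by omega]; exact P.1.antitone_snd _ _,
      fun k j h => P.2 _ _ (by omega)⟩,
    ⟨fun k j => P.1.part j (j + k), rfl, fun k j => P.1.antitone_snd _ _, fun k j => by
      change P.1.part (j + 1) (j + 1 + k) ≤ P.1.part j (j + (k + 1))
      rw [show j + 1 + k = j + (k + 1) by omega]; exact P.1.antitone_fst _ _,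
      fun k j h => P.2 _ _ (by omega)⟩⟩
  invFun p := boxInv M p.1.1 p.2.1 p.2.2
  left_inv P := by
    apply Subtype.ext
    apply pp_ext
    intro i j
    change glue M _ _ i j = _
    simp only [glue]
    split_ifs with h
    · rw [show j + (i - j) = i by omega]
    · rw [show i + (j - i) = j by omega]
  right_inv := by
    rintro ⟨⟨lam, hl⟩, ⟨gl, hgl⟩, ⟨gr, hgr⟩⟩
    have e0 : ∀ j, glue M gl gr j j = lam j := by
      intro j; simp [glue, hgl.1]
    have e1 : ∀ k j, glue M gl gr (j + k) j = gl k j := by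
      intro k j; simp [glue]
    have e2 : ∀ k j, glue M gl gr j (j + k) = gr k j := by
      intro k j
      cases k with
      | zero => rw [hgr.1]; exact e0 j
      | succ k => 
        simp only [glue]
        rw [if_neg (by omega)]
        congr 1; omega
    have h0 : (fun j => glue M gl gr j j) = lam := funext e0
    subst h0
    have h1 : (fun k j => glue M gl gr (j + k) j) = gl := funext₂ e1
    have h2 : (fun k j => glue M gl gr j (j + k)) = gr := funext₂ e2
    refine Sigma.ext rfl (heq_of_eq (Prod.ext (Subtype.ext h1) (Subtype.ext h2)))

lemma leftVol_box (M : ℕ) (P : PlanePartition ⊤ ⊤) (h : InBox M P) :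
    P.leftVol = triVol M (fun k j => P.part (j + k) j) := by
  rw [PlanePartition.leftVol, finsum_eq_sum_of_support_subset (s := 
    (Finset.range M ×ˢ Finset.range M).map ⟨fun p : ℕ × ℕ => (p.2 + (p.1 + 1), p.2), by
      rintro ⟨a, b⟩ ⟨c, d⟩ h; simp at h; ext <;> simp <;> omega⟩),
    Finset.sum_map, Finset.sum_product, triVol]
  · refine Finset.sum_congr rfl fun k _ => Finset.sum_congr rfl fun j _ => ?_
    exact if_pos (show j < j + (k + 1) by omega)
  · rintro ⟨i, j⟩ hp
    simp only [Function.mem_support, ne_eq, ite_eq_right_iff, Classical.not_imp] at hp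
    have : i < M ∧ j < M := by
      by_contra h'; exact hp.2 (h i j (by omega))
    simp only [Finset.coe_map, Function.Embedding.coeFn_mk, mem_image, Finset.mem_coe,
      Finset.mem_product, Finset.mem_range, Prod.exists, Prod.mk.injEq]
    refine ⟨i - j - 1, j, by omega, ?_⟩
    have : j + (i - j - 1 + 1) = i := by have := hp.1; omega
    exact Prod.ext this rfl

lemma rightVol_box (M : ℕ) (P : PlanePartition ⊤ ⊤) (h : InBox M P) :
    P.rightVol = triVol M (fun k j => P.part j (j + k)) := by
  rw [PlanePartition.rightVol, finsum_eq_sum_of_support_subset (s := 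
    (Finset.range M ×ˢ Finset.range M).map ⟨fun p : ℕ × ℕ => (p.2, p.2 + (p.1 + 1)), by
      rintro ⟨a, b⟩ ⟨c, d⟩ h; simp at h; ext <;> simp <;> omega⟩),
    Finset.sum_map, Finset.sum_product, triVol]
  · refine Finset.sum_congr rfl fun k _ => Finset.sum_congr rfl fun j _ => ?_
    exact if_pos (show j < j + (k + 1) by omega)
  · rintro ⟨i, j⟩ hp
    simp only [Function.mem_support, ne_eq, ite_eq_right_iff, Classical.not_imp] at hp
    have : i < M ∧ j < M := by
      by_contra h'; exact hp.2 (h i j (by omega))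
    simp only [Finset.coe_map, Function.Embedding.coeFn_mk, mem_image, Finset.mem_coe,
      Finset.mem_product, Finset.mem_range, Prod.exists, Prod.mk.injEq]
    refine ⟨j - i - 1, i, by omega, ?_⟩
    have : i + (j - i - 1 + 1) = j := by have := hp.1; omega
    exact Prod.ext rfl this

lemma centralVol_box (M : ℕ) (P : PlanePartition ⊤ ⊤) (h : InBox M P) :
    P.centralVol = ∑ j ∈ Finset.range M, P.part j j := by
  rw [PlanePartition.centralVol, finsum_eq_sum_of_support_subset (s := Finset.range M)]
  intro i hi
  simp only [Function.mem_support] at hi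
  simp only [Finset.coe_range, mem_Iio]
  by_contra h'
  exact hi (h i i (by omega))

lemma altD_scale (n : ℕ) (c : ℝ) (x : ℕ → ℝ) (l : Fin n → ℕ) :
    altD n (fun i => c * x i) l = c ^ (∑ j, l j) * altD n x l := by
  rw [altD, altD, ← Finset.prod_pow_eq_pow_sum, ← Matrix.det_mul_row]
  congr 1; ext i j
  simp only [Matrix.of_apply, mul_pow]

lemma schur_scale (n : ℕ) (c : ℝ) (hc : c ≠ 0) (x : ℕ → ℝ) (lam : ℕ → ℕ) :
    altD n (fun i => c * x i) (sh n lam) / vdm n (fun i => c * x i) =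
     c ^ (∑ j ∈ Finset.range n, lam j) * (altD n x (sh n lam) / vdm n x) := by
  rw [← altD_zero, ← altD_zero, altD_scale, altD_scale]
  have : ∑ j, sh n lam j = ∑ j ∈ Finset.range n, lam j + ∑ j : Fin n, (n - 1 - (j : ℕ)) := by
    rw [← Fin.sum_univ_eq_sum_range, ← Finset.sum_add_distrib]; rfl
  rw [this, pow_add, mul_right_comm, mul_comm (c ^ _ * _), mul_div_mul_left _ _ (pow_ne_zero _ hc)]
  ring

def parEquiv (M : ℕ) : {lam // IsPar M lam} ≃ {l : Fin M → ℕ // StrictAnti l} :=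
  Equiv.ofBijective (fun lam => ⟨sh M lam.1, sh_anti M lam.1 lam.2.1⟩) (by
    constructor
    · rintro ⟨a, ha⟩ ⟨b, hb⟩ h
      apply Subtype.ext
      funext j
      by_cases hj : j < M
      · have := congrFun (congrArg Subtype.val h) ⟨j, hj⟩
        simpa [sh] using this
      · change a j = b j
        rw [ha.2 j (by omega), hb.2 j (by omega)]
    · rintro ⟨l, hl⟩
      have key : ∀ d : ℕ, ∀ j (hj : j < M), M - 1 - j = d → d ≤ l ⟨j, hj⟩ := by
        intro d
        induction d with
        | zero => intros; omega
        | succ d ih =>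
          intro j hj h
          have := ih (j+1) (by omega) (by omega)
          have h2 := hl (show (⟨j, hj⟩ : Fin M) < ⟨j+1, by omega⟩ by simp [Fin.lt_def])
          omega
      refine ⟨⟨fun j => if h : j < M then l ⟨j, h⟩ - (M - 1 - j) else 0, ?_, ?_⟩, ?_⟩
      · intro j
        by_cases h : j + 1 < M
        · have h2 := hl (show (⟨j, by omega⟩ : Fin M) < ⟨j+1, h⟩ by simp [Fin.lt_def])
          simp only [h, dif_pos, show j < M by omega]
          omega
        · simp [h]
      · intro j hj
        exact dif_neg (by omega)
      · apply Subtype.ext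
        funext j
        have := key _ j j.2 rfl
        simp only [sh, j.2, dif_pos, Fin.eta] at this ⊢
        omega)

/-- The sum over boxed plane partitions as a sum over strictly decreasing tuples. -/
lemma box_sum (q a η θ cx cy : ℝ) (hcx : 0 < cx) (hcy : 0 < cy)
    (hc : a * Real.sqrt (q ^ η * q ^ θ) = cx * cy)
    (hQ0 : 0 < q ^ η) (hQ1 : q ^ η < 1) (hR0 : 0 < q ^ θ) (hR1 : q ^ θ < 1)
    (M : ℕ) (f : (ℕ → ℕ) → ENNReal) (F : (Fin M → ℕ) → ENNReal)
    (hF : ∀ lam, IsPar M lam → f lam = F (sh M lam)) :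
    ∑' P : {P : PlanePartition ⊤ ⊤ // InBox M P},
      ENNReal.ofReal (mbWeight q a η θ P.1) * f (fun j => P.1.part j j) =
    ∑' l : {l : Fin M → ℕ // StrictAnti l}, F l.1 * ENNReal.ofReal 
      (altD M (fun i => cx * (q ^ η) ^ i) l.1 / vdm M (fun i => cx * (q ^ η) ^ i) *
        (altD M (fun i => cy * (q ^ θ) ^ i) l.1 / vdm M (fun i => cy * (q ^ θ) ^ i))) := by
  have e1 : ∀ P : {P : PlanePartition ⊤ ⊤ // InBox M P},
      ENNReal.ofReal (mbWeight q a η θ P.1) * f (fun j => P.1.part j j) =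
      (fun p : Σ lam : {lam // IsPar M lam}, Tri M lam.1 × Tri M lam.1 => 
        f p.1.1 * ENNReal.ofReal ((cx * cy) ^ (∑ j ∈ Finset.range M, p.1.1 j)) *
        (ENNReal.ofReal ((q ^ η) ^ triVol M p.2.1.1) * ENNReal.ofReal ((q ^ θ) ^ triVol M p.2.2.1)))
        (boxEquiv M P) := by
    intro P
    rw [mbWeight, leftVol_box M P.1 P.2, rightVol_box M P.1 P.2, centralVol_box M P.1 P.2, hc,
      ENNReal.ofReal_mul (by positivity), ENNReal.ofReal_mul (by positivity)]
    simp only [boxEquiv, Equiv.coe_fn_mk]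
    ring
  refine (tsum_congr e1).trans ?_
  rw [(boxEquiv M).tsum_eq (fun p : Σ lam : {lam // IsPar M lam}, Tri M lam.1 × Tri M lam.1 => 
        f p.1.1 * ENNReal.ofReal ((cx * cy) ^ (∑ j ∈ Finset.range M, p.1.1 j)) *
        (ENNReal.ofReal ((q ^ η) ^ triVol M p.2.1.1) * ENNReal.ofReal ((q ^ θ) ^ triVol M p.2.2.1))),
    ENNReal.tsum_sigma', ← (parEquiv M).tsum_eq]
  refine tsum_congr fun lam => ?_
  simp only
  rw [ENNReal.tsum_mul_left]
  have e2 : ∑' p : Tri M lam.1 × Tri M lam.1, ENNReal.ofReal ((q ^ η) ^ triVol M p.1.1) *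
      ENNReal.ofReal ((q ^ θ) ^ triVol M p.2.1) = triSum (q ^ η) M lam.1 * triSum (q ^ θ) M lam.1 := by
    rw [ENNReal.tsum_prod']
    simp only [ENNReal.tsum_mul_left, ENNReal.tsum_mul_right, triSum]
  have p1 := altD_pos M 1 _ one_pos hQ0 hQ1 _ (sh_anti M lam.1 lam.2.1)
  have p2 := altD_pos M 1 _ one_pos hR0 hR1 _ (sh_anti M lam.1 lam.2.1)
  have p3 := altD_pos M 1 _ one_pos hQ0 hQ1 _ (sh_anti M (fun _ => 0) (by simp))
  rw [sh_zero, altD_zero] at p3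
  simp only [one_mul] at p1 p2 p3
  rw [e2, triSum_eq _ hQ0 hQ1 _ _ lam.2, triSum_eq _ hR0 hR1 _ _ lam.2, hF _ lam.2]
  change _ = F (sh M lam.1) * ENNReal.ofReal 
      (altD M (fun i => cx * (q ^ η) ^ i) (sh M lam.1) / vdm M (fun i => cx * (q ^ η) ^ i) *
        (altD M (fun i => cy * (q ^ θ) ^ i) (sh M lam.1) / vdm M (fun i => cy * (q ^ θ) ^ i)))
  rw [schur_scale _ _ hcx.ne', schur_scale _ _ hcy.ne', mul_assoc,
    ← ENNReal.ofReal_mul (by positivity), ← ENNReal.ofReal_mul (by positivity), mul_pow]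
  congr 2
  ring

lemma prod_ite_inj {ι : Type*} [Fintype ι] (l : ι → ℕ) (hl : Function.Injective l) (a : ℕ) (c : ℝ)
    [Decidable (∃ j, l j = a)] :
    ∏ j, (if l j = a then c else 1) = if ∃ j, l j = a then c else 1 := by
  classical
  split_ifs with h
  · obtain ⟨j, hj⟩ := h
    rw [Finset.prod_eq_single j]
    · simp [hj]
    · intro i _ hi
      exact if_neg fun h => hi (hl (h.trans hj.symm))
    · simp
  · push Not at h
    exact Finset.prod_eq_one fun j _ => if_neg (h j)

lemma sum_ite_inj {ι : Type*} [Fintype ι] (l : ι → ℕ) (hl : Function.Injective l) (a : ℕ) (t : ℝ)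
    [Decidable (∃ j, l j = a)] :
    1 + t * ∑ j, (if a = l j then 1 else 0) = if ∃ j, l j = a then 1 + t else 1 := by
  classical
  split_ifs with h
  · obtain ⟨j, hj⟩ := h
    rw [Finset.sum_eq_single j]
    · simp [hj]
    · intro i _ hi
      exact if_neg fun h => hi (hl (h.symm.trans hj.symm))
    · simp
  · push Not at h
    rw [Finset.sum_eq_zero fun j _ => if_neg (h j).symm]
    simp

/-- finite kernel -/
def KM (M : ℕ) (x y : ℕ → ℝ) (k l : ℕ) : ℝ :=
  ∑ i : Fin M, ∑ j : Fin M,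
    (cauM (fun i : Fin M => x i) (fun j : Fin M => y j))⁻¹ j i * x i ^ k * y j ^ l

lemma finite_det (M m : ℕ) (x y : ℕ → ℝ) (hx : ∀ i, 0 < x i ∧ x i < 1) (hy : ∀ i, 0 < y i ∧ y i < 1)
    (A : Fin m → ℕ) (t : ℝ)
    (hdet : (cauM (fun i : Fin M => x i) (fun j : Fin M => y j)).det ≠ 0) :
    HasSum (fun l : {l : Fin M → ℕ // StrictAnti l} =>
      altD M x l.1 * ((∏ j, (1 + t * ∑ p, (if l.1 j = A p then (1 : ℝ) else 0))) * altD M y l.1))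
      ((cauM (fun i : Fin M => x i) (fun j : Fin M => y j)).det *
        Matrix.det (1 + t • Matrix.of fun p r => KM M x y (A p) (A r))) := by
  set G := cauM (fun i : Fin M => x i) (fun j : Fin M => y j) with hG
  set h : ℕ → ℝ := fun l => 1 + t * ∑ p, (if l = A p then (1 : ℝ) else 0) with hh
  have hs0 : ∀ i j : ℕ, HasSum (fun l : ℕ => x i ^ l * y j ^ l) (1 - x i * y j)⁻¹ := by
    intro i j
    refine (hasSum_geometric_of_lt_one (r := x i * y j) (mul_pos (hx i).1 (hy j).1).le ?_).congr_fun' ?_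
    · have := hx i; have := hy j; nlinarith
    · intro l; rw [mul_pow]
  have hs : ∀ i j : ℕ, HasSum (fun l : ℕ => x i ^ l * (h l * y j ^ l))
      ((1 - x i * y j)⁻¹ + t * ∑ p, x i ^ A p * y j ^ A p) := by
    intro i j
    have h1 : ∀ p, HasSum (fun l : ℕ => if l = A p then x i ^ A p * y j ^ A p else 0)
        (x i ^ A p * y j ^ A p) := fun p => hasSum_ite_eq _ _
    have h2 := (hs0 i j).add ((hasSum_sum fun p (_ : p ∈ Finset.univ) => h1 p).mul_left t)
    refine h2.congr_fun' ?_
    intro l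
    have : ∀ p, (if l = A p then x i ^ A p * y j ^ A p else 0) =
      (x i ^ l * y j ^ l) * (if l = A p then (1 : ℝ) else 0) := by
      intro p; split_ifs with h
      · rw [h, mul_one]
      · simp
    simp only [hh, this, ← Finset.mul_sum]
    ring
  have cb := cauchy_binet M (fun i l => x i ^ l) (fun j l => h l * y j ^ l) (by
    intro i j
    exact (hs i j).summable.norm)
  have e1 : Matrix.det (Matrix.of fun i j : Fin M => ∑' l, x i ^ l * (h l * y j ^ l)) =
      G.det * Matrix.det (1 + t • Matrix.of fun p r => KM M x y (A p) (A r)) := by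
    have : (Matrix.of fun i j : Fin M => ∑' l, x i ^ l * (h l * y j ^ l)) =
      G + (Matrix.of fun (i : Fin M) p => t * x i ^ A p) * (Matrix.of fun p (j : Fin M) => y j ^ A p) := by
      ext i j
      simp only [Matrix.of_apply, (hs i j).tsum_eq, Matrix.add_apply, Matrix.mul_apply, hG, cauM,
        Finset.mul_sum, mul_assoc]
    rw [this, Matrix.det_add_mul _ _ (isUnit_iff_ne_zero.2 hdet)]
    congr 1
    rw [← Matrix.det_transpose]
    congr 1
    ext p r
    simp only [Matrix.transpose_apply, Matrix.add_apply, Matrix.smul_apply, Matrix.of_apply,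
      Matrix.mul_apply, KM, Finset.sum_mul, Finset.mul_sum, smul_eq_mul, Matrix.one_apply, eq_comm (a := r)]
    congr 1
    refine Finset.sum_congr rfl fun i _ => Finset.sum_congr rfl fun j _ => ?_
    ring
  rw [← e1]
  refine cb.congr_fun' ?_
  intro l
  simp only [altD]
  rw [← Matrix.det_mul_row]
  rfl

/-- multiplicative statistic -/
def ft {m : ℕ} (κ : Fin m → ℤ) (t : ℝ) (lam : ℕ → ℕ) : ℝ :=
  open Classical in ∏ i, if ∃ n : ℕ, (lam n : ℤ) - n - 1 = κ i then 1 + t else 1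

lemma ft_eq {m : ℕ} (κ : Fin m → ℤ) (hκ : Function.Injective κ) (t : ℝ) (M : ℕ) (A : Fin m → ℕ)
    (hA : ∀ i, κ i = (A i : ℤ) - M) (lam : ℕ → ℕ) (hl : IsPar M lam) :
    ft κ t lam = ∏ j, (1 + t * ∑ p, (if sh M lam j = A p then (1 : ℝ) else 0)) := by
  classical
  have hAi : Function.Injective A := by
    intro i j h; apply hκ; rw [hA, hA, h]
  have hsi := (sh_anti M lam hl.1).injective
  have : ∀ j, (1 + t * ∑ p, (if sh M lam j = A p then (1 : ℝ) else 0)) =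
      ∏ p, if sh M lam j = A p then 1 + t else 1 := by
    intro j
    rw [sum_ite_inj A hAi, ← prod_ite_inj A hAi]
    simp only [eq_comm]
  simp only [this]
  rw [Finset.prod_comm, ft]
  refine Finset.prod_congr rfl fun p _ => ?_
  rw [prod_ite_inj _ hsi]
  refine if_congr ?_ rfl rfl
  rw [hA]
  constructor
  · rintro ⟨n, hn⟩
    by_cases h : n < M
    · exact ⟨⟨n, h⟩, by simp only [sh]; omega⟩
    · have := hl.2 n (by omega); omega
  · rintro ⟨j, hj⟩
    have := j.2
    simp only [sh] at hj
    exact ⟨j, by omega⟩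

lemma ft_nonneg {m : ℕ} (κ : Fin m → ℤ) (t : ℝ) (ht : 0 ≤ t) (lam : ℕ → ℕ) : 0 ≤ ft κ t lam := by
  rw [ft]
  refine Finset.prod_nonneg fun i _ => ?_
  split_ifs <;> linarith

def ZM (M : ℕ) (x y : ℕ → ℝ) : ℝ := ∏ i ∈ Finset.range M, ∏ j ∈ Finset.range M, (1 - x i * y j)⁻¹

lemma box_det (q a η θ cx cy : ℝ) (hcx : 0 < cx) (hcy : 0 < cy) (hcx1 : cx < 1) (hcy1 : cy < 1)
    (hc : a * Real.sqrt (q ^ η * q ^ θ) = cx * cy)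
    (hQ0 : 0 < q ^ η) (hQ1 : q ^ η < 1) (hR0 : 0 < q ^ θ) (hR1 : q ^ θ < 1) (ha : 0 < a)
    (M m : ℕ) (κ : Fin m → ℤ) (hκ : Function.Injective κ) (t : ℝ) (ht : 0 ≤ t) (A : Fin m → ℕ)
    (hA : ∀ i, κ i = (A i : ℤ) - M) :
    ∑' P : {P : PlanePartition ⊤ ⊤ // InBox M P},
      ENNReal.ofReal (mbWeight q a η θ P.1 * ft κ t (fun j => P.1.part j j)) =
    ENNReal.ofReal (ZM M (fun i => cx * (q ^ η) ^ i) (fun i => cy * (q ^ θ) ^ i) * 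
      Matrix.det (1 + t • Matrix.of fun p r =>
        KM M (fun i => cx * (q ^ η) ^ i) (fun i => cy * (q ^ θ) ^ i) (A p) (A r))) := by
  set x : ℕ → ℝ := fun i => cx * (q ^ η) ^ i with hxd
  set y : ℕ → ℝ := fun i => cy * (q ^ θ) ^ i with hyd
  have hx : ∀ i, 0 < x i ∧ x i < 1 := fun i => ⟨by positivity, by
    have := pow_le_one₀ hQ0.le hQ1.le (n := i)
    simp only [hxd]; nlinarith⟩
  have hy : ∀ i, 0 < y i ∧ y i < 1 := fun i => ⟨by positivity, by
    have := pow_le_one₀ hR0.le hR1.le (n := i)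
    simp only [hyd]; nlinarith⟩
  have hx1 : ∀ i j, 0 < 1 - x i * y j := by
    intro i j
    have := hx i; have := hy j; nlinarith
  have vx : 0 < vdm M x := by
    have p3 := altD_pos M cx _ hcx hQ0 hQ1 _ (sh_anti M (fun _ => 0) (by simp))
    rwa [sh_zero, altD_zero] at p3
  have vy : 0 < vdm M y := by
    have p3 := altD_pos M cy _ hcy hR0 hR1 _ (sh_anti M (fun _ => 0) (by simp))
    rwa [sh_zero, altD_zero] at p3
  have hcd := cauchy_det M x y (fun i j => (hx1 i j).ne')
  have hZ : 0 < ZM M x y := Finset.prod_pos fun i _ => Finset.prod_pos fun j _ => inv_pos.2 (hx1 i j)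
  have hdet : (cauM (fun i : Fin M => x i) (fun j : Fin M => y j)).det = vdm M x * vdm M y * ZM M x y := hcd
  have hfd := finite_det M m x y hx hy A t (by rw [hdet]; positivity)
  have hsum := (hfd.mul_left (vdm M x * vdm M y)⁻¹)
  have hbs := box_sum q a η θ cx cy hcx hcy hc hQ0 hQ1 hR0 hR1 M (fun lam => ENNReal.ofReal (ft κ t lam))
    (fun l => ENNReal.ofReal (∏ j, (1 + t * ∑ p, (if l j = A p then (1 : ℝ) else 0))))
    (fun lam hl => by rw [ft_eq κ hκ t M A hA lam hl])
  have hh : ∀ l : Fin M → ℕ, 0 ≤ ∏ j, (1 + t * ∑ p, (if l j = A p then (1 : ℝ) else 0)) := by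
    intro l
    refine Finset.prod_nonneg fun j _ => ?_
    have : 0 ≤ ∑ p, (if l j = A p then (1 : ℝ) else 0) := Finset.sum_nonneg fun p _ => by split_ifs <;> simp
    positivity
  have e1 : ∀ P : {P : PlanePartition ⊤ ⊤ // InBox M P},
      ENNReal.ofReal (mbWeight q a η θ P.1 * ft κ t (fun j => P.1.part j j)) =
      ENNReal.ofReal (mbWeight q a η θ P.1) * ENNReal.ofReal (ft κ t (fun j => P.1.part j j)) := by
    intro P
    rw [ENNReal.ofReal_mul (by unfold mbWeight; positivity)]
  rw [tsum_congr e1, hbs]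
  have e2 : ∀ l : {l : Fin M → ℕ // StrictAnti l}, 
      ENNReal.ofReal (∏ j, (1 + t * ∑ p, (if l.1 j = A p then (1 : ℝ) else 0))) * ENNReal.ofReal 
      (altD M x l.1 / vdm M x * (altD M y l.1 / vdm M y)) = 
      ENNReal.ofReal ((vdm M x * vdm M y)⁻¹ * (altD M x l.1 * ((∏ j, (1 + t * ∑ p, (if l.1 j = A p then (1 : ℝ) else 0))) * altD M y l.1))) := by
    intro l
    rw [← ENNReal.ofReal_mul (hh _)]
    congr 1
    field_simp
  rw [tsum_congr e2, ← ENNReal.ofReal_tsum_of_nonneg _ hsum.summable, hsum.tsum_eq, hdet]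
  · congr 1
    field_simp
  · intro l
    have p1 := altD_pos M cx _ hcx hQ0 hQ1 _ l.2
    have p2 := altD_pos M cy _ hcy hR0 hR1 _ l.2
    have := hh l.1
    positivity

lemma zCirc_norm (r φ : ℝ) (hr : 0 < r) : ‖zCirc r φ‖ = r := by
  rw [zCirc, norm_mul, Complex.norm_exp_ofReal_mul_I, mul_one, Complex.norm_real, Real.norm_of_nonneg hr.le]

lemma zCirc_ne (r φ : ℝ) (hr : 0 < r) : zCirc r φ ≠ 0 := by
  rw [← norm_pos_iff, zCirc_norm r φ hr]; exact hr

lemma zCirc_cont (r : ℝ) : Continuous (zCirc r) := by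
  unfold zCirc; fun_prop

lemma zCirc_eq (r φ : ℝ) : zCirc r φ = circleMap 0 r φ := by
  simp [zCirc, circleMap]

lemma int_circle (r : ℝ) (hr : 0 < r) (f : ℂ → ℂ) :
    ∫ φ in Ioc (-Real.pi) Real.pi, f (zCirc r φ) = Complex.I⁻¹ * ∮ z in C(0, r), z⁻¹ * f z := by
  rw [← intervalIntegral.integral_of_le (by linarith [Real.pi_pos]), circleIntegral,
    ← intervalIntegral.integral_const_mul]
  have hp : Function.Periodic (fun φ => f (zCirc r φ)) (2 * Real.pi) := by
    intro φ; simp only [zCirc_eq, periodic_circleMap 0 r φ]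
  have := hp.intervalIntegral_add_eq (-Real.pi) 0
  rw [show -Real.pi + 2 * Real.pi = Real.pi by ring, zero_add] at this
  rw [this]
  refine intervalIntegral.integral_congr fun φ _ => ?_
  have := zCirc_ne r φ hr
  simp only [deriv_circleMap, zCirc_eq, smul_eq_mul] at this ⊢
  field_simp [Complex.I_ne_zero]

lemma int_a (r : ℝ) (hr : 0 < r) (z : ℂ) (hz : r < ‖z‖) (l : ℕ) :
    ∫ φ in Ioc (-Real.pi) Real.pi, zCirc r φ ^ (l + 1) * (z - zCirc r φ)⁻¹ = 0 := by
  rw [int_circle r hr (fun w => w ^ (l + 1) * (z - w)⁻¹)]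
  have : ∮ w in C(0, r), w⁻¹ * (w ^ (l + 1) * (z - w)⁻¹) = ∮ w in C(0, r), (w ^ l * (z - w)⁻¹) := by
    refine circleIntegral.integral_congr hr.le fun w hw => ?_
    have : w ≠ 0 := by rw [mem_sphere_zero_iff_norm] at hw; rw [← norm_pos_iff, hw]; exact hr
    field_simp
    try ring
  rw [this, DiffContOnCl.circleIntegral_eq_zero hr.le, mul_zero]
  apply DifferentiableOn.diffContOnCl
  intro w hw
  have hw := Metric.closure_ball_subset_closedBall hw
  rw [mem_closedBall_zero_iff] at hw
  have : z - w ≠ 0 := by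
    intro h; rw [sub_eq_zero] at h; rw [h] at hz; linarith
  exact DifferentiableAt.differentiableWithinAt (by fun_prop (disch := assumption))

lemma int_b (r : ℝ) (hr : 0 < r) (y : ℂ) (hy : ‖y‖ < r) (l : ℕ) :
    ∫ φ in Ioc (-Real.pi) Real.pi, zCirc r φ ^ (l + 1) * (zCirc r φ - y)⁻¹ = 2 * Real.pi * y ^ l := by
  rw [int_circle r hr (fun w => w ^ (l + 1) * (w - y)⁻¹)]
  have : ∮ w in C(0, r), w⁻¹ * (w ^ (l + 1) * (w - y)⁻¹) = ∮ w in C(0, r), ((w - y)⁻¹ • w ^ l) := by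
    refine circleIntegral.integral_congr hr.le fun w hw => ?_
    have : w ≠ 0 := by rw [mem_sphere_zero_iff_norm] at hw; rw [← norm_pos_iff, hw]; exact hr
    simp only [smul_eq_mul]
    field_simp
    ring
  rw [this, DiffContOnCl.circleIntegral_sub_inv_smul, smul_eq_mul]
  · field_simp [Complex.I_ne_zero]
  · apply DifferentiableOn.diffContOnCl
    fun_prop
  · simpa using hy

lemma int_zpow (r : ℝ) (hr : 0 < r) (k : ℕ) :
    ∫ φ in Ioc (-Real.pi) Real.pi, zCirc r φ ^ (-((k : ℤ) + 1)) = 0 := by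
  rw [int_circle r hr (fun w => w ^ (-((k : ℤ) + 1)))]
  have : ∮ w in C(0, r), w⁻¹ * (w ^ (-((k : ℤ) + 1))) = ∮ w in C(0, r), ((w - 0) ^ (-(k : ℤ) - 2)) := by
    refine circleIntegral.integral_congr hr.le fun w hw => ?_
    have : w ≠ 0 := by rw [mem_sphere_zero_iff_norm] at hw; rw [← norm_pos_iff, hw]; exact hr
    simp only [sub_zero]
    rw [← zpow_neg_one, ← zpow_add₀ this]
    congr 1; ring
  rw [this, circleIntegral.integral_sub_zpow_of_ne (by omega), mul_zero]

lemma int_c (r : ℝ) (hr : 0 < r) (x : ℂ) (hx : ‖x‖ * r < 1) (k : ℕ) :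
    ∫ φ in Ioc (-Real.pi) Real.pi, zCirc r φ ^ (-(k : ℤ)) * (1 - x * zCirc r φ)⁻¹ = 2 * Real.pi * x ^ k := by
  have hne : ∀ w : ℂ, ‖w‖ ≤ r → 1 - x * w ≠ 0 := by
    intro w hw h
    have : x * w = 1 := (sub_eq_zero.1 h).symm
    have h2 : ‖x‖ * ‖w‖ = 1 := by rw [← norm_mul, this, norm_one]
    have := mul_le_mul_of_nonneg_left hw (norm_nonneg x)
    linarith
  induction k with
  | zero =>
    simp only [Nat.cast_zero, neg_zero, zpow_zero, one_mul, pow_zero, mul_one]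
    rw [int_circle r hr (fun w => (1 - x * w)⁻¹)]
    have := DiffContOnCl.circleIntegral_sub_inv_smul (R := r) (c := 0) (w := 0) (f := fun w => (1 - x * w)⁻¹) (by
      apply DifferentiableOn.diffContOnCl
      intro w hw
      have hw := Metric.closure_ball_subset_closedBall hw
      rw [mem_closedBall_zero_iff] at hw
      have := hne w hw
      exact DifferentiableAt.differentiableWithinAt (by fun_prop (disch := assumption))) (by simpa using hr)
    simp only [sub_zero, smul_eq_mul, mul_zero, inv_one, mul_one] at this
    rw [this]
    field_simp [Complex.I_ne_zero]
  | succ k ih =>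
    have e : ∀ φ, zCirc r φ ^ (-((k + 1 : ℕ) : ℤ)) * (1 - x * zCirc r φ)⁻¹ =
        zCirc r φ ^ (-((k : ℤ) + 1)) + x * (zCirc r φ ^ (-(k : ℤ)) * (1 - x * zCirc r φ)⁻¹) := by
      intro φ
      have h1 := zCirc_ne r φ hr
      have h2 := hne _ (zCirc_norm r φ hr).le
      have h3 : zCirc r φ ^ (-(k : ℤ)) = zCirc r φ ^ (-((k : ℤ) + 1)) * zCirc r φ := by
        rw [← zpow_add_one₀ h1]; congr 1; ring
      rw [h3]
      push_cast
      field_simp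
      ring
    simp only [e]
    have hc := zCirc_cont r
    have n1 := fun φ => zCirc_ne r φ hr
    have n2 := fun φ => hne _ (zCirc_norm r φ hr).le
    have c1 : ∀ n : ℤ, Continuous fun φ => zCirc r φ ^ n := fun n => hc.zpow₀ n (fun φ => Or.inl (n1 φ))
    have c2 : Continuous fun φ => (1 - x * zCirc r φ)⁻¹ := (by fun_prop : Continuous fun φ => (1 - x * zCirc r φ)).inv₀ n2
    have c3 : Continuous fun φ => x * (zCirc r φ ^ (-(k : ℤ)) * (1 - x * zCirc r φ)⁻¹) :=
      continuous_const.mul ((c1 _).mul c2)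
    rw [integral_add (c1 _).integrableOn_Ioc c3.integrableOn_Ioc,
      int_zpow r hr, integral_const_mul, ih]
    ring

def FM (M : ℕ) (x y : ℕ → ℝ) (z : ℂ) : ℂ :=
  (∏ j ∈ Finset.range M, (1 - (y j : ℂ) / z)) / ∏ i ∈ Finset.range M, (1 - (x i : ℂ) * z)

lemma cauM_inv_map (M : ℕ) (x y : Fin M → ℝ) (hdet : (cauM x y).det ≠ 0) :
    (cauM (fun i => (x i : ℂ)) (fun i => (y i : ℂ))).det ≠ 0 ∧
    (cauM (fun i => (x i : ℂ)) (fun i => (y i : ℂ)))⁻¹ = (cauM x y)⁻¹.map Complex.ofReal := by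
  have e : cauM (fun i => (x i : ℂ)) (fun i => (y i : ℂ)) = Complex.ofRealHom.mapMatrix (cauM x y) := by
    ext i j
    simp [cauM]
  constructor
  · rw [e, ← RingHom.map_det]
    simpa using hdet
  · apply Matrix.inv_eq_right_inv
    rw [e]
    change _ * Complex.ofRealHom.mapMatrix ((cauM x y)⁻¹) = 1
    rw [← map_mul, Matrix.mul_nonsing_inv _ (isUnit_iff_ne_zero.2 hdet), map_one]

lemma FM_resolvent (M : ℕ) (x y : ℕ → ℝ) (hdet : (cauM (fun i : Fin M => x i) (fun j : Fin M => y j)).det ≠ 0)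
    (hxy : ∀ i j, 1 - x i * y j ≠ 0) (z w : ℂ) (hz : z ≠ 0) (hw : w ≠ 0) (hzw : z ≠ w)
    (hx : ∀ i, 1 - x i * z ≠ 0) (hx' : ∀ i, 1 - x i * w ≠ 0) (hy : ∀ j, w - y j ≠ 0) :
    FM M x y z / FM M x y w / (z - w) = z ^ (-(M : ℤ)) * w ^ (M : ℤ) * ((z - w)⁻¹ +
      ∑ i : Fin M, ∑ j : Fin M, ((cauM (fun i : Fin M => x i) (fun j : Fin M => y j))⁻¹ j i : ℂ) *
        (1 - x i * z)⁻¹ * (w - y j)⁻¹) := by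
  obtain ⟨h1, h2⟩ := cauM_inv_map M (fun i => x i) (fun i => y i) hdet
  have := cauchy_resolvent (fun i : Fin M => (x i : ℂ)) (fun i : Fin M => (y i : ℂ)) z w hw hzw
    (fun i j => by exact_mod_cast hxy i j) (fun i => hx i) (fun i => hy i) h1
  rw [h2] at this
  simp only [Matrix.map_apply] at this
  rw [this, Finset.prod_div_distrib, Finset.prod_div_distrib]
  rw [Fin.prod_univ_eq_prod_range (fun i => 1 - (x i : ℂ) * w), Fin.prod_univ_eq_prod_range (fun i => 1 - (x i : ℂ) * z),
    Fin.prod_univ_eq_prod_range (fun i => z - (y i : ℂ)), Fin.prod_univ_eq_prod_range (fun i => w - (y i : ℂ))]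
  have e : ∀ u : ℂ, u ≠ 0 → ∏ j ∈ Finset.range M, (1 - (y j : ℂ) / u) = (∏ j ∈ Finset.range M, (u - (y j : ℂ))) / u ^ M := by
    intro u hu
    rw [← Finset.card_range M, ← Finset.prod_const, Finset.card_range, ← Finset.prod_div_distrib]
    refine Finset.prod_congr rfl fun j _ => ?_
    field_simp
  rw [FM, FM, e z hz, e w hw, zpow_neg, zpow_natCast, zpow_natCast]
  have n1 : ∏ i ∈ Finset.range M, (1 - (x i : ℂ) * z) ≠ 0 := Finset.prod_ne_zero_iff.2 fun i _ => hx i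
  have n2 : ∏ i ∈ Finset.range M, (1 - (x i : ℂ) * w) ≠ 0 := Finset.prod_ne_zero_iff.2 fun i _ => hx' i
  have n3 : ∏ i ∈ Finset.range M, (w - (y i : ℂ)) ≠ 0 := Finset.prod_ne_zero_iff.2 fun i _ => hy i
  have n4 : z - w ≠ 0 := sub_ne_zero.2 hzw
  field_simp

lemma contour_fin (M : ℕ) (x y : ℕ → ℝ) (hdet : (cauM (fun i : Fin M => x i) (fun j : Fin M => y j)).det ≠ 0)
    (hxy : ∀ i j, 1 - x i * y j ≠ 0) (r₁ r₂ : ℝ) (hr2 : 0 < r₂) (hr : r₂ < r₁)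
    (hx : ∀ i, 0 < x i ∧ x i * r₁ < 1) (hy : ∀ i, 0 < y i ∧ y i < r₂) (κ l : ℤ) (k' l' : ℕ)
    (hk : κ = (k' : ℤ) - M) (hl : l = (l' : ℤ) - M) :
    ((2 * Real.pi : ℂ) ^ 2)⁻¹ * ∫ φ in Ioc (-Real.pi) Real.pi, ∫ ψ in Ioc (-Real.pi) Real.pi,
      FM M x y (zCirc r₁ φ) / FM M x y (zCirc r₂ ψ) * zCirc r₁ φ ^ (-κ) * zCirc r₂ ψ ^ (l + 1) /
        (zCirc r₁ φ - zCirc r₂ ψ) = (KM M x y k' l' : ℂ) := by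
  have hr1 : 0 < r₁ := hr2.trans hr
  set g : Fin M → Fin M → ℂ := fun i j => ((cauM (fun i : Fin M => x i) (fun j : Fin M => y j))⁻¹ j i : ℂ) with hg
  have z0 := fun φ => zCirc_ne r₁ φ hr1
  have w0 := fun φ => zCirc_ne r₂ φ hr2
  have hzw : ∀ φ ψ, zCirc r₁ φ - zCirc r₂ ψ ≠ 0 := by
    intro φ ψ h
    have := congrArg norm (sub_eq_zero.1 h)
    rw [zCirc_norm _ _ hr1, zCirc_norm _ _ hr2] at this
    linarith
  have hxz : ∀ (i : ℕ) (u : ℂ), ‖u‖ ≤ r₁ → 1 - (x i : ℂ) * u ≠ 0 := by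
    intro i w hw h
    have : (x i : ℂ) * w = 1 := (sub_eq_zero.1 h).symm
    have h2 : ‖(x i : ℂ)‖ * ‖w‖ = 1 := by rw [← norm_mul, this, norm_one]
    rw [Complex.norm_real, Real.norm_of_nonneg (hx i).1.le] at h2
    have := mul_le_mul_of_nonneg_left hw (hx i).1.le
    linarith [(hx i).2]
  have hxz1 := fun i φ => hxz i _ (zCirc_norm r₁ φ hr1).le
  have hwy : ∀ (j : ℕ) φ, zCirc r₂ φ - y j ≠ 0 := by
    intro j φ h
    have := congrArg norm (sub_eq_zero.1 h)
    rw [zCirc_norm _ _ hr2, Complex.norm_real, Real.norm_of_nonneg (hy j).1.le] at this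
    linarith [(hy j).2]
  have e1 : ∀ φ ψ, FM M x y (zCirc r₁ φ) / FM M x y (zCirc r₂ ψ) * zCirc r₁ φ ^ (-κ) * zCirc r₂ ψ ^ (l + 1) /
        (zCirc r₁ φ - zCirc r₂ ψ) = 
      zCirc r₁ φ ^ (-(k' : ℤ)) * (zCirc r₂ ψ ^ (l' + 1) * (zCirc r₁ φ - zCirc r₂ ψ)⁻¹ + 
        ∑ i : Fin M, ∑ j : Fin M, (g i j * (1 - x i * zCirc r₁ φ)⁻¹) * 
          (zCirc r₂ ψ ^ (l' + 1) * (zCirc r₂ ψ - y j)⁻¹)) := by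
    intro φ ψ
    have := FM_resolvent M x y hdet hxy (zCirc r₁ φ) (zCirc r₂ ψ) (z0 φ) (w0 ψ) (sub_ne_zero.1 (hzw φ ψ))
      (fun i => hxz1 i φ) (fun i => hxz i _ ((zCirc_norm r₂ ψ hr2).le.trans hr.le)) (fun j => hwy j ψ)
    have a1 : zCirc r₁ φ ^ (-(k' : ℤ)) = zCirc r₁ φ ^ (-(M : ℤ)) * zCirc r₁ φ ^ (-κ) := by
      rw [← zpow_add₀ (z0 φ)]; congr 1; rw [hk]; ring
    have a2 : zCirc r₂ ψ ^ (l' + 1) = zCirc r₂ ψ ^ (M : ℤ) * zCirc r₂ ψ ^ (l + 1) := by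
      rw [← zpow_natCast, ← zpow_add₀ (w0 ψ)]; congr 1; rw [hl]; push_cast; ring
    calc _ = (FM M x y (zCirc r₁ φ) / FM M x y (zCirc r₂ ψ) / (zCirc r₁ φ - zCirc r₂ ψ)) *
          (zCirc r₁ φ ^ (-κ) * zCirc r₂ ψ ^ (l + 1)) := by ring
      _ = _ := by
        rw [this, a1, a2]
        simp only [mul_add, Finset.mul_sum, add_mul, Finset.sum_mul]
        congr 1
        · ring
        · refine Finset.sum_congr rfl fun i _ => Finset.sum_congr rfl fun j _ => ?_
          ring
  have cw := zCirc_cont r₂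
  have cz := zCirc_cont r₁
  have c1 : ∀ φ, Continuous fun ψ => zCirc r₂ ψ ^ (l' + 1) * (zCirc r₁ φ - zCirc r₂ ψ)⁻¹ := fun φ =>
    (cw.pow _).mul ((continuous_const.sub cw).inv₀ (hzw φ))
  have c2 : ∀ j, Continuous fun ψ => zCirc r₂ ψ ^ (l' + 1) * (zCirc r₂ ψ - y j)⁻¹ := fun j =>
    (cw.pow _).mul ((cw.sub continuous_const).inv₀ (hwy j))
  have c3 : ∀ i j : Fin M, Continuous fun φ =>  (g i j * (2 * Real.pi * (y j : ℂ) ^ l')) * (zCirc r₁ φ ^ (-(k' : ℤ)) * (1 - x i * zCirc r₁ φ)⁻¹) := fun i j =>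
    continuous_const.mul ((cz.zpow₀ _ (fun φ => Or.inl (z0 φ))).mul ((continuous_const.sub (continuous_const.mul cz)).inv₀ (hxz1 i)))
  have e2 : ∀ φ, ∫ ψ in Ioc (-Real.pi) Real.pi,
      FM M x y (zCirc r₁ φ) / FM M x y (zCirc r₂ ψ) * zCirc r₁ φ ^ (-κ) * zCirc r₂ ψ ^ (l + 1) /
        (zCirc r₁ φ - zCirc r₂ ψ) = 
      ∑ i : Fin M, ∑ j : Fin M, (g i j * (2 * Real.pi * (y j : ℂ) ^ l')) * (zCirc r₁ φ ^ (-(k' : ℤ)) * (1 - x i * zCirc r₁ φ)⁻¹) := by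
    intro φ
    have c4 : ∀ i j : Fin M, Continuous fun ψ => (g i j * (1 - x i * zCirc r₁ φ)⁻¹) * 
          (zCirc r₂ ψ ^ (l' + 1) * (zCirc r₂ ψ - y j)⁻¹) := fun i j => continuous_const.mul (c2 j)
    simp only [e1]
    rw [integral_const_mul, integral_add (c1 φ).integrableOn_Ioc
      (continuous_finsetSum _ fun i _ => continuous_finsetSum _ fun j _ => c4 i j).integrableOn_Ioc,
      int_a r₂ hr2 _ (by rw [zCirc_norm _ _ hr1]; exact hr),
      integral_finset_sum _ (fun i _ => (continuous_finsetSum _ fun j _ => c4 i j).integrableOn_Ioc), zero_add,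
      Finset.mul_sum]
    refine Finset.sum_congr rfl fun i _ => ?_
    rw [integral_finset_sum _ (fun j _ => (c4 i j).integrableOn_Ioc), Finset.mul_sum]
    refine Finset.sum_congr rfl fun j _ => ?_
    rw [integral_const_mul, int_b r₂ hr2 _ (by rw [Complex.norm_real, Real.norm_of_nonneg (hy j).1.le]; exact (hy j).2)]
    ring
  simp only [e2]
  rw [integral_finset_sum _ (fun i _ => (continuous_finsetSum _ fun j _ => c3 i j).integrableOn_Ioc), KM]
  push_cast
  rw [Finset.mul_sum]
  refine Finset.sum_congr rfl fun i _ => ?_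
  rw [integral_finset_sum _ (fun j _ => (c3 i j).integrableOn_Ioc), Finset.mul_sum]
  refine Finset.sum_congr rfl fun j _ => ?_
  rw [integral_const_mul, int_c r₁ hr1 _ (by rw [Complex.norm_real, Real.norm_of_nonneg (hx i).1.le]; exact (hx i).2)]
  have : (Real.pi : ℂ) ≠ 0 := by exact_mod_cast Real.pi_ne_zero
  field_simp
  simp only [hg]
  ring

def Cb (ρ u : ℝ) : ℝ := Real.exp (ρ / (1 - ρ) * (1 - u)⁻¹)

lemma qp_bounds (c : ℂ) (ρ u : ℝ) (hc : ‖c‖ ≤ ρ) (hρ : ρ < 1) (hu0 : 0 < u) (hu1 : u < 1) (n : ℕ) :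
    ‖∏ i ∈ Finset.range n, (1 - c * (u : ℂ) ^ i)‖ ≤ Cb ρ u ∧
    ‖(∏ i ∈ Finset.range n, (1 - c * (u : ℂ) ^ i))⁻¹‖ ≤ Cb ρ u := by
  have hρ0 : 0 ≤ ρ := (norm_nonneg _).trans hc
  have hρ1 : 0 < 1 - ρ := by linarith
  have hsum : ∑ i ∈ Finset.range n, ρ / (1 - ρ) * u ^ i ≤ ρ / (1 - ρ) * (1 - u)⁻¹ := by
    rw [← Finset.mul_sum]
    refine mul_le_mul_of_nonneg_left ?_ (by positivity)
    rw [← tsum_geometric_of_lt_one hu0.le hu1]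
    exact (summable_geometric_of_lt_one hu0.le hu1).sum_le_tsum _ (fun i _ => by positivity)
  have hb : ∏ i ∈ Finset.range n, Real.exp (ρ / (1 - ρ) * u ^ i) ≤ Cb ρ u := by
    rw [← Real.exp_sum]
    exact Real.exp_le_exp.2 hsum
  have hn : ∀ i, ‖c * (u : ℂ) ^ i‖ ≤ ρ * u ^ i := by
    intro i
    rw [norm_mul, norm_pow, Complex.norm_real, Real.norm_of_nonneg hu0.le]
    exact mul_le_mul_of_nonneg_right hc (by positivity)
  have hle : ρ ≤ ρ / (1 - ρ) := by
    rw [le_div_iff₀ hρ1]; nlinarith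
  constructor
  · rw [norm_prod]
    refine le_trans (Finset.prod_le_prod (fun i _ => norm_nonneg _) fun i _ => ?_) hb
    have h1 : ‖1 - c * (u : ℂ) ^ i‖ ≤ 1 + ρ * u ^ i := by
      refine (norm_sub_le _ _).trans ?_
      rw [norm_one]; linarith [hn i]
    have h2 := Real.add_one_le_exp (ρ / (1 - ρ) * u ^ i)
    have h3 : ρ * u ^ i ≤ ρ / (1 - ρ) * u ^ i := mul_le_mul_of_nonneg_right hle (by positivity)
    linarith
  · rw [← Finset.prod_inv_distrib, norm_prod]
    refine le_trans (Finset.prod_le_prod (fun i _ => norm_nonneg _) fun i _ => ?_) hb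
    have hui : u ^ i ≤ 1 := pow_le_one₀ hu0.le hu1.le
    have hui0 : 0 < u ^ i := by positivity
    have h1 : 1 - ρ * u ^ i ≤ ‖1 - c * (u : ℂ) ^ i‖ := by
      have := norm_sub_norm_le (1 : ℂ) (c * (u : ℂ) ^ i)
      rw [norm_one] at this; linarith [hn i]
    have h0 : 1 - ρ ≤ 1 - ρ * u ^ i := by nlinarith
    have h4 : 0 < 1 - ρ * u ^ i := by linarith
    rw [norm_inv]
    refine (inv_anti₀ h4 h1).trans ?_
    have h2 := Real.add_one_le_exp (ρ / (1 - ρ) * u ^ i)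
    refine le_trans ?_ h2
    have : (1 - ρ * u ^ i)⁻¹ = ρ * u ^ i / (1 - ρ * u ^ i) + 1 := by field_simp; ring
    rw [this]
    have : ρ * u ^ i / (1 - ρ * u ^ i) ≤ ρ * u ^ i / (1 - ρ) :=
      div_le_div_of_nonneg_left (by positivity) hρ1 h0
    have e : ρ / (1 - ρ) * u ^ i = ρ * u ^ i / (1 - ρ) := by ring
    rw [e]; linarith

lemma qp_tendsto (c : ℂ) (u : ℝ) (hc : ‖c‖ < 1) (hu0 : 0 < u) (hu1 : u < 1) :
    Tendsto (fun n => ∏ i ∈ Finset.range n, (1 - c * (u : ℂ) ^ i)) atTop (𝓝 (qPochInf c u)) ∧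
    qPochInf c u ≠ 0 := by
  have h1 : Tendsto (fun n => ∏ i ∈ Finset.range n, (1 - c * (u : ℂ) ^ i)) atTop (𝓝 (qPochInf c u)) := by
    have : Multipliable (fun i : ℕ => 1 + -(c * (u : ℂ) ^ i)) := by
      apply multipliable_one_add_of_summable
      simp only [norm_neg, norm_mul, norm_pow, Complex.norm_real, Real.norm_of_nonneg hu0.le]
      exact (summable_geometric_of_lt_one hu0.le hu1).mul_left _
    have := this.hasProd.tendsto_prod_nat
    rw [qPochInf]
    simpa only [← sub_eq_add_neg] using this
  refine ⟨h1, ?_⟩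
  have hC : 0 < Cb ‖c‖ u := Real.exp_pos _
  have : (Cb ‖c‖ u)⁻¹ ≤ ‖qPochInf c u‖ := by
    refine ge_of_tendsto' h1.norm fun n => ?_
    have := (qp_bounds c ‖c‖ u le_rfl hc hu0 hu1 n).2
    rw [norm_inv] at this
    by_cases h0 : ‖∏ i ∈ Finset.range n, (1 - c * (u : ℂ) ^ i)‖ = 0
    · exfalso
      rw [norm_eq_zero, Finset.prod_eq_zero_iff] at h0
      obtain ⟨i, _, hi⟩ := h0
      have h2 : ‖c * (u : ℂ) ^ i‖ = 1 := by rw [← sub_eq_zero.1 hi, norm_one]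
      rw [norm_mul, norm_pow, Complex.norm_real, Real.norm_of_nonneg hu0.le] at h2
      have hui : u ^ i ≤ 1 := pow_le_one₀ hu0.le hu1.le
      have hui0 : 0 < u ^ i := by positivity
      nlinarith [norm_nonneg c]
    · have hp : 0 < ‖∏ i ∈ Finset.range n, (1 - c * (u : ℂ) ^ i)‖ := lt_of_le_of_ne (norm_nonneg _) (Ne.symm h0)
      exact inv_le_of_inv_le₀ hp this
  have h2 : 0 < (Cb ‖c‖ u)⁻¹ := inv_pos.2 hC
  exact norm_pos_iff.1 (h2.trans_le this)

lemma double_dct (H : ℕ → ℝ → ℝ → ℂ) (H0 : ℝ → ℝ → ℂ) (C : ℝ)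
    (hc : ∀ n, Continuous (Function.uncurry (H n))) (hb : ∀ n φ ψ, ‖H n φ ψ‖ ≤ C)
    (hlim : ∀ φ ψ, Tendsto (fun n => H n φ ψ) atTop (𝓝 (H0 φ ψ))) :
    Tendsto (fun n => ∫ φ in Ioc (-Real.pi) Real.pi, ∫ ψ in Ioc (-Real.pi) Real.pi, H n φ ψ) atTop
      (𝓝 (∫ φ in Ioc (-Real.pi) Real.pi, ∫ ψ in Ioc (-Real.pi) Real.pi, H0 φ ψ)) := by
  have hin : ∀ φ, Tendsto (fun n => ∫ ψ in Ioc (-Real.pi) Real.pi, H n φ ψ) atTop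
      (𝓝 (∫ ψ in Ioc (-Real.pi) Real.pi, H0 φ ψ)) := by
    intro φ
    refine tendsto_integral_of_dominated_convergence (fun _ => C) ?_ ?_ ?_ ?_
    · intro n
      exact ((hc n).comp (by fun_prop : Continuous fun ψ : ℝ => (φ, ψ))).aestronglyMeasurable
    · exact integrableOn_const (by simp)
    · intro n; exact ae_of_all _ (hb n φ)
    · exact ae_of_all _ (hlim φ)
  refine tendsto_integral_of_dominated_convergence (fun _ => C * (volume (Ioc (-Real.pi) Real.pi)).toReal) ?_ ?_ ?_ ?_
  · intro n
    exact ((hc n).stronglyMeasurable.integral_prod_right (ν := volume.restrict (Ioc (-Real.pi) Real.pi))).aestronglyMeasurable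
  · exact integrableOn_const (by simp)
  · intro n
    refine ae_of_all _ fun φ => ?_
    exact norm_setIntegral_le_of_norm_le_const (by simp) (fun ψ _ => hb n φ ψ)
  · exact ae_of_all _ hin

lemma contour_lim (cx cy Q R r₁ r₂ : ℝ) (hcx : 0 < cx) (hcy : 0 < cy) (hQ0 : 0 < Q) (hQ1 : Q < 1)
    (hR0 : 0 < R) (hR1 : R < 1) (hr2 : 0 < r₂) (hr : r₂ < r₁) (h1 : cx * r₁ < 1) (h2 : cy < r₂) (κ l : ℤ) :
    Tendsto (fun M => ∫ φ in Ioc (-Real.pi) Real.pi, ∫ ψ in Ioc (-Real.pi) Real.pi,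
      FM M (fun i => cx * Q ^ i) (fun i => cy * R ^ i) (zCirc r₁ φ) /
        FM M (fun i => cx * Q ^ i) (fun i => cy * R ^ i) (zCirc r₂ ψ) *
         zCirc r₁ φ ^ (-κ) * zCirc r₂ ψ ^ (l + 1) / (zCirc r₁ φ - zCirc r₂ ψ)) atTop
      (𝓝 (∫ φ in Ioc (-Real.pi) Real.pi, ∫ ψ in Ioc (-Real.pi) Real.pi,
        (qPochInf ((cy : ℂ) / zCirc r₁ φ) R / qPochInf (cx * zCirc r₁ φ) Q) /
        (qPochInf ((cy : ℂ) / zCirc r₂ ψ) R / qPochInf (cx * zCirc r₂ ψ) Q) *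
         zCirc r₁ φ ^ (-κ) * zCirc r₂ ψ ^ (l + 1) / (zCirc r₁ φ - zCirc r₂ ψ))) := by
  have hr1 : 0 < r₁ := hr2.trans hr
  have z0 := fun φ => zCirc_ne r₁ φ hr1
  have w0 := fun φ => zCirc_ne r₂ φ hr2
  have hzw : ∀ φ ψ, zCirc r₁ φ - zCirc r₂ ψ ≠ 0 := by
    intro φ ψ h
    have := congrArg norm (sub_eq_zero.1 h)
    rw [zCirc_norm _ _ hr1, zCirc_norm _ _ hr2] at this
    linarith
  have hzw' : ∀ φ ψ, r₁ - r₂ ≤ ‖zCirc r₁ φ - zCirc r₂ ψ‖ := by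
    intro φ ψ
    have := norm_sub_norm_le (zCirc r₁ φ) (zCirc r₂ ψ)
    rwa [zCirc_norm _ _ hr1, zCirc_norm _ _ hr2] at this
  have hX : ∀ z : ℂ, ‖z‖ ≤ r₁ → ‖(cx : ℂ) * z‖ ≤ cx * r₁ := by
    intro z hz
    rw [norm_mul, Complex.norm_real, Real.norm_of_nonneg hcx.le]
    exact mul_le_mul_of_nonneg_left hz hcx.le
  have hY : ∀ z : ℂ, r₂ ≤ ‖z‖ → ‖(cy : ℂ) / z‖ ≤ cy / r₂ := by
    intro z hz
    rw [norm_div, Complex.norm_real, Real.norm_of_nonneg hcy.le]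
    exact div_le_div_of_nonneg_left hcy.le hr2 hz
  have h2' : cy / r₂ < 1 := (div_lt_one hr2).2 h2
  have eFM : ∀ M z, FM M (fun i => cx * Q ^ i) (fun i => cy * R ^ i) z =
      (∏ i ∈ Finset.range M, (1 - (cy : ℂ) / z * (R : ℂ) ^ i)) /
        ∏ i ∈ Finset.range M, (1 - (cx : ℂ) * z * (Q : ℂ) ^ i) := by
    intro M z
    rw [FM]
    congr 1
    · refine Finset.prod_congr rfl fun i _ => ?_
      push_cast; ring
    · refine Finset.prod_congr rfl fun i _ => ?_
      push_cast; ring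
  simp only [eFM]
  have tX := fun z hz => qp_tendsto ((cx : ℂ) * z) Q ((hX z hz).trans_lt h1) hQ0 hQ1
  have tY := fun z hz => qp_tendsto ((cy : ℂ) / z) R ((hY z hz).trans_lt h2') hR0 hR1
  have bX := fun z hz n => qp_bounds ((cx : ℂ) * z) _ Q (hX z hz) h1 hQ0 hQ1 n
  have bY := fun z hz n => qp_bounds ((cy : ℂ) / z) _ R (hY z hz) h2' hR0 hR1 n
  have nX : ∀ z : ℂ, ‖z‖ ≤ r₁ → ∀ n, ∏ i ∈ Finset.range n, (1 - (cx : ℂ) * z * (Q : ℂ) ^ i) ≠ 0 := by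
    intro z hz n h0
    rw [Finset.prod_eq_zero_iff] at h0
    obtain ⟨i, _, hi⟩ := h0
    have h3 : ‖(cx : ℂ) * z * (Q : ℂ) ^ i‖ = 1 := by rw [← sub_eq_zero.1 hi, norm_one]
    rw [norm_mul, norm_pow, Complex.norm_real, Real.norm_of_nonneg hQ0.le] at h3
    have hui : Q ^ i ≤ 1 := pow_le_one₀ hQ0.le hQ1.le
    have hui0 : 0 < Q ^ i := by positivity
    nlinarith [norm_nonneg ((cx : ℂ) * z), hX z hz]
  have nY : ∀ z : ℂ, r₂ ≤ ‖z‖ → ∀ n, ∏ i ∈ Finset.range n, (1 - (cy : ℂ) / z * (R : ℂ) ^ i) ≠ 0 := by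
    intro z hz n h0
    rw [Finset.prod_eq_zero_iff] at h0
    obtain ⟨i, _, hi⟩ := h0
    have h3 : ‖(cy : ℂ) / z * (R : ℂ) ^ i‖ = 1 := by rw [← sub_eq_zero.1 hi, norm_one]
    rw [norm_mul, norm_pow, Complex.norm_real, Real.norm_of_nonneg hR0.le] at h3
    have hui : R ^ i ≤ 1 := pow_le_one₀ hR0.le hR1.le
    have hui0 : 0 < R ^ i := by positivity
    nlinarith [norm_nonneg ((cy : ℂ) / z), hY z hz]
  have zn1 := fun φ => (zCirc_norm r₁ φ hr1).le
  have zn2 : ∀ φ, r₂ ≤ ‖zCirc r₁ φ‖ := fun φ => by rw [zCirc_norm r₁ φ hr1]; exact hr.le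
  have wn1 : ∀ φ, ‖zCirc r₂ φ‖ ≤ r₁ := fun φ => by rw [zCirc_norm r₂ φ hr2]; exact hr.le
  have wn2 := fun φ => (zCirc_norm r₂ φ hr2).ge
  set CX := Cb (cx * r₁) Q
  set CY := Cb (cy / r₂) R
  have hCX : 0 ≤ CX := (Real.exp_pos _).le
  have hCY : 0 ≤ CY := (Real.exp_pos _).le
  refine double_dct _ _ (((CY * CX) * (CX * CY)) * r₁ ^ (-κ) * r₂ ^ (l + 1) * (r₁ - r₂)⁻¹) ?_ ?_ ?_
  · intro n
    have c1 : Continuous fun p : ℝ × ℝ => zCirc r₁ p.1 := (zCirc_cont r₁).comp continuous_fst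
    have c2 : Continuous fun p : ℝ × ℝ => zCirc r₂ p.2 := (zCirc_cont r₂).comp continuous_snd
    have pc : ∀ (f : ℝ × ℝ → ℂ) (u : ℂ), Continuous f →
       Continuous fun p => ∏ i ∈ Finset.range n, (1 - f p * u ^ i) := by
      intro f u hf
      exact continuous_finsetProd _ fun i _ => by fun_prop
    have d1 := pc (fun p => (cy : ℂ) / zCirc r₁ p.1) R (continuous_const.div c1 fun p => z0 _)
    have d2 := pc (fun p => (cx : ℂ) * zCirc r₁ p.1) Q (continuous_const.mul c1)
    have d3 := pc (fun p => (cy : ℂ) / zCirc r₂ p.2) R (continuous_const.div c2 fun p => w0 _)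
    have d4 := pc (fun p => (cx : ℂ) * zCirc r₂ p.2) Q (continuous_const.mul c2)
    have e1 := d1.div d2 (fun p => nX _ (zn1 p.1) n)
    have e2 := d3.div d4 (fun p => nX _ (wn1 p.2) n)
    have e3 := e1.div e2 (fun p => div_ne_zero (nY _ (wn2 p.2) n) (nX _ (wn1 p.2) n))
    exact ((e3.mul (c1.zpow₀ _ fun p => Or.inl (z0 _))).mul (c2.zpow₀ _ fun p => Or.inl (w0 _))).div
      (c1.sub c2) (fun p => hzw _ _)
  · intro n φ ψ
    rw [div_eq_mul_inv, norm_mul, norm_mul, norm_mul, norm_inv, norm_zpow, norm_zpow, zCirc_norm _ _ hr1,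
      zCirc_norm _ _ hr2]
    have b1 := (bX _ (zn1 φ) n).2
    have b2 := (bY _ (zn2 φ) n).1
    have b3 := (bX _ (wn1 ψ) n).1
    have b4 := (bY _ (wn2 ψ) n).2
    have hinv : ‖zCirc r₁ φ - zCirc r₂ ψ‖⁻¹ ≤ (r₁ - r₂)⁻¹ := inv_anti₀ (by linarith) (hzw' φ ψ)
    have q1 : 0 < r₁ ^ (-κ) := by positivity
    have q2 : 0 < r₂ ^ (l + 1) := by positivity
    rw [div_div_eq_mul_div, div_eq_mul_inv, div_eq_mul_inv, norm_mul, norm_mul, norm_mul]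
    have : ‖∏ i ∈ Finset.range n, (1 - (cy : ℂ) / zCirc r₁ φ * (R : ℂ) ^ i)‖ *
        ‖(∏ i ∈ Finset.range n, (1 - (cx : ℂ) * zCirc r₁ φ * (Q : ℂ) ^ i))⁻¹‖ *
        ‖∏ i ∈ Finset.range n, (1 - (cx : ℂ) * zCirc r₂ ψ * (Q : ℂ) ^ i)‖ *
        ‖(∏ i ∈ Finset.range n, (1 - (cy : ℂ) / zCirc r₂ ψ * (R : ℂ) ^ i))⁻¹‖ ≤ CY * CX * (CX * CY) := by
      rw [← mul_assoc (CY * CX)]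
      gcongr
    gcongr
  · intro φ ψ
    refine Tendsto.div (Tendsto.mul_const _ (Tendsto.mul_const _ (Tendsto.div ?_ ?_ ?_))) tendsto_const_nhds (hzw φ ψ)
    · exact (tY _ (zn2 φ)).1.div (tX _ (zn1 φ)).1 (tX _ (zn1 φ)).2
    · exact (tY _ (wn2 ψ)).1.div (tX _ (wn1 ψ)).1 (tX _ (wn1 ψ)).2
    · exact div_ne_zero (tY _ (wn2 ψ)).2 (tX _ (wn1 ψ)).2

lemma exists_box (P : PlanePartition ⊤ ⊤) : ∃ M, InBox M P := by
  obtain ⟨⟨a, b⟩, hab⟩ := P.finite_supp.bddAbove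
  refine ⟨a + b + 1, fun i j h => ?_⟩
  by_contra h0
  have := hab (show (i, j) ∈ {p : ℕ × ℕ | P.part p.1 p.2 ≠ 0} from h0)
  have h1 : i ≤ a := this.1
  have h2 : j ≤ b := this.2
  omega

lemma InBox.mono {M M' : ℕ} (h : M ≤ M') {P : PlanePartition ⊤ ⊤} (hP : InBox M P) : InBox M' P :=
  fun i j hij => hP i j (by omega)

lemma box_lim (g : PlanePartition ⊤ ⊤ → ENNReal) :
    Tendsto (fun M => ∑' P : {P : PlanePartition ⊤ ⊤ // InBox M P}, g P.1) atTop (𝓝 (∑' P, g P)) := by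
  letI : MeasurableSpace (PlanePartition ⊤ ⊤) := ⊤
  have e : ∀ M, ∑' P : {P : PlanePartition ⊤ ⊤ // InBox M P}, g P.1 =
      ∫⁻ P, ({P | InBox M P} : Set (PlanePartition ⊤ ⊤)).indicator g P ∂Measure.count := by
    intro M
    rw [lintegral_count]
    exact tsum_subtype {P | InBox M P} g
  simp only [e]
  rw [← lintegral_count]
  refine lintegral_tendsto_of_tendsto_of_monotone (fun M => measurable_from_top.aemeasurable) ?_ ?_
  · refine ae_of_all _ fun P M M' h => ?_
    exact indicator_le_indicator_of_subset (fun P hP => InBox.mono h hP) (fun _ => zero_le) P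
  · refine ae_of_all _ fun P => ?_
    obtain ⟨M0, h0⟩ := exists_box P
    refine tendsto_const_nhds.congr' ?_
    filter_upwards [eventually_ge_atTop M0] with M hM
    exact (indicator_of_mem (show P ∈ {P | InBox M P} from InBox.mono hM h0) g).symm

lemma ZM_bound (cx cy Q R : ℝ) (hcx : 0 < cx) (hcy : 0 < cy) (hcx1 : cx < 1) (hcy1 : cy < 1)
    (hQ0 : 0 < Q) (hQ1 : Q < 1) (hR0 : 0 < R) (hR1 : R < 1) (M : ℕ) :
    ZM M (fun i => cx * Q ^ i) (fun i => cy * R ^ i) ≤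
      Real.exp (cx * cy / (1 - cx * cy) * (1 - Q)⁻¹ * (1 - R)⁻¹) := by
  have hc : 0 < 1 - cx * cy := by nlinarith
  have hQ : ∑ i ∈ Finset.range M, Q ^ i ≤ (1 - Q)⁻¹ := by
    rw [← tsum_geometric_of_lt_one hQ0.le hQ1]
    exact (summable_geometric_of_lt_one hQ0.le hQ1).sum_le_tsum _ (fun i _ => by positivity)
  have hR : ∑ i ∈ Finset.range M, R ^ i ≤ (1 - R)⁻¹ := by
    rw [← tsum_geometric_of_lt_one hR0.le hR1]
    exact (summable_geometric_of_lt_one hR0.le hR1).sum_le_tsum _ (fun i _ => by positivity)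
  have hb : ∀ i j : ℕ, 0 < 1 - cx * Q ^ i * (cy * R ^ j) ∧ (1 - cx * Q ^ i * (cy * R ^ j))⁻¹ ≤
      Real.exp (cx * cy / (1 - cx * cy) * Q ^ i * R ^ j) := by
    intro i j
    have a1 : Q ^ i ≤ 1 := pow_le_one₀ hQ0.le hQ1.le
    have a2 : R ^ j ≤ 1 := pow_le_one₀ hR0.le hR1.le
    have a3 : Q ^ i * R ^ j ≤ 1 := mul_le_one₀ a1 (by positivity) a2
    have a0 : 0 < Q ^ i * R ^ j := by positivity
    have a4 : 1 - cx * cy ≤ 1 - cx * Q ^ i * (cy * R ^ j) := by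
      have : cx * cy * (Q ^ i * R ^ j) ≤ cx * cy := mul_le_of_le_one_right (by positivity) a3
      nlinarith
    have a5 : 0 < 1 - cx * Q ^ i * (cy * R ^ j) := by linarith
    refine ⟨a5, ?_⟩
    refine le_trans ?_ (Real.add_one_le_exp _)
    have : (1 - cx * Q ^ i * (cy * R ^ j))⁻¹ = cx * Q ^ i * (cy * R ^ j) / (1 - cx * Q ^ i * (cy * R ^ j)) + 1 := by
      rw [div_add_one a5.ne', add_sub_cancel, one_div]
    rw [this]
    have : cx * Q ^ i * (cy * R ^ j) / (1 - cx * Q ^ i * (cy * R ^ j)) ≤ cx * Q ^ i * (cy * R ^ j) / (1 - cx * cy) :=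
      div_le_div_of_nonneg_left (by positivity) hc a4
    have e : cx * cy / (1 - cx * cy) * Q ^ i * R ^ j = cx * Q ^ i * (cy * R ^ j) / (1 - cx * cy) := by ring
    rw [e]; linarith
  have : ZM M (fun i => cx * Q ^ i) (fun i => cy * R ^ i) ≤
      ∏ i ∈ Finset.range M, ∏ j ∈ Finset.range M, Real.exp (cx * cy / (1 - cx * cy) * Q ^ i * R ^ j) := by
    refine Finset.prod_le_prod (fun i _ => Finset.prod_nonneg fun j _ => (inv_pos.2 (hb i j).1).le) fun i _ => ?_
    exact Finset.prod_le_prod (fun j _ => (inv_pos.2 (hb i j).1).le) fun j _ => (hb i j).2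
  refine this.trans ?_
  simp only [← Real.exp_sum]
  rw [Real.exp_le_exp]
  simp only [← Finset.mul_sum, ← Finset.sum_mul]
  have h0 : 0 ≤ ∑ i ∈ Finset.range M, R ^ i := Finset.sum_nonneg fun i _ => by positivity
  have h1 : 0 ≤ ∑ i ∈ Finset.range M, Q ^ i := Finset.sum_nonneg fun i _ => by positivity
  have h2 : 0 ≤ (1 - Q)⁻¹ := h1.trans hQ
  gcongr

lemma ft_le {m : ℕ} (κ : Fin m → ℤ) (t : ℝ) (ht : 0 ≤ t) (lam : ℕ → ℕ) : ft κ t lam ≤ (1 + t) ^ m := by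
  classical
  rw [ft]
  refine (Finset.prod_le_prod (g := fun _ => 1 + t) (fun i _ => ?_) (fun i _ => ?_)).trans_eq (by simp)
  · split_ifs <;> linarith
  · split_ifs <;> linarith

lemma one_le_ft {m : ℕ} (κ : Fin m → ℤ) (t : ℝ) (ht : 0 ≤ t) (lam : ℕ → ℕ) : 1 ≤ ft κ t lam := by
  classical
  rw [ft]
  refine Eq.trans_le (by simp) (Finset.prod_le_prod (f := fun _ => (1 : ℝ)) (fun i _ => zero_le_one) (fun i _ => ?_))
  split_ifs <;> linarith

/-- Abstract conclusion -/
lemma conclude {α : Type*} {m : ℕ} (W : α → ℝ) (hW0 : ∀ P, 0 ≤ W P) (hWs : Summable W) 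
    (hZ : 0 < ∑' P, W P) (d : α → ℕ → ℕ) (κ : Fin m → ℤ) (K : Matrix (Fin m) (Fin m) ℝ)
    (h : ∀ t : ℝ, 0 < t → ∑' P, W P * ft κ t (d P) = (∑' P, W P) * Matrix.det (1 + t • K)) :
    (∑' P : {P | ∀ i : Fin m, ∃ n : ℕ, (d P n : ℤ) - (n : ℤ) - 1 = κ i}, W P.1) / (∑' P, W P) = K.det := by
  classical
  set E : Set α := {P | ∀ i : Fin m, ∃ n : ℕ, (d P n : ℤ) - (n : ℤ) - 1 = κ i} with hE
  have ti : Tendsto (fun t : ℝ => t⁻¹) atTop (𝓝 0) := tendsto_inv_atTop_zero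
  have l1 : Tendsto (fun t : ℝ => ∑' P, W P * (ft κ t (d P) * (t⁻¹) ^ m)) atTop (𝓝 (∑' P, E.indicator W P)) := by
    refine tendsto_tsum_of_dominated_convergence (bound := fun P => W P * 2 ^ m) (hWs.mul_right _) ?_ ?_
    · intro P
      have e : E.indicator W P = W P * ∏ i, (if ∃ n : ℕ, (d P n : ℤ) - (n : ℤ) - 1 = κ i then (1 : ℝ) else 0) := by
        by_cases hP : P ∈ E
        · rw [indicator_of_mem hP, Finset.prod_eq_one, mul_one]
          intro i _; exact if_pos (hP i)
        · rw [indicator_of_notMem hP]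
          have : ∃ i, ¬ ∃ n : ℕ, (d P n : ℤ) - (n : ℤ) - 1 = κ i := not_forall.1 hP
          obtain ⟨i, hi⟩ := this
          rw [Finset.prod_eq_zero (Finset.mem_univ i) (if_neg hi), mul_zero]
      rw [e]
      refine Tendsto.const_mul _ ?_
      have e2 : ∀ t : ℝ, ft κ t (d P) * (t⁻¹) ^ m =
          ∏ i, ((if ∃ n : ℕ, (d P n : ℤ) - (n : ℤ) - 1 = κ i then 1 + t else 1) * t⁻¹) := by
        intro t
        rw [Finset.prod_mul_distrib, ft]; simp
      simp only [e2]
      refine tendsto_finsetProd _ fun i _ => ?_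
      split_ifs
      · have : Tendsto (fun t : ℝ => t⁻¹ + 1) atTop (𝓝 (0 + 1)) := ti.add_const 1
        rw [zero_add] at this
        refine this.congr' ?_
        filter_upwards [eventually_gt_atTop 0] with t ht
        field_simp
      · simpa using ti
    · filter_upwards [eventually_ge_atTop 1] with t ht P
      have h0 : 0 < t := by linarith
      have h1 := ft_le κ t h0.le (d P)
      have h2 := ft_nonneg κ t h0.le (d P)
      have h3 : ft κ t (d P) * (t⁻¹) ^ m ≤ 2 ^ m := by
        calc _ ≤ (1 + t) ^ m * (t⁻¹) ^ m := by gcongr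
          _ = ((1 + t) * t⁻¹) ^ m := (mul_pow _ _ _).symm
          _ ≤ 2 ^ m := by
            gcongr
            rw [← div_eq_mul_inv, div_le_iff₀ h0]; linarith
      rw [Real.norm_of_nonneg (mul_nonneg (hW0 P) (by positivity))]
      exact mul_le_mul_of_nonneg_left h3 (hW0 P)
  have l2 : Tendsto (fun t : ℝ => ∑' P, W P * (ft κ t (d P) * (t⁻¹) ^ m)) atTop (𝓝 ((∑' P, W P) * K.det)) := by
    have hc : Continuous fun s : ℝ => (∑' P, W P) * Matrix.det (s • (1 : Matrix (Fin m) (Fin m) ℝ) + K) := by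
      refine continuous_const.mul (Continuous.matrix_det ?_)
      fun_prop
    have := (hc.tendsto 0).comp ti
    simp only [zero_smul, zero_add] at this
    refine this.congr' ?_
    filter_upwards [eventually_gt_atTop 0] with t ht
    simp only [← mul_assoc]
    rw [tsum_mul_right, h t ht]
    simp only [Function.comp]
    have e : t⁻¹ • (1 : Matrix (Fin m) (Fin m) ℝ) + K = t⁻¹ • (1 + t • K) := by
      rw [smul_add, smul_smul, inv_mul_cancel₀ ht.ne', one_smul]
    rw [e, Matrix.det_smul, Fintype.card_fin]
    ring
  have := tendsto_nhds_unique l1 l2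
  rw [tsum_subtype E W, this]
  field_simp

lemma ofReal_lim {ι : Type*} {l : Filter ι} [l.NeBot] (u : ι → ℝ) (c S : ℝ) (hS : 0 < S)
    (h : Tendsto (fun n => ENNReal.ofReal (u n)) l (𝓝 (ENNReal.ofReal S))) (hu : Tendsto u l (𝓝 c)) : S = c := by
  have h2 := (ENNReal.continuous_ofReal.tendsto c).comp hu
  have := tendsto_nhds_unique h h2
  have hc : 0 < c := by
    by_contra hc
    rw [ENNReal.ofReal_of_nonpos (not_lt.1 hc), ENNReal.ofReal_eq_zero] at this
    linarith
  have := congrArg ENNReal.toReal this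
  rwa [ENNReal.toReal_ofReal hS.le, ENNReal.toReal_ofReal hc.le] at this

lemma main_aux (q a η θ cx cy : ℝ) (hcx : 0 < cx) (hcy : 0 < cy) (hcx1 : cx < 1) (hcy1 : cy < 1)
    (hc : a * Real.sqrt (q ^ η * q ^ θ) = cx * cy)
    (hQ0 : 0 < q ^ η) (hQ1 : q ^ η < 1) (hR0 : 0 < q ^ θ) (hR1 : q ^ θ < 1) (ha : 0 < a)
    (m : ℕ) (κ : Fin m → ℤ) (hκ : Function.Injective κ) (K : Matrix (Fin m) (Fin m) ℝ)
    (hK : ∀ i j, Tendsto (fun M : ℕ => KM M (fun i => cx * (q ^ η) ^ i) (fun i => cy * (q ^ θ) ^ i)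
      (κ i + M).toNat (κ j + M).toNat) atTop (𝓝 (K i j))) :
    mbProb q a η θ ⊤ ⊤ {Λ | ∀ i : Fin m, ∃ n : ℕ, (Λ.part n n : ℤ) - (n : ℤ) - 1 = κ i} = K.det := by
  set x : ℕ → ℝ := fun i => cx * (q ^ η) ^ i with hxd
  set y : ℕ → ℝ := fun i => cy * (q ^ θ) ^ i with hyd
  set W : PlanePartition ⊤ ⊤ → ℝ := fun P => mbWeight q a η θ P with hW
  have hW0 : ∀ P, 0 < W P := by
    intro P; simp only [hW, mbWeight]
    have : 0 < Real.sqrt (q ^ η * q ^ θ) := Real.sqrt_pos.2 (by positivity)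
    positivity
  -- partition function
  have hZM : ∀ M, ∑' P : {P : PlanePartition ⊤ ⊤ // InBox M P}, ENNReal.ofReal (W P.1) = ENNReal.ofReal (ZM M x y) := by
    intro M
    have := box_det q a η θ cx cy hcx hcy hcx1 hcy1 hc hQ0 hQ1 hR0 hR1 ha M 0 Fin.elim0
      (fun i => i.elim0) 1 zero_le_one Fin.elim0 (fun i => i.elim0)
    simpa [ft] using this
  have hlimZ := box_lim fun P => ENNReal.ofReal (W P)
  simp only [hZM] at hlimZ
  have hfin : ∑' P, ENNReal.ofReal (W P) ≠ ⊤ := by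
    refine ne_top_of_le_ne_top ENNReal.ofReal_ne_top (le_of_tendsto' hlimZ fun M => ENNReal.ofReal_le_ofReal
      (ZM_bound cx cy _ _ hcx hcy hcx1 hcy1 hQ0 hQ1 hR0 hR1 M))
  have hWs : Summable W := by
    have := ENNReal.summable_toReal hfin
    refine this.congr fun P => ?_
    exact ENNReal.toReal_ofReal (hW0 P).le
  have hZ : 0 < ∑' P, W P := by
    let P0 : PlanePartition ⊤ ⊤ := ⟨fun _ _ => 0, by simp, by simp, by simp, by simp, by simp⟩
    exact hWs.tsum_pos (fun P => (hW0 P).le) P0 (hW0 P0)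
  rw [← ENNReal.ofReal_tsum_of_nonneg (fun P => (hW0 P).le) hWs] at hlimZ
  have hZM0 : ∀ M, 0 ≤ ZM M x y := by
    intro M
    refine Finset.prod_nonneg fun i _ => Finset.prod_nonneg fun j _ => inv_nonneg.2 ?_
    have a1 : (q ^ η) ^ i ≤ 1 := pow_le_one₀ hQ0.le hQ1.le
    have a2 : (q ^ θ) ^ j ≤ 1 := pow_le_one₀ hR0.le hR1.le
    have : x i * y j ≤ 1 := mul_le_one₀ (by simp only [hxd]; nlinarith) (by simp only [hyd]; positivity)
      (by simp only [hyd]; nlinarith)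
    linarith
  have hlimZr : Tendsto (fun M => ZM M x y) atTop (𝓝 (∑' P, W P)) := by
    have := (ENNReal.tendsto_toReal ENNReal.ofReal_ne_top).comp hlimZ
    rw [ENNReal.toReal_ofReal hZ.le] at this
    refine this.congr fun M => ?_
    simp only [Function.comp]
    exact ENNReal.toReal_ofReal (hZM0 M)
  refine conclude W (fun P => (hW0 P).le) hWs hZ (fun P j => P.part j j) κ K ?_
  intro t ht
  set f : PlanePartition ⊤ ⊤ → ℝ := fun P => W P * ft κ t (fun j => P.part j j) with hf
  have hf1 : ∀ P, W P ≤ f P := fun P => le_mul_of_one_le_right (hW0 P).le (one_le_ft κ t ht.le _)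
  have hf0 : ∀ P, 0 ≤ f P := fun P => (hW0 P).le.trans (hf1 P)
  have hfs : Summable f := by
    refine Summable.of_nonneg_of_le hf0 (fun P => ?_) (hWs.mul_right ((1 + t) ^ m))
    exact mul_le_mul_of_nonneg_left (ft_le κ t ht.le _) (hW0 P).le
  have hS : 0 < ∑' P, f P := hZ.trans_le (hWs.tsum_le_tsum hf1 hfs)
  have hlim := box_lim fun P => ENNReal.ofReal (f P)
  rw [← ENNReal.ofReal_tsum_of_nonneg hf0 hfs] at hlim
  refine ofReal_lim (l := atTop) (fun M : ℕ => ZM M x y * Matrix.det (1 + t • Matrix.of fun i j =>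
    KM M x y (κ i + M).toNat (κ j + M).toNat)) _ _ hS ?_ ?_
  · refine hlim.congr' ?_
    have hev : ∀ᶠ M : ℕ in atTop, ∀ i, 0 ≤ κ i + M := by
      rw [eventually_all]
      intro i
      filter_upwards [eventually_ge_atTop (-κ i).toNat] with M hM
      omega
    filter_upwards [hev] with M hM
    exact box_det q a η θ cx cy hcx hcy hcx1 hcy1 hc hQ0 hQ1 hR0 hR1 ha M m κ hκ t ht.le
      (fun i => (κ i + M).toNat) (fun i => by have := hM i; omega)
  · refine hlimZr.mul ?_
    have hcont : Continuous fun A : Matrix (Fin m) (Fin m) ℝ => Matrix.det (1 + t • A) := by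
      refine Continuous.matrix_det ?_
      fun_prop
    refine (hcont.tendsto K).comp ?_
    refine tendsto_pi_nhds.2 fun i => tendsto_pi_nhds.2 fun j => hK i j

lemma KM_lim (cx cy Q R r₁ r₂ : ℝ) (hcx : 0 < cx) (hcy : 0 < cy) (hcx1 : cx < 1) (hcy1 : cy < 1)
    (hQ0 : 0 < Q) (hQ1 : Q < 1)
    (hR0 : 0 < R) (hR1 : R < 1) (hr2 : 0 < r₂) (hr : r₂ < r₁) (h1 : cx * r₁ < 1) (h2 : cy < r₂) (κ l : ℤ) :
    Tendsto (fun M : ℕ => (KM M (fun i => cx * Q ^ i) (fun i => cy * R ^ i) (κ + M).toNat (l + M).toNat : ℂ)) atTop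
      (𝓝 (((2 * Real.pi : ℂ) ^ 2)⁻¹ * ∫ φ in Ioc (-Real.pi) Real.pi, ∫ ψ in Ioc (-Real.pi) Real.pi,
        (qPochInf ((cy : ℂ) / zCirc r₁ φ) R / qPochInf (cx * zCirc r₁ φ) Q) /
        (qPochInf ((cy : ℂ) / zCirc r₂ ψ) R / qPochInf (cx * zCirc r₂ ψ) Q) *
         zCirc r₁ φ ^ (-κ) * zCirc r₂ ψ ^ (l + 1) / (zCirc r₁ φ - zCirc r₂ ψ))) := by
  have := (contour_lim cx cy Q R r₁ r₂ hcx hcy hQ0 hQ1 hR0 hR1 hr2 hr h1 h2 κ l).const_mul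
    (((2 * Real.pi : ℂ) ^ 2)⁻¹)
  refine this.congr' ?_
  filter_upwards [eventually_ge_atTop (-κ).toNat, eventually_ge_atTop (-l).toNat] with M hM1 hM2
  have a1 : ∀ i : ℕ, 0 < Q ^ i ∧ Q ^ i ≤ 1 := fun i => ⟨by positivity, pow_le_one₀ hQ0.le hQ1.le⟩
  have a2 : ∀ i : ℕ, 0 < R ^ i ∧ R ^ i ≤ 1 := fun i => ⟨by positivity, pow_le_one₀ hR0.le hR1.le⟩
  have b1 : ∀ i : ℕ, cx * Q ^ i ≤ cx := fun i => mul_le_of_le_one_right hcx.le (a1 i).2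
  have b2 : ∀ i : ℕ, cy * R ^ i ≤ cy := fun i => mul_le_of_le_one_right hcy.le (a2 i).2
  have b3 : ∀ i : ℕ, 0 < cx * Q ^ i := fun i => mul_pos hcx (a1 i).1
  have b4 : ∀ i : ℕ, 0 < cy * R ^ i := fun i => mul_pos hcy (a2 i).1
  have hxy : ∀ i j : ℕ, 0 < 1 - cx * Q ^ i * (cy * R ^ j) := by
    intro i j
    have := mul_le_mul (b1 i) (b2 j) (b4 j).le hcx.le
    nlinarith
  have vx : 0 < vdm M (fun i => cx * Q ^ i) := by
    have p3 := altD_pos M cx _ hcx hQ0 hQ1 _ (sh_anti M (fun _ => 0) (by simp))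
    rwa [sh_zero, altD_zero] at p3
  have vy : 0 < vdm M (fun i => cy * R ^ i) := by
    have p3 := altD_pos M cy _ hcy hR0 hR1 _ (sh_anti M (fun _ => 0) (by simp))
    rwa [sh_zero, altD_zero] at p3
  have hcd := cauchy_det M (fun i => cx * Q ^ i) (fun i => cy * R ^ i) (fun i j => (hxy i j).ne')
  refine contour_fin M _ _ ?_ (fun i j => (hxy i j).ne') r₁ r₂ hr2 hr ?_ ?_ κ l _ _ (by omega) (by omega)
  · rw [hcd]
    have : 0 < ∏ i ∈ Finset.range M, ∏ j ∈ Finset.range M, (1 - cx * Q ^ i * (cy * R ^ j))⁻¹ :=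
      Finset.prod_pos fun i _ => Finset.prod_pos fun j _ => inv_pos.2 (hxy i j)
    positivity
  · intro i
    refine ⟨b3 i, lt_of_le_of_lt ?_ h1⟩
    exact mul_le_mul_of_nonneg_right (b1 i) (by linarith)
  · intro i
    exact ⟨b4 i, (b2 i).trans_lt h2⟩

/-- the diagonal slice point process `{Λ_{i,i} - i + 1/2 : i ≥ 1}` of a
Muttalib–Borodin plane partition is determinantal with kernel `K_d` (half-integers are
written as `κ + 1/2`; with 0-based `n = i - 1` the condition `Λ_{i,i} - i = κ` reads
`Λ.part n n - n - 1 = κ`). -/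
theorem statement18 (q a η θ : ℝ) (hq0 : 0 < q) (hq1 : q < 1) (ha0 : 0 < a) (ha1 : a ≤ 1)
    (hη : 0 < η) (hθ : 0 < θ) (m : ℕ) (hm : 0 < m)
    (κ : Fin m → ℤ) (hκ : Function.Injective κ) :
    ((mbProb q a η θ ⊤ ⊤
        {Λ | ∀ i : Fin m, ∃ n : ℕ, (Λ.part n n : ℤ) - (n : ℤ) - 1 = κ i} : ℝ) : ℂ) =
      Matrix.det (Matrix.of fun i j : Fin m => Kd q a η θ (κ i) (κ j)) := by
  have hQ0 : 0 < q ^ η := Real.rpow_pos_of_pos hq0 _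
  have hQ1 : q ^ η < 1 := Real.rpow_lt_one hq0.le hq1 hη
  have hR0 : 0 < q ^ θ := Real.rpow_pos_of_pos hq0 _
  have hR1 : q ^ θ < 1 := Real.rpow_lt_one hq0.le hq1 hθ
  have hs0 : 0 < Real.sqrt a := Real.sqrt_pos.2 ha0
  have hs1 : Real.sqrt a ≤ 1 := Real.sqrt_le_one.2 ha1
  have hQh0 : 0 < (q ^ η) ^ ((1 : ℝ) / 2) := Real.rpow_pos_of_pos hQ0 _
  have hRh0 : 0 < (q ^ θ) ^ ((1 : ℝ) / 2) := Real.rpow_pos_of_pos hR0 _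
  have hQh1 : (q ^ η) ^ ((1 : ℝ) / 2) < 1 := Real.rpow_lt_one hQ0.le hQ1 (by norm_num)
  have hRh1 : (q ^ θ) ^ ((1 : ℝ) / 2) < 1 := Real.rpow_lt_one hR0.le hR1 (by norm_num)
  obtain ⟨cx, hcxd⟩ : ∃ c, c = Real.sqrt a * (q ^ η) ^ ((1 : ℝ) / 2) := ⟨_, rfl⟩
  obtain ⟨cy, hcyd⟩ : ∃ c, c = Real.sqrt a * (q ^ θ) ^ ((1 : ℝ) / 2) := ⟨_, rfl⟩
  have hcx : 0 < cx := by rw [hcxd]; positivity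
  have hcy : 0 < cy := by rw [hcyd]; positivity
  have hcx1 : cx < 1 := by rw [hcxd]; nlinarith
  have hcy1 : cy < 1 := by rw [hcyd]; nlinarith
  have hc : a * Real.sqrt (q ^ η * q ^ θ) = cx * cy := by
    rw [hcxd, hcyd, ← Real.sqrt_eq_rpow, ← Real.sqrt_eq_rpow, Real.sqrt_mul hQ0.le]
    have := Real.mul_self_sqrt ha0.le
    calc _ = (Real.sqrt a * Real.sqrt a) * (Real.sqrt (q ^ η) * Real.sqrt (q ^ θ)) := by rw [this]
      _ = _ := by ring
  have hd : ddelta q a η θ = min ((1 - cy) / 2) ((cx⁻¹ - 1) / 2) := by rw [ddelta, ← hcxd, ← hcyd]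
  have hi : 1 < cx⁻¹ := (one_lt_inv₀ hcx).2 hcx1
  have hd0 : 0 < ddelta q a η θ := by
    rw [hd]; exact lt_min (by linarith) (by linarith)
  have hd1 : ddelta q a η θ ≤ (1 - cy) / 2 := by rw [hd]; exact min_le_left _ _
  have hd2 : ddelta q a η θ ≤ (cx⁻¹ - 1) / 2 := by rw [hd]; exact min_le_right _ _
  have h1 : cx * (1 + ddelta q a η θ) < 1 := by
    have := mul_le_mul_of_nonneg_left hd2 hcx.le
    have e : cx * ((cx⁻¹ - 1) / 2) = (1 - cx) / 2 := by field_simp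
    rw [e] at this
    nlinarith
  have hlim : ∀ k l : ℤ, Tendsto (fun M : ℕ => (KM M (fun i => cx * (q ^ η) ^ i) (fun i => cy * (q ^ θ) ^ i)
      (k + M).toNat (l + M).toNat : ℂ)) atTop (𝓝 (Kd q a η θ k l)) := by
    intro k l
    have := KM_lim cx cy (q ^ η) (q ^ θ) (1 + ddelta q a η θ) (1 - ddelta q a η θ) hcx hcy hcx1 hcy1 hQ0 hQ1
      hR0 hR1 (by linarith) (by linarith) h1 (by linarith) k l
    simp only [Kd, Fd, ← hcxd, ← hcyd]
    exact this
  have hre : ∀ k l : ℤ, Tendsto (fun M : ℕ => KM M (fun i => cx * (q ^ η) ^ i) (fun i => cy * (q ^ θ) ^ i)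
      (k + M).toNat (l + M).toNat) atTop (𝓝 (Kd q a η θ k l).re) := by
    intro k l
    have := (Complex.continuous_re.tendsto _).comp (hlim k l)
    exact this
  have hreal : ∀ k l : ℤ, Kd q a η θ k l = ((Kd q a η θ k l).re : ℂ) := by
    intro k l
    exact tendsto_nhds_unique (hlim k l) ((Complex.continuous_ofReal.tendsto _).comp (hre k l))
  rw [main_aux q a η θ cx cy hcx hcy hcx1 hcy1 hc hQ0 hQ1 hR0 hR1 ha0 m κ hκ
    (Matrix.of fun i j => (Kd q a η θ (κ i) (κ j)).re) (fun i j => hre _ _)]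
  change Complex.ofRealHom _ = _
  rw [RingHom.map_det]
  congr 1
  ext i j
  exact (hreal (κ i) (κ j)).symm


end
end
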